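/- arXiv:math/9810153 — 6 statements merged into one kernel-verified Lean document; each statement's English description precedes it below -/
import Mathlib

section
/- Let x = (x_0,…,x_5) ∈ ℂ^6 be nonzero with x_0+⋯+x_5 = 0 and x_0^3+⋯+x_5^3 = 0, i.e. a point of the Segre cubic S_3 ⊂ ℙ^5(ℂ). Then the Jacobian matrix of the pair of polynomials (x_0+⋯+x_5, x_0^3+⋯+x_5^3) at x has rank ≤ 1 (i.e. x is a singular point of S_3) if and only if there exist c ∈ ℂ, c ≠ 0, and a permutation π of {0,…,5} such that (x_{π(0)},…,x_{π(5)}) = (c,c,c,−c,−c,−c). Moreover, the set of such singular points, viewed in ℙ^5(ℂ) (i.e. up to nonzero scalar), has exactly 10 elements. -/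
open scoped LinearAlgebra.Projectivization

/-- The `2×6` Jacobian matrix of the pair `(x_0+⋯+x_5, x_0³+⋯+x_5³)` at `x`. -/
def segreJacobian (x : Fin 6 → ℂ) : Matrix (Fin 2) (Fin 6) ℂ :=
  Matrix.of fun k i => if k = 0 then 1 else 3 * x i ^ 2

/-- The Jacobian of the Segre cubic is degenerate exactly when all coordinates have the same
square. -/
theorem segreJacobian_rank_le_one_iff (x : Fin 6 → ℂ) :
    (segreJacobian x).rank ≤ 1 ↔ ∀ i j, x i ^ 2 = x j ^ 2 := by
  constructor
  · intro h i j
    by_contra hij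
    have hli : LinearIndependent ℂ (segreJacobian x).row := by
      have hrow : (segreJacobian x).row 0 ≠ 0 := fun h0 => by
        simpa [segreJacobian] using congrFun h0 0
      have hrows : (segreJacobian x).row = ![(segreJacobian x).row 0, (segreJacobian x).row 1] := by
        ext k
        fin_cases k <;> rfl
      rw [hrows, LinearIndependent.pair_iff' hrow]
      intro a ha
      have hi := congrFun ha i
      have hj := congrFun ha j
      simp only [segreJacobian, Matrix.row, Matrix.of_apply, Pi.smul_apply, smul_eq_mul,
        if_true, one_ne_zero, if_false, mul_one] at hi hj
      exact hij (mul_left_cancel₀ three_ne_zero (hi.symm.trans hj))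
    have := hli.rank_matrix
    simp only [Fintype.card_fin] at this
    omega
  · intro h
    have hJ : segreJacobian x = Matrix.vecMulVec ![1, 3 * x 0 ^ 2] 1 := by
      ext k i
      fin_cases k <;> simp [segreJacobian, Matrix.vecMulVec_apply, h i 0]
    rw [hJ]
    exact Matrix.rank_vecMulVec_le _ _

/-- The vector with coordinate `1` on `S` and `-1` off `S`. -/
def signVec (S : Finset (Fin 6)) : Fin 6 → ℂ :=
  fun i => if i ∈ S then 1 else -1

theorem signVec_sq (S : Finset (Fin 6)) (i : Fin 6) : signVec S i ^ 2 = 1 := by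
  unfold signVec; split_ifs <;> norm_num

theorem signVec_ne_zero (S : Finset (Fin 6)) : signVec S ≠ 0 := by
  intro h
  simpa [h] using signVec_sq S 0

theorem signVec_injective : Function.Injective signVec := by
  intro S T h
  ext i
  have h1 : (1 : ℂ) ≠ -1 := by norm_num
  have hi := congrFun h i
  unfold signVec at hi
  grind

theorem sum_signVec (S : Finset (Fin 6)) : ∑ i, signVec S i = 2 * S.card - 6 := by
  have h : ∀ i, signVec S i = 2 * (if i ∈ S then 1 else 0) - 1 := by
    intro i; unfold signVec; split_ifs <;> norm_num
  simp [h, Finset.sum_sub_distrib, mul_comm]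

/-- A nonzero vector with zero sum whose coordinates have equal squares is a multiple of a
balanced sign vector. -/
theorem exists_eq_smul_signVec {x : Fin 6 → ℂ} (hx : x ≠ 0) (hsum : ∑ i, x i = 0)
    (hsq : ∀ i j, x i ^ 2 = x j ^ 2) :
    x 0 ≠ 0 ∧ ∃ S : Finset (Fin 6), S.card = 3 ∧ 0 ∈ S ∧ x = x 0 • signVec S := by
  classical
  have h0 : x 0 ≠ 0 := by
    intro h0
    refine hx (funext fun i => ?_)
    simpa [h0] using hsq i 0
  set S : Finset (Fin 6) := {i | x i = x 0}
  have hxS : x = x 0 • signVec S := by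
    funext i
    by_cases hi : x i = x 0
    · simp [signVec, S, hi]
    · simpa [signVec, S, hi] using (sq_eq_sq_iff_eq_or_eq_neg.mp (hsq i 0)).resolve_left hi
  refine ⟨h0, S, ?_, by simp [S], hxS⟩
  have h : x 0 * (2 * S.card - 6) = 0 := by
    rw [← sum_signVec, Finset.mul_sum, ← hsum]
    exact Finset.sum_congr rfl fun i _ => (congrFun hxS i).symm
  have h' : (S.card : ℂ) = 3 := by
    linear_combination (1 / 2 : ℂ) * (mul_eq_zero.mp h).resolve_left h0
  exact_mod_cast h'

theorem exists_perm_mem_iff {α : Type*} [Fintype α] [DecidableEq α] {S T : Finset α}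
    (h : S.card = T.card) : ∃ π : Equiv.Perm α, ∀ i, π i ∈ T ↔ i ∈ S := by
  let e : {i // i ∈ S} ≃ {i // i ∈ T} := Finset.equivOfCardEq h
  refine ⟨e.extendSubtype, fun i => ⟨fun hi => ?_, e.extendSubtype_mem i⟩⟩
  by_contra hS
  exact e.extendSubtype_not_mem i hS hi

/-- The singular points of the Segre cubic are the classes of the balanced sign vectors whose
first coordinate is `1`. -/
theorem segre_singular_points_eq_image :
    {p : ℙ ℂ (Fin 6 → ℂ) |
        ∃ (x : Fin 6 → ℂ) (hx : x ≠ 0), (∑ i, x i) = 0 ∧ (∑ i, x i ^ 3) = 0 ∧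
          (segreJacobian x).rank ≤ 1 ∧ p = Projectivization.mk ℂ x hx} =
      (fun S => Projectivization.mk ℂ (signVec S) (signVec_ne_zero S)) ''
        ((Finset.powersetCard 3 Finset.univ).filter (0 ∈ ·) : Finset (Finset (Fin 6))) := by
  ext p
  simp only [Set.mem_ofPred_eq, Set.mem_image, Finset.mem_coe, Finset.mem_filter,
    Finset.mem_powersetCard, Finset.subset_univ, true_and]
  constructor
  · rintro ⟨x, hx, hsum, -, hrank, rfl⟩
    obtain ⟨-, S, hS, h0S, hxS⟩ :=
      exists_eq_smul_signVec hx hsum ((segreJacobian_rank_le_one_iff x).mp hrank)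
    exact ⟨S, ⟨hS, h0S⟩, ((Projectivization.mk_eq_mk_iff' ℂ _ _ _ _).mpr ⟨x 0, hxS.symm⟩).symm⟩
  · rintro ⟨S, ⟨hS, -⟩, rfl⟩
    have hsum : ∑ i, signVec S i = 0 := by rw [sum_signVec, hS]; norm_num
    refine ⟨signVec S, signVec_ne_zero S, hsum, ?_, ?_, rfl⟩
    · simpa only [pow_succ _ 2, signVec_sq, one_mul] using hsum
    · exact (segreJacobian_rank_le_one_iff _).mpr fun i j => by simp only [signVec_sq]

theorem injOn_mk_signVec :
    Set.InjOn (fun S => Projectivization.mk ℂ (signVec S) (signVec_ne_zero S))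
      {S : Finset (Fin 6) | 0 ∈ S} := by
  intro S hS T hT h
  obtain ⟨a, ha⟩ := (Projectivization.mk_eq_mk_iff' ℂ _ _ _ _).mp h
  have h0S : 0 ∈ S := hS
  have h0T : 0 ∈ T := hT
  have ha1 : a = 1 := by simpa [signVec, h0S, h0T] using congrFun ha 0
  exact signVec_injective (by rw [← ha, ha1, one_smul])

/-- A nonzero `x ∈ ℂ⁶` on the Segre cubic (`Σ x_i = Σ x_i³ = 0`) is a singular point
(the Jacobian of the defining equations has rank `≤ 1`) iff some permutation of its
coordinates equals `(c,c,c,−c,−c,−c)` for some `c ≠ 0`; moreover the set of singular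
points in `ℙ⁵(ℂ)` has exactly `10` elements. -/
theorem segre_cubic_singular_points :
    (∀ x : Fin 6 → ℂ, x ≠ 0 → (∑ i, x i) = 0 → (∑ i, x i ^ 3) = 0 →
      ((segreJacobian x).rank ≤ 1 ↔
        ∃ c : ℂ, c ≠ 0 ∧ ∃ π : Equiv.Perm (Fin 6),
          ∀ i : Fin 6, x (π i) = ![c, c, c, -c, -c, -c] i)) ∧
    ({p : ℙ ℂ (Fin 6 → ℂ) |
        ∃ (x : Fin 6 → ℂ) (hx : x ≠ 0), (∑ i, x i) = 0 ∧ (∑ i, x i ^ 3) = 0 ∧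
          (segreJacobian x).rank ≤ 1 ∧ p = Projectivization.mk ℂ x hx}.ncard = 10) := by
  refine ⟨fun x hx hsum _ => ?_, ?_⟩
  · rw [segreJacobian_rank_le_one_iff]
    constructor
    · intro hsq
      obtain ⟨h0, S, hS, -, hxS⟩ := exists_eq_smul_signVec hx hsum hsq
      obtain ⟨π, hπ⟩ := exists_perm_mem_iff (S := ({0, 1, 2} : Finset (Fin 6))) hS.symm
      refine ⟨x 0, h0, π, fun i => ?_⟩
      rw [congrFun hxS (π i), Pi.smul_apply, signVec, if_congr (hπ i) rfl rfl]
      fin_cases i <;> simp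
    · rintro ⟨c, -, π, hπ⟩
      have h : ∀ i, x i ^ 2 = c ^ 2 := by
        intro i
        obtain ⟨j, rfl⟩ := π.surjective i
        rw [hπ j]
        fin_cases j <;> simp
      exact fun i j => (h i).trans (h j).symm
  · rw [segre_singular_points_eq_image, Set.InjOn.ncard_image, Set.ncard_coe_finset]
    · decide
    · exact injOn_mk_signVec.mono fun S hS => (Finset.mem_filter.mp hS).2
end

section
/- Let G(x_0,…,x_4) = Σ_{i=0}^4 x_i^3 − (x_0+⋯+x_4)^3, a homogeneous cubic form on ℂ^5 defining the Segre cubic as a hypersurface in ℙ^4(ℂ). If F is any nonzero homogeneous cubic form on ℂ^5 such that every singular point of the hypersurface {F = 0} ⊂ ℙ^4(ℂ) is a node, then {F = 0} has at most 10 singular points; and if it has exactly 10 singular points, then there exist T ∈ GL(5,ℂ) and c ∈ ℂ, c ≠ 0, such that F(T·x) = c·G(x) for all x ∈ ℂ^5 (i.e. {F=0} is projectively equivalent to the Segre cubic). -/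
open scoped LinearAlgebra.Projectivization
open MvPolynomial

/-- The set of singular points in `ℙ⁴(ℂ)` of the hypersurface `{F = 0}`: points with a
nonzero representative at which all five partial derivatives of `F` vanish. -/
def projSing (F : MvPolynomial (Fin 5) ℂ) : Set (ℙ ℂ (Fin 5 → ℂ)) :=
  {p | ∃ (v : Fin 5 → ℂ) (hv : v ≠ 0), p = Projectivization.mk ℂ v hv ∧
    ∀ i : Fin 5, eval v (pderiv i F) = 0}

/-- The Hessian matrix of `F` at `v`. -/
noncomputable def hessianAt (F : MvPolynomial (Fin 5) ℂ) (v : Fin 5 → ℂ) : Matrix (Fin 5) (Fin 5) ℂ :=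
  Matrix.of fun i j => eval v (pderiv i (pderiv j F))

/-- A point of `ℙ⁴(ℂ)` is a node of `{F = 0}` if it is a singular point and the Hessian
of `F` at (any nonzero representative of) the point has rank exactly `4`. -/
def IsNode (F : MvPolynomial (Fin 5) ℂ) (p : ℙ ℂ (Fin 5 → ℂ)) : Prop :=
  p ∈ projSing F ∧ ∀ (v : Fin 5 → ℂ) (hv : v ≠ 0),
    p = Projectivization.mk ℂ v hv → (hessianAt F v).rank = 4

/-- The Segre cubic form `G(x) = Σ x_i³ − (Σ x_i)³` on `ℂ⁵`. -/
noncomputable def segreCubicForm : MvPolynomial (Fin 5) ℂ :=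
  (∑ i : Fin 5, X i ^ 3) - (∑ i : Fin 5, X i) ^ 3

/-- The discriminant (up to a factor) of the binary cubic with coefficients
`a, 3b, 3c, d`. -/
def cubicDisc {R : Type*} [CommRing R] (a b c d : R) : R :=
  a ^ 2 * d ^ 2 - 6 * a * b * c * d + 4 * a * c ^ 3 + 4 * b ^ 3 * d - 3 * b ^ 2 * c ^ 2

theorem cubicDisc_translate {R : Type*} [CommRing R] (a b c d t : R) :
    cubicDisc (a + 3 * t * b + 3 * t ^ 2 * c + t ^ 3 * d) (b + 2 * t * c + t ^ 2 * d)
      (c + t * d) d = cubicDisc a b c d := by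
  simp only [cubicDisc]; ring

theorem cubicDisc_reverse {R : Type*} [CommRing R] (a b c d : R) :
    cubicDisc d c b a = cubicDisc a b c d := by
  simp only [cubicDisc]; ring

theorem exists_double_root_of_cubicDisc_eq_zero {a b c d : ℂ} (h : cubicDisc a b c d = 0) :
    (∃ t, a + 3 * t * b + 3 * t ^ 2 * c + t ^ 3 * d = 0 ∧ b + 2 * t * c + t ^ 2 * d = 0) ∨
      (c = 0 ∧ d = 0) := by
  simp only [cubicDisc] at h
  by_cases hd : d = 0
  · by_cases hc : c = 0
    · exact Or.inr ⟨hc, hd⟩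
    · subst hd
      have h' : 4 * a * c = 3 * b ^ 2 := by
        apply mul_left_cancel₀ (pow_ne_zero 2 hc)
        linear_combination h
      obtain ⟨t, ht⟩ : ∃ t, 2 * t * c = -b := ⟨-b / (2 * c), by field_simp⟩
      refine Or.inl ⟨t, ?_, by linear_combination ht⟩
      apply mul_left_cancel₀ hc
      linear_combination h' / 4 + (3 * b / 2 + 3 / 4 * (2 * t * c - b)) * ht
  · by_cases hq : b * d - c ^ 2 = 0
    · have hb : b = c ^ 2 / d := by field_simp; linear_combination hq
      have had : a * d - b * c = 0 := by
        have : (a * d - b * c) ^ 2 = 0 := by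
          linear_combination h + 4 * (a * c - b ^ 2) * hq
        exact pow_eq_zero_iff (two_ne_zero) |>.1 this
      have ha : a = c ^ 3 / d ^ 2 := by
        rw [hb] at had
        field_simp at had ⊢
        linear_combination had
      refine Or.inl ⟨-c / d, ?_, ?_⟩
      · rw [ha, hb]; field_simp; ring
      · rw [hb]; field_simp; ring
    · have hD : (a * d - b * c) ^ 2 = 4 * (a * c - b ^ 2) * (b * d - c ^ 2) := by
        linear_combination h
      obtain ⟨t, ht⟩ : ∃ t, 2 * t * (b * d - c ^ 2) = -(a * d - b * c) :=
        ⟨-(a * d - b * c) / (2 * (b * d - c ^ 2)), by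
          rw [mul_right_comm, mul_div_cancel₀ _ (mul_ne_zero two_ne_zero hq)]⟩
      have h1 : t ^ 2 * (b * d - c ^ 2) = a * c - b ^ 2 := by
        apply mul_left_cancel₀ (mul_ne_zero (by norm_num : (4 : ℂ) ≠ 0) hq)
        linear_combination (2 * t * (b * d - c ^ 2) - (a * d - b * c)) * ht + hD
      have h2 : b + 2 * t * c + t ^ 2 * d = 0 := by
        apply mul_left_cancel₀ hq
        linear_combination d * h1 + c * ht
      have h3 : a + 2 * t * b + t ^ 2 * c = 0 := by
        apply mul_left_cancel₀ hq
        linear_combination c * h1 + b * ht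
      exact Or.inl ⟨t, by linear_combination h3 + t * h2, h2⟩

theorem eq_zero_of_two_double_roots {a b c d t u : ℂ} (htu : t ≠ u)
    (ht : a + 3 * t * b + 3 * t ^ 2 * c + t ^ 3 * d = 0) (ht' : b + 2 * t * c + t ^ 2 * d = 0)
    (hu : a + 3 * u * b + 3 * u ^ 2 * c + u ^ 3 * d = 0) (hu' : b + 2 * u * c + u ^ 2 * d = 0) :
    a = 0 ∧ b = 0 ∧ c = 0 ∧ d = 0 := by
  have h0 : t - u ≠ 0 := sub_ne_zero.2 htu
  have h1 : 2 * c + (t + u) * d = 0 := by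
    apply mul_left_cancel₀ h0
    linear_combination ht' - hu'
  have hd : d = 0 := by
    apply mul_left_cancel₀ (pow_ne_zero 3 h0)
    linear_combination (-2) * (ht - hu) + 6 * (t * ht' - u * hu') - 3 * (t + u) * (t - u) * h1
  subst hd
  have hc : c = 0 := by linear_combination h1 / 2
  subst hc
  have hb : b = 0 := by linear_combination ht'
  subst hb
  exact ⟨by linear_combination ht, rfl, rfl, rfl⟩

theorem eq_zero_of_double_root_of_cubicDisc_ne_zero {a b e h c d : ℂ}
    (hD : cubicDisc a b e h ≠ 0) (h1 : c ^ 2 * a + 2 * c * d * b + d ^ 2 * e = 0)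
    (h2 : c ^ 2 * b + 2 * c * d * e + d ^ 2 * h = 0) : c = 0 ∧ d = 0 := by
  have hc : c = 0 := by
    by_contra hc
    apply hD
    obtain ⟨t, rfl⟩ : ∃ t, d = t * c := ⟨d / c, by field_simp⟩
    have hb : b = -2 * t * e - t ^ 2 * h := by
      apply mul_left_cancel₀ (pow_ne_zero 2 hc)
      linear_combination h2
    have ha : a = -2 * t * b - t ^ 2 * e := by
      apply mul_left_cancel₀ (pow_ne_zero 2 hc)
      linear_combination h1
    rw [ha, hb, cubicDisc]
    ring
  subst hc
  refine ⟨rfl, ?_⟩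
  by_contra hd
  apply hD
  have he : e = 0 := by simpa [hd] using h1
  have hh : h = 0 := by simpa [hd] using h2
  simp [cubicDisc, he, hh]

namespace Polynomial

open scoped Polynomial

theorem simple_tangency_of_cubicDisc_eq_zero {A B C' D : ℂ[X]} {x : ℂ}
    (hdisc : cubicDisc A B C' D = 0) (hA : A.eval x = 0) (hB : B.eval x = 0)
    (hCD : ¬ (C'.eval x = 0 ∧ D.eval x = 0)) :
    A.derivative.eval x = 0 ∧
      2 * A.derivative.derivative.eval x * C'.eval x = 3 * B.derivative.eval x ^ 2 := by
  obtain ⟨A, rfl⟩ := dvd_iff_isRoot.2 hA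
  obtain ⟨B, rfl⟩ := dvd_iff_isRoot.2 hB
  have hX : (X - C x : ℂ[X]) ≠ 0 := X_sub_C_ne_zero x
  simp only [cubicDisc] at hdisc
  by_cases hC : C'.eval x = 0
  · have hD : D.eval x ≠ 0 := fun h => hCD ⟨hC, h⟩
    obtain ⟨C', rfl⟩ := dvd_iff_isRoot.2 hC
    have e1 : A ^ 2 * D ^ 2 + (X - C x) * (-6 * A * B * C' * D + 4 * (X - C x) * A * C' ^ 3 +
        4 * B ^ 3 * D - 3 * (X - C x) * B ^ 2 * C' ^ 2) = 0 := by
      apply mul_left_cancel₀ (pow_ne_zero 2 hX)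
      linear_combination hdisc
    have hA1 : A.eval x = 0 := by
      have := congrArg (eval x) e1
      simpa [hD] using this
    obtain ⟨A, rfl⟩ := dvd_iff_isRoot.2 hA1
    have e2 : 4 * B ^ 3 * D + (X - C x) * (A ^ 2 * D ^ 2 - 6 * A * B * C' * D +
        4 * (X - C x) * A * C' ^ 3 - 3 * B ^ 2 * C' ^ 2) = 0 := by
      apply mul_left_cancel₀ hX
      linear_combination e1
    have hB1 : B.eval x = 0 := by
      have := congrArg (eval x) e2
      simpa [hD] using this
    simp [hB1]
  · have e1 : 4 * A * C' ^ 3 + (X - C x) * (A ^ 2 * D ^ 2 - 6 * A * B * C' * D +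
        4 * (X - C x) * B ^ 3 * D - 3 * B ^ 2 * C' ^ 2) = 0 := by
      apply mul_left_cancel₀ hX
      linear_combination hdisc
    have hA1 : A.eval x = 0 := by
      have := congrArg (eval x) e1
      simpa [hC] using this
    obtain ⟨A, rfl⟩ := dvd_iff_isRoot.2 hA1
    have e2 : 4 * A * C' ^ 3 - 3 * B ^ 2 * C' ^ 2 + (X - C x) * ((X - C x) * A ^ 2 * D ^ 2
        - 6 * A * B * C' * D + 4 * B ^ 3 * D) = 0 := by
      apply mul_left_cancel₀ hX
      linear_combination e1
    have h3 : 4 * A.eval x * C'.eval x = 3 * B.eval x ^ 2 := by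
      have := congrArg (eval x) e2
      simp at this
      apply mul_left_cancel₀ (pow_ne_zero 2 hC)
      linear_combination this
    constructor
    · simp
    · simp
      linear_combination h3

/-- The affine singular points of the curve `A(x) + 3 B(x) t + 3 C(x) t² + D(x) t³ = 0`. -/
def curveSing (A B C' D : ℂ[X]) : Set (ℂ × ℂ) :=
  {q | A.eval q.1 + 3 * q.2 * B.eval q.1 + 3 * q.2 ^ 2 * C'.eval q.1 + q.2 ^ 3 * D.eval q.1 = 0 ∧
    B.eval q.1 + 2 * q.2 * C'.eval q.1 + q.2 ^ 2 * D.eval q.1 = 0 ∧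
    A.derivative.eval q.1 + 3 * q.2 * B.derivative.eval q.1 +
      3 * q.2 ^ 2 * C'.derivative.eval q.1 + q.2 ^ 3 * D.derivative.eval q.1 = 0}

/-- All affine singular points of `A(x) + 3 B(x) t + 3 C(x) t² + D(x) t³ = 0` are ordinary
double points. -/
def IsNodalCurve (A B C' D : ℂ[X]) : Prop :=
  ∀ q ∈ curveSing A B C' D,
    2 * (A.derivative.derivative.eval q.1 + 3 * q.2 * B.derivative.derivative.eval q.1 +
      3 * q.2 ^ 2 * C'.derivative.derivative.eval q.1 +
      q.2 ^ 3 * D.derivative.derivative.eval q.1) * (C'.eval q.1 + q.2 * D.eval q.1) ≠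
    3 * (B.derivative.eval q.1 + 2 * q.2 * C'.derivative.eval q.1 +
      q.2 ^ 2 * D.derivative.eval q.1) ^ 2

theorem IsNodalCurve.exists_fibre_ne_zero {A B C' D : ℂ[X]} (h : IsNodalCurve A B C' D) :
    ∃ x, ¬ (A.eval x = 0 ∧ B.eval x = 0 ∧ C'.eval x = 0 ∧ D.eval x = 0) := by
  by_contra! hz
  have hA : A = 0 := funext fun x => by simpa using (hz x).1
  have hB : B = 0 := funext fun x => by simpa using (hz x).2.1
  have hC : C' = 0 := funext fun x => by simpa using (hz x).2.2.1
  have hD : D = 0 := funext fun x => by simpa using (hz x).2.2.2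
  subst hA hB hC hD
  exact h (0, 0) (by simp [curveSing]) (by simp)

theorem IsNodalCurve.cubicDisc_ne_zero {A B C' D : ℂ[X]} (h : IsNodalCurve A B C' D)
    (h' : IsNodalCurve D C' B A) : cubicDisc A B C' D ≠ 0 := by
  intro hdisc
  obtain ⟨x, hx⟩ := h.exists_fibre_ne_zero
  have hdx : cubicDisc (A.eval x) (B.eval x) (C'.eval x) (D.eval x) = 0 := by
    have := congrArg (eval x) hdisc
    simpa [cubicDisc] using this
  rcases exists_double_root_of_cubicDisc_eq_zero hdx with ⟨t, ht1, ht2⟩ | ⟨hc, hd⟩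
  · have hdisc' := cubicDisc_translate A B C' D (C t)
    rw [hdisc] at hdisc'
    obtain ⟨h1, h2⟩ := simple_tangency_of_cubicDisc_eq_zero (x := x) hdisc'
      (by simpa using ht1) (by simpa using ht2) (by
        rintro ⟨h3, h4⟩
        simp only [eval_add, eval_mul, eval_C] at h3
        have hc : C'.eval x = 0 := by simpa [h4] using h3
        have hb : B.eval x = 0 := by simpa [h4, hc] using ht2
        have ha : A.eval x = 0 := by simpa [h4, hc, hb] using ht1
        exact hx ⟨ha, hb, hc, h4⟩)
    refine h (x, t) ⟨ht1, ht2, ?_⟩ ?_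
    · simpa [derivative_pow] using h1
    · simpa [derivative_pow] using h2
  · rw [← cubicDisc_reverse] at hdisc
    obtain ⟨h1, h2⟩ := simple_tangency_of_cubicDisc_eq_zero (x := x) hdisc hd hc
      (fun h3 => hx ⟨h3.2, h3.1, hc, hd⟩)
    refine h' (x, 0) ⟨by simpa using hd, by simpa using hc, by simpa using h1⟩ ?_
    simpa using h2

theorem natDegree_cubicDisc_le {A B C' D : ℂ[X]} (hA : A.natDegree ≤ 3) (hB : B.natDegree ≤ 3)
    (hC : C'.natDegree ≤ 3) (hD : D.natDegree ≤ 3) : (cubicDisc A B C' D).natDegree ≤ 12 := by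
  have h6 : (6 : ℂ[X]).natDegree = 0 := natDegree_ofNat 6
  have h4 : (4 : ℂ[X]).natDegree = 0 := natDegree_ofNat 4
  have h3 : (3 : ℂ[X]).natDegree = 0 := natDegree_ofNat 3
  have hm : ∀ {p q : ℂ[X]} {m n k : ℕ}, p.natDegree ≤ m → q.natDegree ≤ n → m + n = k →
      (p * q).natDegree ≤ k := fun hp hq hk => hk ▸ natDegree_mul_le_of_le hp hq
  have hp : ∀ {p : ℂ[X]} (n : ℕ), p.natDegree ≤ 3 → (p ^ n).natDegree ≤ n * 3 :=
    fun n h => natDegree_pow_le_of_le n h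
  have ha : ∀ {p q : ℂ[X]}, p.natDegree ≤ 12 → q.natDegree ≤ 12 → (p + q).natDegree ≤ 12 :=
    fun hp hq => (natDegree_add_le _ _).trans (max_le hp hq)
  have hs : ∀ {p q : ℂ[X]}, p.natDegree ≤ 12 → q.natDegree ≤ 12 → (p - q).natDegree ≤ 12 :=
    fun hp hq => (natDegree_sub_le _ _).trans (max_le hp hq)
  refine hs (ha (ha (hs ?_ ?_) ?_) ?_) ?_
  · exact hm (hp 2 hA) (hp 2 hD) rfl
  · exact hm (hm (hm (hm h6.le hA rfl) hB rfl) hC rfl) hD rfl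
  · exact hm (hm h4.le hA rfl) (hp 3 hC) rfl
  · exact hm (hm h4.le (hp 3 hB) rfl) hD rfl
  · exact hm (hm h3.le (hp 2 hB) rfl) (hp 2 hC) rfl

theorem sq_dvd_cubicDisc {A B C' D : ℂ[X]} {x t : ℂ} (h : (x, t) ∈ curveSing A B C' D) :
    (X - C x) ^ 2 ∣ cubicDisc A B C' D := by
  obtain ⟨h1, h2, h3⟩ := h
  rw [← cubicDisc_translate A B C' D (C t)]
  obtain ⟨A₁, hA₁⟩ : (X - C x) ∣ A + 3 * C t * B + 3 * C t ^ 2 * C' + C t ^ 3 * D :=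
    dvd_iff_isRoot.2 (by simpa using h1)
  obtain ⟨B₁, hB₁⟩ : (X - C x) ∣ B + 2 * C t * C' + C t ^ 2 * D :=
    dvd_iff_isRoot.2 (by simpa using h2)
  obtain ⟨A₂, rfl⟩ : (X - C x) ∣ A₁ := dvd_iff_isRoot.2 (by
    have := congrArg (fun p => eval x (derivative p)) hA₁
    simp [derivative_pow] at this
    simp only at h3
    rw [IsRoot, ← this]
    linear_combination h3)
  rw [hA₁, hB₁]
  generalize C' + C t * D = E
  unfold cubicDisc
  exact ⟨(X - C x) ^ 2 * A₂ ^ 2 * D ^ 2 - 6 * (X - C x) * A₂ * B₁ * E * D + 4 * A₂ * E ^ 3 +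
    4 * (X - C x) * B₁ ^ 3 * D - 3 * B₁ ^ 2 * E ^ 2, by ring⟩

theorem pow_four_dvd_cubicDisc {A B C' D : ℂ[X]} {x : ℂ} (hA : A.eval x = 0)
    (hB : B.eval x = 0) (hC : C'.eval x = 0) (hD : D.eval x = 0) :
    (X - C x) ^ 4 ∣ cubicDisc A B C' D := by
  obtain ⟨A, rfl⟩ := dvd_iff_isRoot.2 hA
  obtain ⟨B, rfl⟩ := dvd_iff_isRoot.2 hB
  obtain ⟨C', rfl⟩ := dvd_iff_isRoot.2 hC
  obtain ⟨D, rfl⟩ := dvd_iff_isRoot.2 hD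
  exact ⟨cubicDisc A B C' D, by unfold cubicDisc; ring⟩

theorem IsNodalCurve.fibre_finite_of_eq_zero {A B C' D : ℂ[X]} (h : IsNodalCurve A B C' D)
    {x : ℂ} (hA : A.eval x = 0) (hB : B.eval x = 0) (hC : C'.eval x = 0) (hD : D.eval x = 0) :
    ∃ s : Finset ℂ, s.card ≤ 3 ∧ ∀ t, (x, t) ∈ curveSing A B C' D → t ∈ s := by
  set g : ℂ[X] := C (A.derivative.eval x) + C (3 * B.derivative.eval x) * X +
    C (3 * C'.derivative.eval x) * X ^ 2 + C (D.derivative.eval x) * X ^ 3 with hg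
  have hdeg : g.natDegree ≤ 3 := by rw [hg]; compute_degree
  have hg0 : g ≠ 0 := by
    intro hg0
    have h0 : A.derivative.eval x = 0 := by
      have := congrArg (coeff · 0) hg0
      simpa [hg, coeff_X, coeff_X_pow] using this
    have h1 : B.derivative.eval x = 0 := by
      have := congrArg (fun p => eval 0 (derivative p)) hg0
      simpa [hg] using this
    refine h (x, 0) ⟨?_, ?_, ?_⟩ ?_ <;> simp [hA, hB, hC, hD, h0, h1]
  refine ⟨g.roots.toFinset, (Multiset.toFinset_card_le _).trans ((card_roots' g).trans hdeg), ?_⟩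
  rintro t ⟨-, -, h3⟩
  rw [Multiset.mem_toFinset, mem_roots hg0, IsRoot, hg]
  simp at h3 ⊢
  linear_combination h3

theorem fibre_finite_of_ne_zero {A B C' D : ℂ[X]}
    {x : ℂ} (hx : ¬ (A.eval x = 0 ∧ B.eval x = 0 ∧ C'.eval x = 0 ∧ D.eval x = 0)) :
    ∃ s : Finset ℂ, s.card ≤ 1 ∧ ∀ t, (x, t) ∈ curveSing A B C' D → t ∈ s := by
  by_cases hne : ∃ t, (x, t) ∈ curveSing A B C' D
  · obtain ⟨t, ht⟩ := hne
    refine ⟨{t}, by simp, fun u hu => ?_⟩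
    rw [Finset.mem_singleton]
    by_contra htu
    exact hx (eq_zero_of_two_double_roots htu hu.1 hu.2.1 ht.1 ht.2.1)
  · exact ⟨∅, by simp, fun t ht => (hne ⟨t, ht⟩).elim⟩

open Classical in
/-- A nodal `(3,3)`-curve has at most nine affine singular points, and if it has nine then it
contains three lines of each ruling. -/
theorem IsNodalCurve.ncard_curveSing_le {A B C' D : ℂ[X]} (h : IsNodalCurve A B C' D)
    (hdisc : cubicDisc A B C' D ≠ 0) (hA : A.natDegree ≤ 3) (hB : B.natDegree ≤ 3)
    (hC : C'.natDegree ≤ 3) (hD : D.natDegree ≤ 3) :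
    (curveSing A B C' D).Finite ∧ (curveSing A B C' D).ncard ≤ 9 ∧
      ((curveSing A B C' D).ncard = 9 → ∃ x₁ x₂ x₃ : ℂ, x₁ ≠ x₂ ∧ x₁ ≠ x₃ ∧ x₂ ≠ x₃ ∧
        ∀ x, x = x₁ ∨ x = x₂ ∨ x = x₃ →
          A.eval x = 0 ∧ B.eval x = 0 ∧ C'.eval x = 0 ∧ D.eval x = 0) := by
  set P : ℂ → Prop := fun x => A.eval x = 0 ∧ B.eval x = 0 ∧ C'.eval x = 0 ∧ D.eval x = 0 with hP
  set R := (cubicDisc A B C' D).roots.toFinset with hR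
  set Z := R.filter P with hZ
  have hfib : ∀ x, ∃ s : Finset ℂ, (s.card ≤ if P x then 3 else 1) ∧
      ∀ t, (x, t) ∈ curveSing A B C' D ↔ t ∈ s := by
    intro x
    have : ∃ s : Finset ℂ, (s.card ≤ if P x then 3 else 1) ∧
      ∀ t, (x, t) ∈ curveSing A B C' D → t ∈ s := by
      by_cases hx : P x
      · simpa [hx] using h.fibre_finite_of_eq_zero hx.1 hx.2.1 hx.2.2.1 hx.2.2.2
      · simpa only [hx, if_false] using fibre_finite_of_ne_zero hx
    obtain ⟨s, hs, hs'⟩ := this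
    refine ⟨s.filter fun t => (x, t) ∈ curveSing A B C' D,
      (Finset.card_le_card (Finset.filter_subset _ _)).trans hs, fun t => ?_⟩
    simp only [Finset.mem_filter]
    exact ⟨fun ht => ⟨hs' t ht, ht⟩, fun ht => ht.2⟩
  choose s hs hs' using hfib
  have hmult : ∀ x, 2 * (s x).card ≤ (cubicDisc A B C' D).rootMultiplicity x +
      if P x then 2 else 0 := by
    intro x
    by_cases hx : P x
    · have h1 := hs x
      have h2 := (le_rootMultiplicity_iff hdisc).2
        (pow_four_dvd_cubicDisc hx.1 hx.2.1 hx.2.2.1 hx.2.2.2)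
      simp only [hx, if_true] at h1 ⊢
      omega
    · have h1 := hs x
      simp only [hx, if_false] at h1 ⊢
      rcases (s x).eq_empty_or_nonempty with h0 | ⟨t, ht⟩
      · simp [h0]
      · have h2 := (le_rootMultiplicity_iff hdisc).2 (sq_dvd_cubicDisc ((hs' x t).2 ht))
        omega
  have hset : curveSing A B C' D = ((R.sigma s).image fun q => (q.1, q.2) : Finset (ℂ × ℂ)) := by
    ext ⟨x, t⟩
    simp only [Finset.coe_image, Set.mem_image, Finset.mem_coe, Finset.mem_sigma, Prod.mk.injEq]
    constructor
    · intro hq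
      refine ⟨⟨x, t⟩, ⟨?_, (hs' x t).1 hq⟩, rfl, rfl⟩
      rw [hR, Multiset.mem_toFinset, mem_roots hdisc, ← dvd_iff_isRoot]
      exact (dvd_pow_self _ two_ne_zero).trans (sq_dvd_cubicDisc hq)
    · rintro ⟨⟨x', t'⟩, ⟨-, h2⟩, rfl, rfl⟩
      exact (hs' _ _).2 h2
  have hcard : (curveSing A B C' D).ncard ≤ ∑ x ∈ R, (s x).card := by
    rw [hset, Set.ncard_coe_finset]
    exact Finset.card_image_le.trans (Finset.card_sigma _ _).le
  have hsum : ∑ x ∈ R, (cubicDisc A B C' D).rootMultiplicity x ≤ 12 := by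
    simp only [← count_roots]
    rw [hR, Multiset.toFinset_sum_count_eq]
    exact (card_roots' _).trans (natDegree_cubicDisc_le hA hB hC hD)
  have hZ3 : Z.card ≤ 3 := by
    obtain ⟨x, hx⟩ := h.exists_fibre_ne_zero
    have key : ∀ p : ℂ[X], p.natDegree ≤ 3 → (∀ x, P x → p.eval x = 0) → p.eval x ≠ 0 →
        Z.card ≤ 3 := by
      intro p hp hPp hpx
      have hp0 : p ≠ 0 := by rintro rfl; simp at hpx
      refine (Finset.card_le_card (t := p.roots.toFinset) fun y hy => ?_).trans
        ((Multiset.toFinset_card_le _).trans ((card_roots' p).trans hp))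
      rw [Multiset.mem_toFinset, mem_roots hp0]
      exact hPp y (Finset.mem_filter.1 hy).2
    by_contra hlt
    refine hx ⟨?_, ?_, ?_, ?_⟩ <;> by_contra hne
    · exact hlt (key A hA (fun _ h => h.1) hne)
    · exact hlt (key B hB (fun _ h => h.2.1) hne)
    · exact hlt (key C' hC (fun _ h => h.2.2.1) hne)
    · exact hlt (key D hD (fun _ h => h.2.2.2) hne)
  have htotal : 2 * ∑ x ∈ R, (s x).card ≤ 12 + 2 * Z.card := by
    calc 2 * ∑ x ∈ R, (s x).card ≤ ∑ x ∈ R, ((cubicDisc A B C' D).rootMultiplicity x +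
          if P x then 2 else 0) := by
            rw [Finset.mul_sum]; exact Finset.sum_le_sum fun x _ => hmult x
      _ ≤ 12 + 2 * Z.card := by
        rw [Finset.sum_add_distrib, ← Finset.sum_filter, Finset.sum_const, smul_eq_mul, ← hZ]
        omega
  refine ⟨by rw [hset]; exact Finset.finite_toSet _, by omega, fun h9 => ?_⟩
  obtain ⟨x₁, x₂, x₃, h12, h13, h23, hZe⟩ := Finset.card_eq_three.1
    (show Z.card = 3 by omega)
  refine ⟨x₁, x₂, x₃, h12, h13, h23, fun x hx => ?_⟩
  have : x ∈ Z := by rw [hZe]; simpa using hx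
  exact (Finset.mem_filter.1 this).2

end Polynomial

section Frames

variable {V : Type*} [AddCommGroup V] [Module ℂ V]

/-- A symmetric trilinear form whose associated cubic hypersurface has only nodes as
singularities. -/
structure IsNodalForm (T : V →ₗ[ℂ] V →ₗ[ℂ] V →ₗ[ℂ] ℂ) : Prop where
  swap₁₂ : ∀ x y z, T x y z = T y x z
  swap₂₃ : ∀ x y z, T x y z = T x z y
  node : ∀ v, v ≠ 0 → (∀ z, T v v z = 0) → ∀ w, (∀ z, T v w z = 0) → ∃ k : ℂ, w = k • v

/-- A spanning family `p, a, b, c, d` such that `p` is a singular point of the cubic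
hypersurface and the polar quadric of `p` is `x_a x_d - x_b x_c`. The isotropic vectors modulo `p`
are then `s₀t₀ a + s₀t₁ b + s₁t₀ c + s₁t₁ d`. -/
structure IsFrame (T : V →ₗ[ℂ] V →ₗ[ℂ] V →ₗ[ℂ] ℂ) (p a b c d : V) : Prop where
  pp : ∀ z, T p p z = 0
  aa : T p a a = 0
  bb : T p b b = 0
  cc : T p c c = 0
  dd : T p d d = 0
  ab : T p a b = 0
  ac : T p a c = 0
  bd : T p b d = 0
  cd : T p c d = 0
  ad : T p a d = 1
  bc : T p b c = -1
  span : ∀ v, ∃ x₀ x₁ x₂ x₃ x₄ : ℂ, v = x₀ • p + x₁ • a + x₂ • b + x₃ • c + x₄ • d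

variable {T : V →ₗ[ℂ] V →ₗ[ℂ] V →ₗ[ℂ] ℂ} {p a b c d : V}

namespace IsFrame

theorem swap (hT : IsNodalForm T) (h : IsFrame T p a b c d) : IsFrame T p a c b d where
  pp := h.pp
  aa := h.aa
  bb := h.cc
  cc := h.bb
  dd := h.dd
  ab := h.ac
  ac := h.ab
  bd := h.cd
  cd := h.bd
  ad := h.ad
  bc := by rw [hT.swap₂₃, h.bc]
  span v := by
    obtain ⟨x₀, x₁, x₂, x₃, x₄, rfl⟩ := h.span v
    exact ⟨x₀, x₁, x₃, x₂, x₄, by module⟩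

theorem shift (hT : IsNodalForm T) (h : IsFrame T p a b c d) (x : ℂ) :
    IsFrame T p (a + x • c) (b + x • d) c d := by
  have ca : T p c a = 0 := by rw [hT.swap₂₃, h.ac]
  have da : T p d a = 1 := by rw [hT.swap₂₃, h.ad]
  have db : T p d b = 0 := by rw [hT.swap₂₃, h.bd]
  have cb : T p c b = -1 := by rw [hT.swap₂₃, h.bc]
  refine ⟨h.pp, ?_, ?_, h.cc, h.dd, ?_, ?_, ?_, h.cd, ?_, ?_, fun v => ?_⟩
  · simp [h.aa, h.ac, h.cc, ca]
  · simp [h.bb, h.bd, h.dd, db]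
  · simp [h.ab, h.ad, h.cd, cb]
  · simp [h.ac, h.cc]
  · simp [h.bd, h.dd]
  · simp [h.ad, h.cd]
  · have dc : T p d c = 0 := by rw [hT.swap₂₃, h.cd]
    simp [h.bc, dc]
  · obtain ⟨x₀, x₁, x₂, x₃, x₄, rfl⟩ := h.span v
    exact ⟨x₀, x₁, x₂, x₃ - x * x₁, x₄ - x * x₂, by module⟩

theorem flip (hT : IsNodalForm T) (h : IsFrame T p a b c d) : IsFrame T (-p) b a d c where
  pp z := by simp [h.pp]
  aa := by simp [h.bb]
  bb := by simp [h.aa]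
  cc := by simp [h.dd]
  dd := by simp [h.cc]
  ab := by simp [hT.swap₂₃ p b a, h.ab]
  ac := by simp [h.bd]
  bd := by simp [h.ac]
  cd := by simp [hT.swap₂₃ p d c, h.cd]
  ad := by simp [h.bc]
  bc := by simp [h.ad]
  span v := by
    obtain ⟨x₀, x₁, x₂, x₃, x₄, rfl⟩ := h.span v
    exact ⟨-x₀, x₂, x₁, x₄, x₃, by module⟩

theorem apply_eq_zero (h : IsFrame T p a b c d) {x y : V} (hp : T x y p = 0) (ha : T x y a = 0)
    (hb : T x y b = 0) (hc : T x y c = 0) (hd : T x y d = 0) (z : V) : T x y z = 0 := by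
  obtain ⟨x₀, x₁, x₂, x₃, x₄, rfl⟩ := h.span z
  simp [hp, ha, hb, hc, hd]

theorem nondegenerate (hT : IsNodalForm T) (h : IsFrame T p a b c d) (haaa : T a a a = 0)
    (haab : T a a b = 0) (haac : T a a c = 0) :
    4 * T a b b * T a c c ≠ (2 * T a b c + T a a d) ^ 2 := by
  intro hdeg
  have h12 := hT.swap₁₂
  have h23 := hT.swap₂₃
  obtain ⟨hpp, haa, hbb, hcc, hdd, hab, hac, hbd, hcd, had, hbc, -⟩ := id h
  have hpp' : ∀ z, T p z p = 0 := fun z => by rw [h23, hpp]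
  have hpp'' : ∀ z, T z p p = 0 := fun z => by rw [h12, hpp']
  set e := T a a d with he
  have hker : ∃ k l : ℂ, (k ≠ 0 ∨ l ≠ 0) ∧ k * (2 * T a b b) + l * (2 * T a b c + e) = 0 ∧
      k * (2 * T a b c + e) + l * (2 * T a c c) = 0 := by
    by_cases h0 : T a b b = 0
    · have h1 : 2 * T a b c + e = 0 := by
        rw [h0] at hdeg
        exact (pow_eq_zero_iff two_ne_zero).1 (by linear_combination -hdeg)
      exact ⟨1, 0, by simp, by simp [h0], by simp [h1]⟩
    · exact ⟨2 * T a b c + e, -(2 * T a b b), by simp [h0], by ring,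
        by linear_combination -hdeg⟩
  obtain ⟨k, l, hkl, hk1, hk2⟩ := hker
  set v := (-e / 2) • p + a with hv
  set w := k • b + l • c + (-(k * T a b d + l * T a c d)) • p with hw
  have hvd : T p v d = 1 := by simp [hv, hpp, had]
  have hv0 : v ≠ 0 := by
    intro h0
    simp [h0] at hvd
  have hsing : ∀ z, T v v z = 0 := by
    apply h.apply_eq_zero <;>
    simp only [hv, map_add, map_smul, LinearMap.add_apply, LinearMap.smul_apply, smul_eq_mul, hpp,
      hpp', hpp''] <;> simp only [h12 a p, h23 a _ p, haa, hab, hac, had, haaa, haab, haac] <;>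
      ring
  have hw0 : ∀ z, T v w z = 0 := by
    apply h.apply_eq_zero <;>
    simp only [hv, hw, map_add, map_smul, LinearMap.add_apply, LinearMap.smul_apply, smul_eq_mul,
      hpp, hpp', hpp''] <;>
    simp only [h12 a p, h23 a _ p, h23 p _ a, h23 p c b, h23 a _ a, h23 a c b,
      haa, hab, hac, had, haab, haac, hbb, hbc, hbd, hcc, hcd]
    · ring
    · ring
    · linear_combination hk1 / 2
    · linear_combination hk2 / 2
    · ring
  obtain ⟨m, hm⟩ := hT.node v hv0 hsing w hw0
  have hb' : T p w b = m * T p v b := by rw [hm]; simp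
  have hc' : T p w c = m * T p v c := by rw [hm]; simp
  simp [hv, hw, hpp, hab, hac, h23 p c b, hbb, hbc, hcc] at hb' hc'
  simp [hb', hc'] at hkl

end IsFrame

open scoped Polynomial in
/-- The restriction of a trilinear form to three parametrized lines, as a polynomial in the
parameter. -/
noncomputable def pencil (T : V →ₗ[ℂ] V →ₗ[ℂ] V →ₗ[ℂ] ℂ) (a a' b b' c c' : V) : ℂ[X] :=
  Polynomial.C (T a b c) + Polynomial.C (T a' b c + T a b' c + T a b c') * Polynomial.X +
    Polynomial.C (T a' b' c + T a' b c' + T a b' c') * Polynomial.X ^ 2 +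
    Polynomial.C (T a' b' c') * Polynomial.X ^ 3

theorem natDegree_pencil_le (a a' b b' c c' : V) : (pencil T a a' b b' c c').natDegree ≤ 3 := by
  unfold pencil
  compute_degree

theorem eval_pencil (x : ℂ) (a a' b b' c c' : V) :
    (pencil T a a' b b' c c').eval x = T (a + x • a') (b + x • b') (c + x • c') := by
  simp [pencil]
  ring

theorem eval_derivative_pencil (x : ℂ) (a a' b b' c c' : V) :
    (pencil T a a' b b' c c').derivative.eval x = T a' (b + x • b') (c + x • c') +
      T (a + x • a') b' (c + x • c') + T (a + x • a') (b + x • b') c' := by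
  simp [pencil]
  ring

theorem eval_derivative_derivative_pencil (x : ℂ) (a a' b b' c c' : V) :
    (pencil T a a' b b' c c').derivative.derivative.eval x = 2 * (T a' b' (c + x • c') +
      T (a + x • a') b' c' + T a' (b + x • b') c') := by
  simp [pencil]
  ring

/-- The singular points of the curve of bidegree `(3, 3)` attached to a frame. -/
def frameSing (T : V →ₗ[ℂ] V →ₗ[ℂ] V →ₗ[ℂ] ℂ) (a b c d : V) : Set (ℂ × ℂ) :=
  Polynomial.curveSing (pencil T a c a c a c) (pencil T a c a c b d) (pencil T a c b d b d)
    (pencil T b d b d b d)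

theorem mem_frameSing_iff (hT : IsNodalForm T) {x t : ℂ} :
    (x, t) ∈ frameSing T a b c d ↔
      T (a + x • c + t • (b + x • d)) (a + x • c + t • (b + x • d))
        (a + x • c + t • (b + x • d)) = 0 ∧
      T (a + x • c + t • (b + x • d)) (a + x • c + t • (b + x • d)) (b + x • d) = 0 ∧
      T (a + x • c + t • (b + x • d)) (a + x • c + t • (b + x • d)) (c + t • d) = 0 := by
  have h12 := hT.swap₁₂
  have h23 := hT.swap₂₃
  simp only [frameSing, Polynomial.curveSing, Set.mem_ofPred_eq, eval_pencil,
    eval_derivative_pencil]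
  generalize a + x • c = u
  generalize b + x • d = w
  refine and_congr (Eq.congr_left ?_) (and_congr (Eq.congr_left ?_) ?_)
  · simp only [map_add, map_smul, LinearMap.add_apply, LinearMap.smul_apply, smul_eq_mul, h12, h23]
    ring
  · simp only [map_add, map_smul, LinearMap.add_apply, LinearMap.smul_apply, smul_eq_mul, h12]
    ring
  · rw [← mul_eq_zero_iff_left (b := T (u + t • w) (u + t • w) (c + t • d))
      (three_ne_zero (α := ℂ))]
    refine Eq.congr_left ?_
    simp only [map_add, map_smul, LinearMap.add_apply, LinearMap.smul_apply, smul_eq_mul, h12, h23]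
    ring

namespace IsFrame

theorem shift_shift (hT : IsNodalForm T) (h : IsFrame T p a b c d) (x t : ℂ) :
    IsFrame T p (a + x • c + t • (b + x • d)) (b + x • d) (c + t • d) d :=
  (((h.shift hT x).swap hT).shift hT t).swap hT

theorem isNodalCurve (hT : IsNodalForm T) (h : IsFrame T p a b c d) :
    Polynomial.IsNodalCurve (pencil T a c a c a c) (pencil T a c a c b d) (pencil T a c b d b d)
      (pencil T b d b d b d) := by
  rintro ⟨x, t⟩ hq
  obtain ⟨h1, h2, h3⟩ := (mem_frameSing_iff hT).1 hq
  have hnd := (h.shift_shift hT x t).nondegenerate hT h1 h2 h3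
  contrapose! hnd
  have h12 := hT.swap₁₂
  have h23 := hT.swap₂₃
  simp only [eval_pencil, eval_derivative_pencil, eval_derivative_derivative_pencil] at hnd
  generalize a + x • c = u at hnd ⊢
  generalize b + x • d = w at hnd ⊢
  simp only [map_add, map_smul, LinearMap.add_apply, LinearMap.smul_apply, smul_eq_mul,
    h12, h23] at hnd ⊢
  linear_combination hnd / 3

theorem cubicDisc_ne_zero (hT : IsNodalForm T) (h : IsFrame T p a b c d) :
    ∃ x : ℂ, cubicDisc (T (a + x • c) (a + x • c) (a + x • c))
      (T (a + x • c) (a + x • c) (b + x • d)) (T (a + x • c) (b + x • d) (b + x • d))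
      (T (b + x • d) (b + x • d) (b + x • d)) ≠ 0 := by
  have h1 := h.isNodalCurve hT
  have h2 := (h.flip hT).isNodalCurve hT
  have e1 : pencil T b d b d a c = pencil T a c b d b d := by
    simp only [pencil, hT.swap₁₂, hT.swap₂₃]; congr 3 <;> ring_nf
  have e2 : pencil T b d a c a c = pencil T a c a c b d := by
    simp only [pencil, hT.swap₁₂, hT.swap₂₃]; congr 3 <;> ring_nf
  rw [e1, e2] at h2
  by_contra! h0
  refine h1.cubicDisc_ne_zero h2 (Polynomial.funext fun x => ?_)
  simpa [cubicDisc, eval_pencil] using h0 x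

/-- There are no singular points over `s = ∞`. -/
def NoSingAtInfty (T : V →ₗ[ℂ] V →ₗ[ℂ] V →ₗ[ℂ] ℂ) (p c d : V) : Prop :=
  ∀ r y z : ℂ, (∀ w, T (r • p + y • c + z • d) (r • p + y • c + z • d) w = 0) → y = 0 ∧ z = 0

theorem exists_noSingAtInfty (hT : IsNodalForm T) (h : IsFrame T p a b c d) :
    ∃ x : ℂ, NoSingAtInfty T p (a + x • c) (b + x • d) := by
  obtain ⟨x, hx⟩ := h.cubicDisc_ne_zero hT
  refine ⟨x, fun r y z hsing => ?_⟩
  have hf := h.shift hT x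
  generalize a + x • c = u at *
  generalize b + x • d = w at *
  have h12 := hT.swap₁₂
  have h23 := hT.swap₂₃
  obtain ⟨hpp, haa, hbb, -, -, hab, -⟩ := hf
  have hba : T p w u = 0 := by rw [h23, hab]
  refine eq_zero_of_double_root_of_cubicDisc_ne_zero hx ?_ ?_
  · have := hsing u
    simp [hpp, h12 u p, h12 w p, haa, hba, h12 w u u] at this
    rw [h23 u w u] at this
    linear_combination this + z ^ 2 * (h12 u w w).trans (h23 w u w)
  · have := hsing w
    simp [hpp, h12 u p, h12 w p, hbb, hab, h12 w u w] at this
    linear_combination this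

/-- A frame with no singular points over `s = ∞` or `t = ∞`. -/
theorem exists_affine (hT : IsNodalForm T) (h : IsFrame T p a b c d) :
    ∃ a' b' c' d', IsFrame T p a' b' c' d' ∧ NoSingAtInfty T p c' d' ∧
      NoSingAtInfty T p b' d' := by
  obtain ⟨x, hx⟩ := h.exists_noSingAtInfty hT
  have h1 := (((h.shift hT x).swap hT).flip hT).swap hT
  generalize a + x • c = c₁ at hx h1
  generalize b + x • d = d₁ at hx h1
  obtain ⟨y, hy⟩ := (h1.swap hT).exists_noSingAtInfty hT
  have h2 := (((h1.swap hT).shift hT y).swap hT).flip hT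
  rw [neg_neg] at h2
  refine ⟨_, _, _, _, h2, fun r s t hst => ?_, fun r s t hst => ?_⟩
  · obtain ⟨h3, h4⟩ := hx r t (s + t * y) (fun w => by
      rw [← hst w]; congr 2 <;> [congr 1; skip] <;> module)
    subst h3
    exact ⟨by simpa using h4, rfl⟩
  · exact hy (-r) s t (fun w => by
      rw [← hst w]; congr 2 <;> [congr 1; skip] <;> module)

/-- Every singular point other than `p` comes from a singular point of the `(3, 3)`-curve. -/
theorem singular_cases (hT : IsNodalForm T) (h : IsFrame T p a b c d)
    (hs : NoSingAtInfty T p c d) (ht : NoSingAtInfty T p b d) {v : V}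
    (hv : ∀ z, T v v z = 0) :
    (∃ k : ℂ, v = k • p) ∨ ∃ q ∈ frameSing T a b c d, ∃ k : ℂ,
      v = k • ((-T (a + q.1 • c + q.2 • (b + q.1 • d)) (a + q.1 • c + q.2 • (b + q.1 • d)) d / 2) • p
        + (a + q.1 • c + q.2 • (b + q.1 • d))) := by
  have h12 := hT.swap₁₂
  have h23 := hT.swap₂₃
  have hpp := h.pp
  have hpp' : ∀ z, T p z p = 0 := fun z => by rw [h23, hpp]
  have hpp'' : ∀ z, T z p p = 0 := fun z => by rw [h12, hpp']
  obtain ⟨x₀, x₁, x₂, x₃, x₄, hv'⟩ := h.span v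
  have hQ : x₁ * x₄ = x₂ * x₃ := by
    obtain ⟨-, haa, hbb, hcc, hdd, hab, hac, hbd, hcd, had, hbc, -⟩ := id h
    have h0 := hv p
    rw [hv', h23, h12] at h0
    simp [hpp, hpp', h23 p b a, h23 p c a, h23 p d, h23 p c b,
      haa, hbb, hcc, hdd, hab, hac, hbd, hcd, had, hbc] at h0
    linear_combination h0 / 2
  by_cases hx₁ : x₁ = 0
  · left
    subst hx₁
    rcases mul_eq_zero.1 (show x₂ * x₃ = 0 by rw [← hQ, zero_mul]) with rfl | rfl
    · obtain ⟨rfl, rfl⟩ := hs x₀ x₃ x₄ (by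
        rw [show x₀ • p + x₃ • c + x₄ • d = v by rw [hv']; module]; exact hv)
      exact ⟨x₀, by rw [hv']; module⟩
    · obtain ⟨rfl, rfl⟩ := ht x₀ x₂ x₄ (by
        rw [show x₀ • p + x₂ • b + x₄ • d = v by rw [hv']; module]; exact hv)
      exact ⟨x₀, by rw [hv']; module⟩
  · right
    obtain ⟨x, rfl⟩ : ∃ x, x₃ = x₁ * x := ⟨x₃ / x₁, by field_simp⟩
    obtain ⟨t, rfl⟩ : ∃ t, x₂ = x₁ * t := ⟨x₂ / x₁, by field_simp⟩
    obtain ⟨r, rfl⟩ : ∃ r, x₀ = x₁ * r := ⟨x₀ / x₁, by field_simp⟩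
    obtain rfl : x₄ = x₁ * t * x := mul_left_cancel₀ hx₁ (by linear_combination hQ)
    have hf := h.shift_shift hT x t
    have hvr : v = x₁ • (r • p + (a + x • c + t • (b + x • d))) := by rw [hv']; module
    have hmem := mem_frameSing_iff (x := x) (t := t) (a := a) (b := b) (c := c) (d := d) hT
    refine ⟨(x, t), hmem.2 ?_, x₁, ?_⟩
    all_goals
      try simp only
      generalize a + x • c + t • (b + x • d) = u at *
      have hu : ∀ z, 2 * r * T p u z + T u u z = 0 := by
        intro z
        have := hv z
        rw [hvr] at this
        simp [hpp, h12 u p, -mul_eq_zero] at this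
        apply mul_left_cancel₀ (pow_ne_zero 2 hx₁)
        linear_combination this
    · have h1 := hu u
      have h2 := hu (b + x • d)
      have h3 := hu (c + t • d)
      rw [hf.aa] at h1
      rw [hf.ab] at h2
      rw [hf.ac] at h3
      exact ⟨by linear_combination h1, by linear_combination h2, by linear_combination h3⟩
    · have h1 := hu d
      rw [hf.ad] at h1
      rw [hvr]
      congr 3
      linear_combination h1 / 2

theorem transform (hT : IsNodalForm T) (h : IsFrame T p a b c d) {α β γ δ : ℂ}
    (hdet : α * δ - β * γ ≠ 0) :
    IsFrame T ((α * δ - β * γ)⁻¹ • p) (α • a + β • c) (α • b + β • d) (γ • a + δ • c)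
      (γ • b + δ • d) := by
  obtain ⟨hpp, haa, hbb, hcc, hdd, hab, hac, hbd, hcd, had, hbc, hspan⟩ := h
  have h23 := hT.swap₂₃
  have hba : T p b a = 0 := by rw [h23, hab]
  have hca : T p c a = 0 := by rw [h23, hac]
  have hdb : T p d b = 0 := by rw [h23, hbd]
  have hdc : T p d c = 0 := by rw [h23, hcd]
  have hda : T p d a = 1 := by rw [h23, had]
  have hcb : T p c b = -1 := by rw [h23, hbc]
  refine ⟨fun z => by simp [hpp], ?_, ?_, ?_, ?_, ?_, ?_, ?_, ?_, ?_, ?_, fun v => ?_⟩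
  · simp [haa, hac, hca, hcc]
  · simp [hbb, hbd, hdb, hdd]
  · simp [haa, hac, hca, hcc]
  · simp [hbb, hbd, hdb, hdd]
  · simp [hab, had, hcb, hcd]; ring
  · simp [haa, hac, hca, hcc]
  · simp [hbb, hbd, hdb, hdd]
  · simp [hab, had, hcb, hcd]; ring
  · simp [hab, had, hcb, hcd]; field_simp; ring
  · simp [hba, hbc, hda, hdc]; field_simp; ring
  · obtain ⟨x₀, x₁, x₂, x₃, x₄, rfl⟩ := hspan v
    have key : ∀ x y : ℂ, ∃ x' y', x = α * x' + γ * y' ∧ y = β * x' + δ * y' := fun x y =>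
      ⟨(δ * x - γ * y) / (α * δ - β * γ), (α * y - β * x) / (α * δ - β * γ),
        by rw [mul_div_assoc', mul_div_assoc', ← add_div, eq_div_iff hdet]; ring,
        by rw [mul_div_assoc', mul_div_assoc', ← add_div, eq_div_iff hdet]; ring⟩
    obtain ⟨y₁, y₃, e1, e3⟩ := key x₁ x₃
    obtain ⟨y₂, y₄, e2, e4⟩ := key x₂ x₄
    refine ⟨(α * δ - β * γ) * x₀, y₁, y₂, y₃, y₄, ?_⟩
    rw [smul_smul, mul_right_comm, mul_inv_cancel₀ hdet, e1, e2, e3, e4]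
    module

theorem add_smul (hT : IsNodalForm T) (h : IsFrame T p a b c d) (k₁ k₂ k₃ k₄ : ℂ) :
    IsFrame T p (a + k₁ • p) (b + k₂ • p) (c + k₃ • p) (d + k₄ • p) := by
  obtain ⟨hpp, haa, hbb, hcc, hdd, hab, hac, hbd, hcd, had, hbc, hspan⟩ := h
  have hpp' : ∀ z, T p z p = 0 := fun z => by rw [hT.swap₂₃, hpp]
  refine ⟨hpp, ?_, ?_, ?_, ?_, ?_, ?_, ?_, ?_, ?_, ?_, fun v => ?_⟩
  iterate 10 simp [hpp, hpp', haa, hbb, hcc, hdd, hab, hac, hbd, hcd, had, hbc]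
  obtain ⟨x₀, x₁, x₂, x₃, x₄, rfl⟩ := hspan v
  exact ⟨x₀ - k₁ * x₁ - k₂ * x₂ - k₃ * x₃ - k₄ * x₄, x₁, x₂, x₃, x₄, by module⟩

end IsFrame

/-- The cubic vanishes on the plane spanned by `u` and `w`. -/
def VanishesOn (T : V →ₗ[ℂ] V →ₗ[ℂ] V →ₗ[ℂ] ℂ) (u w : V) : Prop :=
  ∀ y z : ℂ, T (y • u + z • w) (y • u + z • w) (y • u + z • w) = 0

theorem vanishesOn_iff (hT : IsNodalForm T) {u w : V} :
    VanishesOn T u w ↔ T u u u = 0 ∧ T u u w = 0 ∧ T u w w = 0 ∧ T w w w = 0 := by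
  have h12 := hT.swap₁₂
  have h23 := hT.swap₂₃
  have expand : ∀ y z : ℂ, T (y • u + z • w) (y • u + z • w) (y • u + z • w) =
      y ^ 3 * T u u u + 3 * y ^ 2 * z * T u u w + 3 * y * z ^ 2 * T u w w + z ^ 3 * T w w w := by
    intro y z
    simp only [map_add, map_smul, LinearMap.add_apply, LinearMap.smul_apply, smul_eq_mul, h12, h23]
    ring
  constructor
  · intro h
    have e1 := (expand 1 0).symm.trans (h 1 0)
    have e2 := (expand 0 1).symm.trans (h 0 1)
    have e3 := (expand 1 1).symm.trans (h 1 1)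
    have e4 := (expand 1 (-1)).symm.trans (h 1 (-1))
    exact ⟨by linear_combination e1, by linear_combination (e3 - e4) / 6 - e2 / 3,
      by linear_combination (e3 + e4) / 6 - e1 / 3, by linear_combination e2⟩
  · rintro ⟨h1, h2, h3, h4⟩ y z
    rw [expand, h1, h2, h3, h4]
    ring

theorem VanishesOn.of_mem_span {u w u' w' : V} (h : VanishesOn T u w) {α β γ δ : ℂ}
    (hu : u' = α • u + β • w) (hw : w' = γ • u + δ • w) : VanishesOn T u' w' := by
  intro y z
  have := h (y * α + z * γ) (y * β + z * δ)
  rw [show y • u' + z • w' = (y * α + z * γ) • u + (y * β + z * δ) • w by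
    rw [hu, hw]; module]
  exact this

namespace IsFrame

theorem exists_standard_lines (hT : IsNodalForm T) (h : IsFrame T p a b c d) {x₁ x₂ x₃ : ℂ}
    (h₁₂ : x₁ ≠ x₂) (h₁₃ : x₁ ≠ x₃) (h₂₃ : x₂ ≠ x₃)
    (h₁ : VanishesOn T (a + x₁ • c) (b + x₁ • d)) (h₂ : VanishesOn T (a + x₂ • c) (b + x₂ • d))
    (h₃ : VanishesOn T (a + x₃ • c) (b + x₃ • d)) :
    ∃ k α β γ δ : ℂ, IsFrame T (k • p) (α • a + β • c) (α • b + β • d) (γ • a + δ • c)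
        (γ • b + δ • d) ∧ VanishesOn T (α • a + β • c) (α • b + β • d) ∧
      VanishesOn T (γ • a + δ • c) (γ • b + δ • d) ∧
      VanishesOn T (α • a + β • c + (γ • a + δ • c)) (α • b + β • d + (γ • b + δ • d)) := by
  have n12 := sub_ne_zero.2 h₁₂
  have n13 := sub_ne_zero.2 h₁₃
  have n23 := sub_ne_zero.2 h₂₃
  obtain ⟨l, hl⟩ : ∃ l, l = (x₃ - x₂) / (x₁ - x₂) := ⟨_, rfl⟩
  obtain ⟨m, hm⟩ : ∃ m, m = (x₁ - x₃) / (x₁ - x₂) := ⟨_, rfl⟩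
  have hl0 : l ≠ 0 := by
    rw [hl]; exact div_ne_zero (by rwa [← neg_sub, neg_ne_zero]) n12
  have hm0 : m ≠ 0 := by rw [hm]; exact div_ne_zero n13 n12
  have hlm : l + m = 1 := by rw [hl, hm]; field_simp; ring
  have hlm' : l * x₁ + m * x₂ = x₃ := by rw [hl, hm]; field_simp; ring
  have hdet : l * (m * x₂) - (l * x₁) * m ≠ 0 := by
    rw [show l * (m * x₂) - (l * x₁) * m = -(l * m * (x₁ - x₂)) by ring]
    exact neg_ne_zero.2 (mul_ne_zero (mul_ne_zero hl0 hm0) n12)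
  refine ⟨_, _, _, _, _, h.transform hT hdet, ?_, ?_, ?_⟩
  · exact h₁.of_mem_span (α := l) (β := 0) (γ := 0) (δ := l) (by module) (by module)
  · exact h₂.of_mem_span (α := m) (β := 0) (γ := 0) (δ := m) (by module) (by module)
  · obtain rfl : m = 1 - l := by rw [← hlm]; ring
    rw [← hlm'] at h₃
    exact h₃.of_mem_span (α := 1) (β := 0) (γ := 0) (δ := 1) (by module) (by module)

end IsFrame

theorem mem_frameSing_swap (hT : IsNodalForm T) {q : ℂ × ℂ} :
    q.swap ∈ frameSing T a c b d ↔ q ∈ frameSing T a b c d := by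
  obtain ⟨x, t⟩ := q
  rw [Prod.swap_prod_mk, mem_frameSing_iff hT, mem_frameSing_iff hT,
    show a + t • b + x • (c + t • d) = a + x • c + t • (b + x • d) by module]
  tauto

theorem ncard_frameSing_swap (hT : IsNodalForm T) :
    (frameSing T a c b d).ncard = (frameSing T a b c d).ncard := by
  rw [← Set.ncard_image_of_injective (frameSing T a b c d) Prod.swap_injective]
  congr 1
  ext q
  rw [Set.image_swap_eq_preimage_swap, Set.mem_preimage, ← mem_frameSing_swap hT]

namespace IsFrame

theorem ncard_frameSing_le (hT : IsNodalForm T) (h : IsFrame T p a b c d) :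
    (frameSing T a b c d).Finite ∧ (frameSing T a b c d).ncard ≤ 9 ∧
      ((frameSing T a b c d).ncard = 9 → ∃ x₁ x₂ x₃ : ℂ, x₁ ≠ x₂ ∧ x₁ ≠ x₃ ∧ x₂ ≠ x₃ ∧
        VanishesOn T (a + x₁ • c) (b + x₁ • d) ∧ VanishesOn T (a + x₂ • c) (b + x₂ • d) ∧
        VanishesOn T (a + x₃ • c) (b + x₃ • d)) := by
  have hdisc : cubicDisc (pencil T a c a c a c) (pencil T a c a c b d) (pencil T a c b d b d)
      (pencil T b d b d b d) ≠ 0 := by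
    intro h0
    obtain ⟨x, hx⟩ := h.cubicDisc_ne_zero hT
    apply hx
    simpa [cubicDisc, eval_pencil] using congrArg (Polynomial.eval x) h0
  obtain ⟨h1, h2, h3⟩ := (h.isNodalCurve hT).ncard_curveSing_le hdisc (natDegree_pencil_le ..)
    (natDegree_pencil_le ..) (natDegree_pencil_le ..) (natDegree_pencil_le ..)
  refine ⟨h1, h2, fun h9 => ?_⟩
  obtain ⟨x₁, x₂, x₃, h12, h13, h23, hx⟩ := h3 h9
  simp only [eval_pencil] at hx
  exact ⟨x₁, x₂, x₃, h12, h13, h23, (vanishesOn_iff hT).2 (hx _ (.inl rfl)),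
    (vanishesOn_iff hT).2 (hx _ (.inr (.inl rfl))), (vanishesOn_iff hT).2 (hx _ (.inr (.inr rfl)))⟩

/-- If the `(3, 3)`-curve has nine singular points, it is a union of six lines, which can be moved
to standard position. -/
theorem exists_six_lines (hT : IsNodalForm T) (h : IsFrame T p a b c d)
    (h9 : (frameSing T a b c d).ncard = 9) :
    ∃ p a b c d, IsFrame T p a b c d ∧ VanishesOn T a b ∧ VanishesOn T c d ∧
      VanishesOn T (a + c) (b + d) ∧ VanishesOn T a c ∧ VanishesOn T b d ∧
      VanishesOn T (a + b) (c + d) := by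
  obtain ⟨x₁, x₂, x₃, h12, h13, h23, hx₁, hx₂, hx₃⟩ := (h.ncard_frameSing_le hT).2.2 h9
  obtain ⟨t₁, t₂, t₃, k12, k13, k23, ht₁, ht₂, ht₃⟩ :=
    ((h.swap hT).ncard_frameSing_le hT).2.2 ((ncard_frameSing_swap hT).trans h9)
  obtain ⟨k, α, β, γ, δ, hf, hab, hcd, hac⟩ := h.exists_standard_lines hT h12 h13 h23 hx₁ hx₂ hx₃
  have ht : ∀ t : ℂ, VanishesOn T (a + t • b) (c + t • d) →
      VanishesOn T (α • a + β • c + t • (α • b + β • d))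
        (γ • a + δ • c + t • (γ • b + δ • d)) := fun t h =>
    h.of_mem_span (α := α) (β := β) (γ := γ) (δ := δ) (by module) (by module)
  replace ht₁ := ht _ ht₁
  replace ht₂ := ht _ ht₂
  replace ht₃ := ht _ ht₃
  clear ht
  generalize α • a + β • c = a' at *
  generalize α • b + β • d = b' at *
  generalize γ • a + δ • c = c' at *
  generalize γ • b + δ • d = d' at *
  obtain ⟨k', α', β', γ', δ', hf', hac', hbd', hab'⟩ :=
    (hf.swap hT).exists_standard_lines hT k12 k13 k23 ht₁ ht₂ ht₃
  exact ⟨_, _, _, _, _, hf'.swap hT,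
    hab.of_mem_span (α := α') (β := β') (γ := γ') (δ := δ') rfl rfl,
    hcd.of_mem_span (α := α') (β := β') (γ := γ') (δ := δ') rfl rfl,
    hac.of_mem_span (α := α') (β := β') (γ := γ') (δ := δ') (by module) (by module),
    hac', hbd', hab'⟩

theorem vanishesOn_add_smul (hT : IsNodalForm T) {p u w : V} (hpp : ∀ z, T p p z = 0)
    (huu : T p u u = 0) (huw : T p u w = 0) (hww : T p w w = 0) (h : VanishesOn T u w) (k l : ℂ) :
    VanishesOn T (u + k • p) (w + l • p) := by
  have h12 := hT.swap₁₂
  have h23 := hT.swap₂₃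
  have hpp' : ∀ z, T p z p = 0 := fun z => by rw [h23, hpp]
  obtain ⟨h1, h2, h3, h4⟩ := (vanishesOn_iff hT).1 h
  refine (vanishesOn_iff hT).2 ⟨?_, ?_, ?_, ?_⟩ <;>
  simp [h12 u p, h12 w p, h23 u _ p, h23 w _ p, hpp, hpp', huu, huw, hww, h1, h2, h3, h4]

/-- The standard lines can be kept while making `T a a d`, `T a d d`, `T b b c`, `T b c c`
vanish. -/
theorem exists_six_lines_diag (hT : IsNodalForm T) (h : IsFrame T p a b c d)
    (h9 : (frameSing T a b c d).ncard = 9) :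
    ∃ p a b c d, IsFrame T p a b c d ∧ VanishesOn T a b ∧ VanishesOn T c d ∧
      VanishesOn T (a + c) (b + d) ∧ VanishesOn T a c ∧ VanishesOn T b d ∧
      VanishesOn T (a + b) (c + d) ∧ T a a d = 0 ∧ T a d d = 0 ∧ T b b c = 0 ∧ T b c c = 0 := by
  obtain ⟨p, a, b, c, d, h, l₁, l₂, l₃, l₄, l₅, l₆⟩ := h.exists_six_lines hT h9
  have h12 := hT.swap₁₂
  have h23 := hT.swap₂₃
  have hf := h.add_smul hT (-T a a d / 2) (T b b c / 2) (T b c c / 2) (-T a d d / 2)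
  obtain ⟨hpp, haa, hbb, hcc, hdd, hab, hac, hbd, hcd, had, hbc, -⟩ := h
  have hpp' : ∀ z, T p z p = 0 := fun z => by rw [h23, hpp]
  have hba : T p b a = 0 := by rw [h23, hab]
  have hca : T p c a = 0 := by rw [h23, hac]
  have hdb : T p d b = 0 := by rw [h23, hbd]
  have hdc : T p d c = 0 := by rw [h23, hcd]
  have hcb : T p c b = -1 := by rw [h23, hbc]
  refine ⟨_, _, _, _, _, hf, vanishesOn_add_smul hT hpp haa hab hbb l₁ _ _,
    vanishesOn_add_smul hT hpp hcc hcd hdd l₂ _ _, ?_,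
    vanishesOn_add_smul hT hpp haa hac hcc l₄ _ _, vanishesOn_add_smul hT hpp hbb hbd hdd l₅ _ _,
    ?_, ?_, ?_, ?_, ?_⟩
  · have := vanishesOn_add_smul hT (u := a + c) (w := b + d) hpp (by simp [haa, hac, hca, hcc])
      (by simp [hab, had, hcb, hcd]) (by simp [hbb, hbd, hdb, hdd]) l₃
      (-T a a d / 2 + T b c c / 2) (T b b c / 2 + -T a d d / 2)
    exact this.of_mem_span (α := 1) (β := 0) (γ := 0) (δ := 1) (by module) (by module)
  · have := vanishesOn_add_smul hT (u := a + b) (w := c + d) hpp (by simp [haa, hab, hba, hbb])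
      (by simp [hac, had, hbc, hbd]) (by simp [hcc, hcd, hdc, hdd]) l₆
      (-T a a d / 2 + T b b c / 2) (T b c c / 2 + -T a d d / 2)
    exact this.of_mem_span (α := 1) (β := 0) (γ := 0) (δ := 1) (by module) (by module)
  · simp [hpp, hpp', h12 a p, h23 a _ p, haa, had]
    ring
  · simp [hpp, hpp', h12 a p, h23 a _ p, hdd, had]
    ring
  · simp [hpp, hpp', h12 b p, h23 b _ p, hbb, hbc]
    ring
  · simp [hpp, hpp', h12 b p, h23 b _ p, hcc, hbc]
    ring

theorem exists_normal_form (hT : IsNodalForm T) (h : IsFrame T p a b c d)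
    (h9 : (frameSing T a b c d).ncard = 9) :
    ∃ (p a b c d : V) (m : ℂ), m ≠ 0 ∧
      (∀ v, ∃ x₀ x₁ x₂ x₃ x₄ : ℂ, v = x₀ • p + x₁ • a + x₂ • b + x₃ • c + x₄ • d) ∧
      ∀ x₀ x₁ x₂ x₃ x₄ : ℂ, ∀ v, v = x₀ • p + x₁ • a + x₂ • b + x₃ • c + x₄ • d →
        T v v v = 6 * m * (x₀ * (x₁ * x₄ - x₂ * x₃) + x₁ * x₂ * x₃ - x₁ * x₂ * x₄ -
          x₁ * x₃ * x₄ + x₂ * x₃ * x₄) := by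
  have h12 := hT.swap₁₂
  have h23 := hT.swap₂₃
  obtain ⟨p, a, b, c, d, h, l₁, l₂, l₃, l₄, l₅, l₆, haad, hadd, hbbc, hbcc⟩ :=
    h.exists_six_lines_diag hT h9
  obtain ⟨haaa, haab, habb, hbbb⟩ := (vanishesOn_iff hT).1 l₁
  obtain ⟨hccc, hccd, hcdd, hddd⟩ := (vanishesOn_iff hT).1 l₂
  obtain ⟨-, haac, hacc, -⟩ := (vanishesOn_iff hT).1 l₄
  obtain ⟨-, hbbd, hbdd, -⟩ := (vanishesOn_iff hT).1 l₅
  have e₁ := ((vanishesOn_iff hT).1 l₃).2.1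
  have e₂ := ((vanishesOn_iff hT).1 l₃).2.2.1
  have e₃ := ((vanishesOn_iff hT).1 l₆).2.1
  clear l₁ l₂ l₃ l₄ l₅ l₆
  obtain ⟨hpp, haa, hbb, hcc, hdd, hab, hac, hbd, hcd, had, hbc, hspan⟩ := id h
  have hpp' : ∀ z, T p z p = 0 := fun z => by rw [h23, hpp]
  have hpp'' : ∀ z, T z p p = 0 := fun z => by rw [h12, hpp']
  simp only [map_add, LinearMap.add_apply, h12 c a, h12 b a, h12 c b, h23 _ c b, h23 _ d b, haab, haad,
    hbcc, hccd, habb, hadd, hbbc, hcdd, haac, hbbd] at e₁ e₂ e₃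
  have hacd : T a c d = -T a b c := by linear_combination e₁ / 2
  have habd : T a b d = -T a b c := by linear_combination e₃ / 2
  have hbcd : T b c d = T a b c := by linear_combination e₂ / 2 - habd
  have hm : T a b c ≠ 0 := by
    intro hm
    have ha0 : a ≠ 0 := by
      rintro rfl
      simp at had
    obtain ⟨k, hk⟩ := hT.node a ha0
      (h.apply_eq_zero (by rw [h23, h12, haa]) haaa haab haac haad) b
      (h.apply_eq_zero (by rw [h23, h12, hab]) (by rw [h23, haab]) habb hm (by rw [habd, hm, neg_zero]))
    rw [hk] at hbc
    simp [hac] at hbc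
  refine ⟨T a b c • p, a, b, c, d, T a b c, hm, fun v => ?_, ?_⟩
  · obtain ⟨x₀, x₁, x₂, x₃, x₄, rfl⟩ := hspan v
    exact ⟨x₀ / T a b c, x₁, x₂, x₃, x₄, by rw [smul_smul, div_mul_cancel₀ _ hm]⟩
  · rintro x₀ x₁ x₂ x₃ x₄ v rfl
    simp only [map_add, map_smul, LinearMap.add_apply, LinearMap.smul_apply, smul_eq_mul, hpp,
      hpp', hpp'', h12 _ p, h23 _ _ p, h12 c a, h23 _ c a, h12 b a, h23 _ b a, h12 d a,
      h23 _ d a, h12 c b, h23 _ c b, h12 d b, h23 _ d b, h12 d c, h23 _ d c, haa, hbb, hcc, hdd,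
      hab, hac, hbd, hcd, had, hbc, haaa, haab, habb, hbbb, hccc, hccd, hcdd, hddd, haac, hacc,
      hbbd, hbdd, haad, hadd, hbbc, hbcc, hacd, habd, hbcd]
    ring

end IsFrame

namespace IsNodalForm

/-- The polar quadric of a singular point is diagonal in some basis containing the point up to
scaling. -/
theorem exists_orthogonal_basis [FiniteDimensional ℂ V] (hV : Module.finrank ℂ V = 5)
    (hT : IsNodalForm T) (hp0 : p ≠ 0) (hp : ∀ z, T p p z = 0) :
    ∃ (v : Module.Basis (Fin 5) ℂ V) (k : ℂ), v 0 = k • p ∧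
      (∀ i j, i ≠ j → T p (v i) (v j) = 0) ∧ ∀ i, i ≠ 0 → T p (v i) (v i) ≠ 0 := by
  obtain ⟨v, hv⟩ : ∃ v : Module.Basis (Fin 5) ℂ V, ∀ i j, i ≠ j → T p (v i) (v j) = 0 := by
    obtain ⟨v, hv⟩ := LinearMap.BilinForm.exists_orthogonal_basis (B := T p)
      ⟨fun x y => hT.swap₂₃ p x y⟩
    refine ⟨v.reindex (finCongr hV), fun i j hij => ?_⟩
    rw [v.reindex_apply, v.reindex_apply]
    exact hv fun h => hij ((finCongr hV).symm.injective h)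
  have happ : ∀ i z, T p (v i) z = v.repr z i * T p (v i) (v i) := by
    intro i z
    conv_lhs => rw [← v.sum_repr z, map_sum]
    rw [Finset.sum_eq_single i (fun j _ hj => by rw [map_smul, hv i j hj.symm, smul_zero])
      (by simp), map_smul, smul_eq_mul]
  have hrad : ∀ i, T p (v i) (v i) = 0 → ∃ k : ℂ, v i = k • p := fun i hi =>
    hT.node p hp0 hp (v i) fun z => by rw [happ, hi, mul_zero]
  obtain ⟨i₀, hi₀⟩ : ∃ i, T p (v i) (v i) = 0 := by
    by_contra! hne
    refine hp0 (v.ext_elem fun i => ?_)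
    have h0 := happ i p
    rw [hT.swap₂₃, hp] at h0
    simpa [hne i] using h0.symm
  obtain ⟨k, hk⟩ := hrad i₀ hi₀
  refine ⟨v.reindex (Equiv.swap i₀ 0), k, ?_, fun i j hij => ?_, fun i hi h0 => ?_⟩
  · simpa using hk
  · rw [v.reindex_apply, v.reindex_apply]
    exact hv _ _ fun h => hij ((Equiv.swap i₀ 0).symm.injective h)
  · rw [v.reindex_apply] at h0
    obtain ⟨l, hl⟩ := hrad _ h0
    have hne : (Equiv.swap i₀ 0).symm i ≠ i₀ := by
      rw [Ne, Equiv.symm_apply_eq, Equiv.swap_apply_left]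
      exact hi
    have hk0 : k ≠ 0 := by
      rintro rfl
      exact v.ne_zero i₀ (by rw [hk, zero_smul])
    generalize (Equiv.swap i₀ 0).symm i = j at hl hne
    have := v.repr_self_apply j j
    rw [hl, show p = k⁻¹ • v i₀ by rw [hk, smul_smul, inv_mul_cancel₀ hk0, one_smul]] at this
    simp [hne.symm] at this

/-- Through every singular point of a nodal cubic threefold there is a frame. -/
theorem exists_isFrame [FiniteDimensional ℂ V] (hV : Module.finrank ℂ V = 5)
    (hT : IsNodalForm T) (hp0 : p ≠ 0) (hp : ∀ z, T p p z = 0) :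
    ∃ a b c d, IsFrame T p a b c d := by
  obtain ⟨v, k, hv0, hv, hne⟩ := hT.exists_orthogonal_basis hV hp0 hp
  have hscale : ∀ i, i ≠ 0 → ∃ (u : V) (s : ℂ), v i = s • u ∧ T p u u = 1 ∧
      ∀ z, T p (v i) z = 0 → T p u z = 0 := by
    intro i hi
    obtain ⟨s, hs⟩ := IsAlgClosed.exists_eq_mul_self (T p (v i) (v i))
    have hs0 : s ≠ 0 := by
      rintro rfl
      exact hne i hi (by rw [hs, zero_mul])
    refine ⟨s⁻¹ • v i, s, ?_, ?_, fun z hz => ?_⟩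
    · rw [smul_smul, mul_inv_cancel₀ hs0, one_smul]
    · simp [hs, hs0]
    · simp [hz]
  obtain ⟨u₁, s₁, e₁, n₁, o₁⟩ := hscale 1 (by decide)
  obtain ⟨u₂, s₂, e₂, n₂, o₂⟩ := hscale 2 (by decide)
  obtain ⟨u₃, s₃, e₃, n₃, o₃⟩ := hscale 3 (by decide)
  obtain ⟨u₄, s₄, e₄, n₄, o₄⟩ := hscale 4 (by decide)
  have h23 := hT.swap₂₃
  have h12 : T p u₁ u₂ = 0 := o₁ _ (by rw [h23]; exact o₂ _ (hv _ _ (by decide)))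
  have h13 : T p u₁ u₃ = 0 := o₁ _ (by rw [h23]; exact o₃ _ (hv _ _ (by decide)))
  have h14 : T p u₁ u₄ = 0 := o₁ _ (by rw [h23]; exact o₄ _ (hv _ _ (by decide)))
  have h23' : T p u₂ u₃ = 0 := o₂ _ (by rw [h23]; exact o₃ _ (hv _ _ (by decide)))
  have h24 : T p u₂ u₄ = 0 := o₂ _ (by rw [h23]; exact o₄ _ (hv _ _ (by decide)))
  have h34 : T p u₃ u₄ = 0 := o₃ _ (by rw [h23]; exact o₄ _ (hv _ _ (by decide)))
  have hI : Complex.I * Complex.I = -1 := Complex.I_mul_I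
  have hu₂ : u₂ = -Complex.I • Complex.I • u₂ := by
    rw [neg_smul, smul_smul, hI, neg_smul, one_smul, neg_neg]
  have hu₄ : u₄ = -Complex.I • Complex.I • u₄ := by
    rw [neg_smul, smul_smul, hI, neg_smul, one_smul, neg_neg]
  have hspan : ∀ z, ∃ x₀ x₁ x₂ x₃ x₄ : ℂ, z = x₀ • p + x₁ • (u₁ + Complex.I • u₂) +
      x₂ • (u₃ + Complex.I • u₄) + x₃ • ((-1 / 2 : ℂ) • (u₃ - Complex.I • u₄)) +
      x₄ • ((1 / 2 : ℂ) • (u₁ - Complex.I • u₂)) := by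
    intro z
    rw [← v.sum_repr z, Fin.sum_univ_five, hv0, e₁, e₂, e₃, e₄]
    generalize v.repr z = r
    refine ⟨r 0 * k, (r 1 * s₁ - r 2 * s₂ * Complex.I) / 2, (r 3 * s₃ - r 4 * s₄ * Complex.I) / 2,
      -(r 3 * s₃ + r 4 * s₄ * Complex.I), r 1 * s₁ + r 2 * s₂ * Complex.I, ?_⟩
    generalize Complex.I • u₂ = w₂ at hu₂ ⊢
    generalize Complex.I • u₄ = w₄ at hu₄ ⊢
    rw [hu₂, hu₄]
    module
  refine ⟨_, _, _, _, hp, ?_, ?_, ?_, ?_, ?_, ?_, ?_, ?_, ?_, ?_, hspan⟩ <;>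
  simp only [map_add, map_sub, map_smul, LinearMap.add_apply, LinearMap.sub_apply,
    LinearMap.smul_apply, smul_eq_mul, h23 p u₂ u₁, h23 p u₃ u₁, h23 p u₄ u₁, h23 p u₃ u₂,
    h23 p u₄ u₂, h23 p u₄ u₃, n₁, n₂, n₃, n₄, h12, h13, h14, h23', h24, h34] <;>
  first
  | ring1
  | linear_combination hI
  | linear_combination hI / 4
  | linear_combination hI / 2
  | linear_combination -hI / 2

end IsNodalForm

namespace IsFrame

/-- The vector representing the point of the cubic threefold that corresponds to a singular point of
the `(3, 3)`-curve. -/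
noncomputable def lift (T : V →ₗ[ℂ] V →ₗ[ℂ] V →ₗ[ℂ] ℂ) (p a b c d : V) (q : ℂ × ℂ) : V :=
  (-T (a + q.1 • c + q.2 • (b + q.1 • d)) (a + q.1 • c + q.2 • (b + q.1 • d)) d / 2) • p +
    (a + q.1 • c + q.2 • (b + q.1 • d))

theorem lift_ne_zero (hT : IsNodalForm T) (h : IsFrame T p a b c d) (q : ℂ × ℂ) :
    lift T p a b c d q ≠ 0 := by
  intro h0
  have h1 : T p (lift T p a b c d q) d = 1 := by
    rw [lift, map_add, LinearMap.add_apply, (h.shift_shift hT q.1 q.2).ad]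
    simp [h.pp]
  rw [h0] at h1
  simp at h1

end IsFrame

end Frames

theorem pderiv_pderiv_comm (i j : Fin 5) (F : MvPolynomial (Fin 5) ℂ) :
    pderiv i (pderiv j F) = pderiv j (pderiv i F) := by
  have h : ⁅(pderiv i : Derivation ℂ (MvPolynomial (Fin 5) ℂ) (MvPolynomial (Fin 5) ℂ)),
      pderiv j⁆ = 0 := derivation_ext fun k => by
    rw [Derivation.commutator_apply, pderiv_X, pderiv_X, Derivation.zero_apply]
    simp [Pi.single_apply, apply_ite]
  rw [← sub_eq_zero, ← Derivation.commutator_apply, h, Derivation.zero_apply]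

theorem sum_mul_eval_pderiv {F : MvPolynomial (Fin 5) ℂ} {n : ℕ}
    (hF : F.IsHomogeneous n) (v : Fin 5 → ℂ) :
    ∑ i, v i * eval v (pderiv i F) = n * eval v F := by
  simpa using congrArg (eval v) hF.sum_X_mul_pderiv

/-- The symmetric trilinear form of a cubic form. -/
noncomputable def polarForm (F : MvPolynomial (Fin 5) ℂ) :
    (Fin 5 → ℂ) →ₗ[ℂ] (Fin 5 → ℂ) →ₗ[ℂ] (Fin 5 → ℂ) →ₗ[ℂ] ℂ :=
  ∑ i, ∑ j, ∑ k, (eval 0 (pderiv i (pderiv j (pderiv k F))) / 6) •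
    (LinearMap.proj i).smulRight ((LinearMap.proj j).smulRight (LinearMap.proj k))

theorem polarForm_apply (F : MvPolynomial (Fin 5) ℂ) (x y z : Fin 5 → ℂ) :
    polarForm F x y z =
      ∑ i, ∑ j, ∑ k, eval 0 (pderiv i (pderiv j (pderiv k F))) / 6 * (x i * (y j * z k)) := by
  simp [polarForm, LinearMap.sum_apply]

theorem polarForm_swap₁₂ (F : MvPolynomial (Fin 5) ℂ) (x y z : Fin 5 → ℂ) :
    polarForm F x y z = polarForm F y x z := by
  rw [polarForm_apply, polarForm_apply, Finset.sum_comm]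
  refine Finset.sum_congr rfl fun i _ => Finset.sum_congr rfl fun j _ =>
    Finset.sum_congr rfl fun k _ => ?_
  rw [pderiv_pderiv_comm j i]
  ring

theorem polarForm_swap₂₃ (F : MvPolynomial (Fin 5) ℂ) (x y z : Fin 5 → ℂ) :
    polarForm F x y z = polarForm F x z y := by
  rw [polarForm_apply, polarForm_apply]
  refine Finset.sum_congr rfl fun i _ => ?_
  rw [Finset.sum_comm]
  refine Finset.sum_congr rfl fun j _ => Finset.sum_congr rfl fun k _ => ?_
  rw [pderiv_pderiv_comm k j]
  ring

variable {F : MvPolynomial (Fin 5) ℂ}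

theorem hessianAt_eq (hF : F.IsHomogeneous 3) (v : Fin 5 → ℂ) (i j : Fin 5) :
    hessianAt F v i j = 6 * polarForm F v (Pi.single i 1) (Pi.single j 1) := by
  have h1 : (pderiv i (pderiv j F)).IsHomogeneous 1 := hF.pderiv.pderiv
  have h0 : ∀ k, eval v (pderiv k (pderiv i (pderiv j F))) =
      eval 0 (pderiv k (pderiv i (pderiv j F))) := by
    intro k
    have h : (pderiv k (pderiv i (pderiv j F))).IsHomogeneous 0 := h1.pderiv
    rw [← totalDegree_zero_iff_isHomogeneous, totalDegree_eq_zero_iff_eq_C] at h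
    rw [h, eval_C, eval_C]
  have h2 := sum_mul_eval_pderiv h1 v
  simp only [h0, Nat.cast_one, one_mul] at h2
  rw [hessianAt, Matrix.of_apply, ← h2, polarForm_apply, Finset.mul_sum]
  refine Finset.sum_congr rfl fun k _ => ?_
  rw [Finset.sum_eq_single i (by simp +contextual) (by simp),
    Finset.sum_eq_single j (by simp +contextual) (by simp), Pi.single_eq_same, Pi.single_eq_same]
  ring

theorem apply_eq_sum (L : (Fin 5 → ℂ) →ₗ[ℂ] ℂ) (v : Fin 5 → ℂ) :
    L v = ∑ i, v i * L (Pi.single i 1) := by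
  conv_lhs => rw [← Finset.univ_sum_single v, map_sum]
  refine Finset.sum_congr rfl fun i _ => ?_
  rw [← smul_eq_mul, ← map_smul, ← Pi.single_smul, smul_eq_mul, mul_one]

theorem eval_pderiv_eq (hF : F.IsHomogeneous 3) (v : Fin 5 → ℂ) (j : Fin 5) :
    eval v (pderiv j F) = 3 * polarForm F v v (Pi.single j 1) := by
  have h2 : (pderiv j F).IsHomogeneous 2 := hF.pderiv
  have h3 := sum_mul_eval_pderiv h2 v
  have h4 : ∀ i, eval v (pderiv i (pderiv j F)) = hessianAt F v i j := fun i => rfl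
  simp only [h4, hessianAt_eq hF] at h3
  rw [polarForm_swap₂₃, apply_eq_sum (polarForm F v (Pi.single j 1)) v, Finset.mul_sum]
  apply mul_left_cancel₀ (two_ne_zero (α := ℂ))
  rw [← Nat.cast_ofNat, ← h3, Finset.mul_sum]
  refine Finset.sum_congr rfl fun i _ => ?_
  rw [polarForm_swap₂₃ F v (Pi.single j 1)]
  push_cast
  ring

theorem eval_eq_polarForm (hF : F.IsHomogeneous 3) (v : Fin 5 → ℂ) :
    eval v F = polarForm F v v v := by
  have h := sum_mul_eval_pderiv hF v
  simp only [eval_pderiv_eq hF] at h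
  rw [apply_eq_sum (polarForm F v v) v]
  apply mul_left_cancel₀ (three_ne_zero (α := ℂ))
  rw [← Nat.cast_ofNat, ← h, Finset.mul_sum]
  refine Finset.sum_congr rfl fun i _ => ?_
  push_cast
  ring

theorem polarForm_eq_zero_iff (hF : F.IsHomogeneous 3) (v : Fin 5 → ℂ) :
    (∀ z, polarForm F v v z = 0) ↔ ∀ i, eval v (pderiv i F) = 0 := by
  simp only [eval_pderiv_eq hF]
  refine ⟨fun h i => by rw [h, mul_zero], fun h z => ?_⟩
  rw [apply_eq_sum (polarForm F v v) z]
  refine Finset.sum_eq_zero fun i _ => ?_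
  rw [(mul_eq_zero_iff_left three_ne_zero).1 (h i), mul_zero]

theorem isNodalForm_polarForm (hF : F.IsHomogeneous 3) (hnodes : ∀ p ∈ projSing F, IsNode F p) :
    IsNodalForm (polarForm F) where
  swap₁₂ := polarForm_swap₁₂ F
  swap₂₃ := polarForm_swap₂₃ F
  node v hv hsing w hw := by
    have hrank := (hnodes (Projectivization.mk ℂ v hv)
      ⟨v, hv, rfl, (polarForm_eq_zero_iff hF v).1 hsing⟩).2 v hv rfl
    have hker : ∀ w, (∀ z, polarForm F v w z = 0) → w ∈ (hessianAt F v).mulVecLin.ker := by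
      intro w hw
      rw [LinearMap.mem_ker]
      ext i
      have := hw (Pi.single i 1)
      rw [polarForm_swap₂₃, apply_eq_sum (polarForm F v (Pi.single i 1)) w] at this
      rw [Matrix.mulVecLin_apply, Matrix.mulVec, dotProduct, Pi.zero_apply,
        ← mul_zero (6 : ℂ), ← this, Finset.mul_sum]
      refine Finset.sum_congr rfl fun j _ => ?_
      rw [hessianAt_eq hF]
      ring
    have h1 := (hessianAt F v).mulVecLin.finrank_range_add_finrank_ker
    rw [← Matrix.rank, hrank, Module.finrank_fin_fun] at h1
    obtain ⟨k, hk⟩ := (finrank_eq_one_iff_of_nonzero'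
      (⟨v, hker v hsing⟩ : (hessianAt F v).mulVecLin.ker)
      (by simpa [Subtype.ext_iff] using hv)).1 (Nat.add_left_cancel (n := 4) h1) ⟨w, hker w hw⟩
    exact ⟨k, (congrArg Subtype.val hk).symm⟩

theorem exists_generalLinear_of_normal_form {F : MvPolynomial (Fin 5) ℂ} {p a b c d : Fin 5 → ℂ}
    {m : ℂ} (hspan : ∀ v, ∃ x₀ x₁ x₂ x₃ x₄ : ℂ, v = x₀ • p + x₁ • a + x₂ • b + x₃ • c + x₄ • d)
    (hF : ∀ x₀ x₁ x₂ x₃ x₄ : ℂ, eval (x₀ • p + x₁ • a + x₂ • b + x₃ • c + x₄ • d) F =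
      6 * m * (x₀ * (x₁ * x₄ - x₂ * x₃) + x₁ * x₂ * x₃ - x₁ * x₂ * x₄ - x₁ * x₃ * x₄ +
        x₂ * x₃ * x₄)) :
    ∃ T : Matrix.GeneralLinearGroup (Fin 5) ℂ, ∀ x : Fin 5 → ℂ,
      eval (fun i => ∑ j, (T : Matrix (Fin 5) (Fin 5) ℂ) i j * x j) F =
        2 * m * eval x segreCubicForm := by
  set A : Matrix (Fin 5) (Fin 5) ℂ :=
    Matrix.of fun i j => ![b + d, -p - c, a + b, p + a + b + d, b - c] j i with hA
  have happ : ∀ x : Fin 5 → ℂ, A.mulVec x = (-x 1 + x 3) • p + (x 2 + x 3) • a +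
      (x 0 + x 2 + x 3 + x 4) • b + (-x 1 - x 4) • c + (x 0 + x 3) • d := by
    intro x
    ext i
    simp [hA, Matrix.mulVec, dotProduct, Fin.sum_univ_five]
    ring
  have hunit : IsUnit A := by
    rw [← Matrix.mulVec_surjective_iff_isUnit]
    intro v
    obtain ⟨y₀, y₁, y₂, y₃, y₄, rfl⟩ := hspan v
    refine ⟨![(-y₀ - y₁ + y₂ + y₃ + y₄) / 2, (-y₀ + y₁ - y₂ - y₃ + y₄) / 2,
      (-y₀ + y₁ + y₂ + y₃ - y₄) / 2, (y₀ + y₁ - y₂ - y₃ + y₄) / 2,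
      (y₀ - y₁ + y₂ - y₃ - y₄) / 2], ?_⟩
    rw [happ]
    simp only [Matrix.cons_val]
    module
  refine ⟨hunit.unit, fun x => ?_⟩
  have h := hF (-x 1 + x 3) (x 2 + x 3) (x 0 + x 2 + x 3 + x 4) (-x 1 - x 4) (x 0 + x 3)
  rw [← happ] at h
  refine Eq.trans h ?_
  simp only [segreCubicForm, Fin.sum_univ_five, map_sub, map_add, map_pow, eval_X]
  ring

/-- A nonzero homogeneous cubic form on `ℂ⁵` all of whose singular points are nodes has
at most `10` singular points; if it has exactly `10` then it is projectively equivalent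
to the Segre cubic. -/
theorem segre_cubic_maximal_nodal_cubic
    (F : MvPolynomial (Fin 5) ℂ) (hF0 : F ≠ 0) (hFhom : F.IsHomogeneous 3)
    (hnodes : ∀ p ∈ projSing F, IsNode F p) :
    ((projSing F).Finite ∧ (projSing F).ncard ≤ 10) ∧
    ((projSing F).ncard = 10 →
      ∃ (T : Matrix.GeneralLinearGroup (Fin 5) ℂ) (c : ℂ), c ≠ 0 ∧
        ∀ x : Fin 5 → ℂ,
          eval (fun i => ∑ j, (T : Matrix (Fin 5) (Fin 5) ℂ) i j * x j) F =
            c * eval x segreCubicForm) := by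
  rcases (projSing F).eq_empty_or_nonempty with hempty | ⟨-, p, hp0, rfl, hp⟩
  · simp [hempty]
  have hT := isNodalForm_polarForm hFhom hnodes
  obtain ⟨a₀, b₀, c₀, d₀, h₀⟩ := hT.exists_isFrame (Module.finrank_fin_fun ℂ) hp0
    ((polarForm_eq_zero_iff hFhom p).2 hp)
  obtain ⟨a, b, c, d, h, hs, ht⟩ := h₀.exists_affine hT
  obtain ⟨hfin, hle, -⟩ := h.ncard_frameSing_le hT
  have hsub : projSing F ⊆ insert (Projectivization.mk ℂ p hp0)
      ((fun q => Projectivization.mk ℂ _ (h.lift_ne_zero hT q)) ''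
        frameSing (polarForm F) a b c d) := by
    rintro _ ⟨v, hv0, rfl, hv⟩
    rcases h.singular_cases hT hs ht ((polarForm_eq_zero_iff hFhom v).2 hv) with
      ⟨k, hk⟩ | ⟨q, hq, k, hk⟩
    · exact .inl ((Projectivization.mk_eq_mk_iff' ..).2 ⟨k, hk.symm⟩)
    · exact .inr ⟨q, hq, ((Projectivization.mk_eq_mk_iff' ..).2 ⟨k, hk.symm⟩).symm⟩
  have hfin' := (hfin.image fun q => Projectivization.mk ℂ _ (h.lift_ne_zero hT q)).insert
    (Projectivization.mk ℂ p hp0)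
  have hcard : (projSing F).ncard ≤ (frameSing (polarForm F) a b c d).ncard + 1 :=
    (Set.ncard_le_ncard hsub hfin').trans ((Set.ncard_insert_le _ _).trans
      (Nat.add_le_add_right (Set.ncard_image_le hfin) 1))
  refine ⟨⟨hfin'.subset hsub, by omega⟩, fun h10 => ?_⟩
  obtain ⟨p, a, b, c, d, m, hm, hspan, hform⟩ := h.exists_normal_form hT (by omega)
  obtain ⟨A, hA⟩ := exists_generalLinear_of_normal_form (m := m) hspan fun x₀ x₁ x₂ x₃ x₄ => by
    rw [eval_eq_polarForm hFhom]
    exact hform _ _ _ _ _ _ rfl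
  exact ⟨A, 2 * m, mul_ne_zero two_ne_zero hm, hA⟩
end

section
/- Let F_B(y_0,…,y_4) = y_0^4 − y_0(y_1^3 + y_2^3 + y_3^3 + y_4^3) + 3·y_1·y_2·y_3·y_4, the Burkhardt quartic form on ℂ^5. Then the hypersurface {F_B = 0} ⊂ ℙ^4(ℂ) has exactly 45 singular points, and every one of these singular points is a node. -/
open scoped LinearAlgebra.Projectivization
open MvPolynomial

/-- The Burkhardt quartic form `F_B(y) = y_0⁴ − y_0(y_1³+y_2³+y_3³+y_4³) + 3·y_1y_2y_3y_4`. -/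
noncomputable def burkhardtForm : MvPolynomial (Fin 5) ℂ :=
  X 0 ^ 4 - X 0 * (X 1 ^ 3 + X 2 ^ 3 + X 3 ^ 3 + X 4 ^ 3) + 3 * (X 1 * X 2 * X 3 * X 4)

/-- The gradient of the Burkhardt form vanishes at `v`, written out in coordinates. -/
structure BurkhardtSingular (v : Fin 5 → ℂ) : Prop where
  d0 : 4 * v 0 ^ 3 = v 1 ^ 3 + v 2 ^ 3 + v 3 ^ 3 + v 4 ^ 3
  d1 : v 0 * v 1 ^ 2 = v 2 * v 3 * v 4
  d2 : v 0 * v 2 ^ 2 = v 1 * v 3 * v 4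
  d3 : v 0 * v 3 ^ 2 = v 1 * v 2 * v 4
  d4 : v 0 * v 4 ^ 2 = v 1 * v 2 * v 3

theorem eval_pderiv_burkhardtForm (v : Fin 5 → ℂ) :
    (fun i => eval v (pderiv i burkhardtForm)) =
      ![4 * v 0 ^ 3 - (v 1 ^ 3 + v 2 ^ 3 + v 3 ^ 3 + v 4 ^ 3),
        3 * (v 2 * v 3 * v 4 - v 0 * v 1 ^ 2), 3 * (v 1 * v 3 * v 4 - v 0 * v 2 ^ 2),
        3 * (v 1 * v 2 * v 4 - v 0 * v 3 ^ 2), 3 * (v 1 * v 2 * v 3 - v 0 * v 4 ^ 2)] := by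
  have h3 (i : Fin 5) : pderiv i (3 : MvPolynomial (Fin 5) ℂ) = 0 := by
    rw [← map_ofNat C 3]; exact pderiv_C
  funext i
  fin_cases i <;>
    simp [burkhardtForm, pderiv_X, Derivation.leibniz, Derivation.leibniz_pow, h3] <;> ring

theorem burkhardtSingular_iff (v : Fin 5 → ℂ) :
    BurkhardtSingular v ↔ ∀ i : Fin 5, eval v (pderiv i burkhardtForm) = 0 := by
  have key (i : Fin 5) : eval v (pderiv i burkhardtForm) = _ :=
    congrFun (eval_pderiv_burkhardtForm v) i
  simp only [key, Fin.forall_fin_succ]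
  simp only [Matrix.cons_val_zero, Matrix.cons_val_succ, mul_eq_zero, sub_eq_zero,
    OfNat.ofNat_ne_zero, false_or]
  constructor
  · rintro ⟨h0, h1, h2, h3, h4⟩
    exact ⟨h0, h1.symm, h2.symm, h3.symm, h4.symm, fun i => i.elim0⟩
  · rintro ⟨h0, h1, h2, h3, h4, -⟩
    exact ⟨h0, h1.symm, h2.symm, h3.symm, h4.symm⟩

theorem hessianAt_burkhardtForm (v : Fin 5 → ℂ) :
    hessianAt burkhardtForm v =
      !![12 * v 0 ^ 2, -3 * v 1 ^ 2, -3 * v 2 ^ 2, -3 * v 3 ^ 2, -3 * v 4 ^ 2;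
        -3 * v 1 ^ 2, -6 * v 0 * v 1, 3 * v 3 * v 4, 3 * v 2 * v 4, 3 * v 2 * v 3;
        -3 * v 2 ^ 2, 3 * v 3 * v 4, -6 * v 0 * v 2, 3 * v 1 * v 4, 3 * v 1 * v 3;
        -3 * v 3 ^ 2, 3 * v 2 * v 4, 3 * v 1 * v 4, -6 * v 0 * v 3, 3 * v 1 * v 2;
        -3 * v 4 ^ 2, 3 * v 2 * v 3, 3 * v 1 * v 3, 3 * v 1 * v 2, -6 * v 0 * v 4] := by
  have h3 (i : Fin 5) : pderiv i (3 : MvPolynomial (Fin 5) ℂ) = 0 := by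
    rw [← map_ofNat C 3]; exact pderiv_C
  have h4 (i : Fin 5) : pderiv i (4 : MvPolynomial (Fin 5) ℂ) = 0 := by
    rw [← map_ofNat C 4]; exact pderiv_C
  ext i j
  fin_cases i <;> fin_cases j <;>
    simp [hessianAt, burkhardtForm, pderiv_X, Derivation.leibniz, Derivation.leibniz_pow,
      Pi.single_apply, h3, h4] <;> ring

theorem BurkhardtSingular.smul {v : Fin 5 → ℂ} (h : BurkhardtSingular v) (t : ℂ) :
    BurkhardtSingular (t • v) := by
  obtain ⟨h0, h1, h2, h3, h4⟩ := h
  constructor <;> simp only [Pi.smul_apply, smul_eq_mul]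
  · linear_combination t ^ 3 * h0
  · linear_combination t ^ 3 * h1
  · linear_combination t ^ 3 * h2
  · linear_combination t ^ 3 * h3
  · linear_combination t ^ 3 * h4

/-- Membership in the singular locus does not depend on the representative. -/
theorem mk_mem_projSing_iff {v : Fin 5 → ℂ} (hv : v ≠ 0) :
    Projectivization.mk ℂ v hv ∈ projSing burkhardtForm ↔ BurkhardtSingular v := by
  constructor
  · rintro ⟨w, hw, hp, hs⟩
    obtain ⟨a, rfl⟩ := (Projectivization.mk_eq_mk_iff' ℂ v w hv hw).1 hp
    exact ((burkhardtSingular_iff w).2 hs).smul a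
  · intro h
    exact ⟨v, hv, rfl, (burkhardtSingular_iff v).1 h⟩

/-- The two kinds of singular points: those off the hyperplane `y₀ = 0`, and those on it. -/
theorem BurkhardtSingular.cases {v : Fin 5 → ℂ} (h : BurkhardtSingular v) (hv : v ≠ 0) :
    (v 0 ≠ 0 ∧ (∀ i, v i ^ 3 = v 0 ^ 3) ∧ v 1 * v 2 * v 3 * v 4 = v 0 ^ 4) ∨
    (∃ i j : Fin 4, i < j ∧ v i.succ ≠ 0 ∧ v j.succ ≠ 0 ∧ v i.succ ^ 3 + v j.succ ^ 3 = 0 ∧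
      ∀ k, k ≠ i.succ → k ≠ j.succ → v k = 0) := by
  obtain ⟨h0, h1, h2, h3, h4⟩ := h
  by_cases hz : v 0 = 0
  · right
    have hne : ¬ (v 1 = 0 ∧ v 2 = 0 ∧ v 3 = 0 ∧ v 4 = 0) := by
      rintro ⟨e1, e2, e3, e4⟩
      apply hv
      funext i
      fin_cases i <;> simpa
    have build (i j : Fin 4) (hij : i < j) (hi : v i.succ ≠ 0) (hj : v j.succ ≠ 0)
        (hk : ∀ k : Fin 4, k ≠ i → k ≠ j → v k.succ = 0) :
        ∃ i j : Fin 4, i < j ∧ v i.succ ≠ 0 ∧ v j.succ ≠ 0 ∧ v i.succ ^ 3 + v j.succ ^ 3 = 0 ∧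
          ∀ k, k ≠ i.succ → k ≠ j.succ → v k = 0 := by
      refine ⟨i, j, hij, hi, hj, ?_, fun k hki hkj => ?_⟩
      · have hsum : ∑ k : Fin 4, v k.succ ^ 3 = 0 := by
          simp only [Fin.sum_univ_four]
          change v 1 ^ 3 + v 2 ^ 3 + v 3 ^ 3 + v 4 ^ 3 = 0
          linear_combination -h0 + 4 * v 0 ^ 2 * hz
        rw [← hsum]
        refine (Fintype.sum_eq_add (f := fun k : Fin 4 => v k.succ ^ 3) i j hij.ne
          fun k hk' => ?_).symm
        rw [hk k hk'.1 hk'.2, zero_pow three_ne_zero]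
      · cases k using Fin.cases with
        | zero => exact hz
        | succ k => exact hk k (fun e => hki (e ▸ rfl)) (fun e => hkj (e ▸ rfl))
    simp only [hz, zero_mul, zero_eq_mul, mul_eq_zero] at h1 h2 h3 h4
    by_cases e1 : v 1 = 0 <;> by_cases e2 : v 2 = 0 <;> by_cases e3 : v 3 = 0 <;>
      by_cases e4 : v 4 = 0 <;> simp only [e1, e2, e3, e4, or_self, or_true, and_true,
        not_true_eq_false, or_false] at h0 h1 h2 h3 h4 hne
    all_goals first
      | exact build 0 1 (by decide) e1 e2 (by simp [Fin.forall_fin_succ, e3, e4])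
      | exact build 0 2 (by decide) e1 e3 (by simp [Fin.forall_fin_succ, e2, e4])
      | exact build 0 3 (by decide) e1 e4 (by simp [Fin.forall_fin_succ, e2, e3])
      | exact build 1 2 (by decide) e2 e3 (by simp [Fin.forall_fin_succ, e1, e4])
      | exact build 1 3 (by decide) e2 e4 (by simp [Fin.forall_fin_succ, e1, e3])
      | exact build 2 3 (by decide) e3 e4 (by simp [Fin.forall_fin_succ, e1, e2])
      | (simp only [hz] at h0; replace h0 := h0.symm; norm_num [e1, e2, e3, e4] at h0)
  · left
    have hP : v 1 * v 2 * v 3 * v 4 = v 0 ^ 4 := by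
      linear_combination (-1 / 4) * (v 0 * h0 + v 1 * h1 + v 2 * h2 + v 3 * h3 + v 4 * h4)
    refine ⟨hz, fun i => mul_left_cancel₀ hz ?_, hP⟩
    fin_cases i <;> simp only [Fin.zero_eta, Fin.mk_one, Fin.reduceFinMk]
    · linear_combination v 1 * h1 + hP
    · linear_combination v 2 * h2 + hP
    · linear_combination v 3 * h3 + hP
    · linear_combination v 4 * h4 + hP

theorem rank_eq_of_ker_eq_span {v : Fin 5 → ℂ} (hv : v ≠ 0) (M : Matrix (Fin 5) (Fin 5) ℂ)
    (hM : LinearMap.ker M.mulVecLin = ℂ ∙ v) : M.rank = 4 := by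
  have h := LinearMap.finrank_range_add_finrank_ker M.mulVecLin
  rw [hM, finrank_span_singleton hv, Module.finrank_fin_fun] at h
  rw [Matrix.rank]
  omega

theorem mulVec_hessianAt_eq_zero_iff (v x : Fin 5 → ℂ) :
    (hessianAt burkhardtForm v).mulVec x = 0 ↔
      4 * v 0 ^ 2 * x 0 = v 1 ^ 2 * x 1 + v 2 ^ 2 * x 2 + v 3 ^ 2 * x 3 + v 4 ^ 2 * x 4 ∧
      v 1 ^ 2 * x 0 + 2 * v 0 * v 1 * x 1 = v 3 * v 4 * x 2 + v 2 * v 4 * x 3 + v 2 * v 3 * x 4 ∧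
      v 2 ^ 2 * x 0 + 2 * v 0 * v 2 * x 2 = v 3 * v 4 * x 1 + v 1 * v 4 * x 3 + v 1 * v 3 * x 4 ∧
      v 3 ^ 2 * x 0 + 2 * v 0 * v 3 * x 3 = v 2 * v 4 * x 1 + v 1 * v 4 * x 2 + v 1 * v 2 * x 4 ∧
      v 4 ^ 2 * x 0 + 2 * v 0 * v 4 * x 4 =
        v 2 * v 3 * x 1 + v 1 * v 3 * x 2 + v 1 * v 2 * x 3 := by
  have h : (hessianAt burkhardtForm v).mulVec x =
      ![3 * (4 * v 0 ^ 2 * x 0 - (v 1 ^ 2 * x 1 + v 2 ^ 2 * x 2 + v 3 ^ 2 * x 3 + v 4 ^ 2 * x 4)),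
        -3 * (v 1 ^ 2 * x 0 + 2 * v 0 * v 1 * x 1 -
          (v 3 * v 4 * x 2 + v 2 * v 4 * x 3 + v 2 * v 3 * x 4)),
        -3 * (v 2 ^ 2 * x 0 + 2 * v 0 * v 2 * x 2 -
          (v 3 * v 4 * x 1 + v 1 * v 4 * x 3 + v 1 * v 3 * x 4)),
        -3 * (v 3 ^ 2 * x 0 + 2 * v 0 * v 3 * x 3 -
          (v 2 * v 4 * x 1 + v 1 * v 4 * x 2 + v 1 * v 2 * x 4)),
        -3 * (v 4 ^ 2 * x 0 + 2 * v 0 * v 4 * x 4 -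
          (v 2 * v 3 * x 1 + v 1 * v 3 * x 2 + v 1 * v 2 * x 3))] := by
    rw [hessianAt_burkhardtForm]
    funext i
    fin_cases i <;> simp [Matrix.mulVec, dotProduct, Fin.sum_univ_five] <;> ring
  rw [h, funext_iff]
  simp only [Fin.forall_fin_succ, IsEmpty.forall_iff, Matrix.cons_val_zero, Matrix.cons_val_succ,
    Pi.zero_apply, mul_eq_zero, neg_eq_zero, OfNat.ofNat_ne_zero, false_or, sub_eq_zero, and_true]

theorem BurkhardtSingular.ker_hessianAt {v : Fin 5 → ℂ} (h : BurkhardtSingular v) (hv : v ≠ 0) :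
    LinearMap.ker (hessianAt burkhardtForm v).mulVecLin = ℂ ∙ v := by
  ext x
  rw [LinearMap.mem_ker, Matrix.mulVecLin_apply, mulVec_hessianAt_eq_zero_iff,
    Submodule.mem_span_singleton]
  constructor
  · rintro ⟨e0, e1, e2, e3, e4⟩
    obtain ⟨hz, hc, hP⟩ | ⟨i, j, hij, hi, hj, hc, hk⟩ := h.cases hv
    · have hne (i : Fin 5) : v i ≠ 0 := fun hi => by
        have := hc i
        rw [hi, zero_pow three_ne_zero] at this
        exact hz (pow_eq_zero_iff three_ne_zero |>.1 this.symm)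
      have hu (i : Fin 5) : ∃ u, x i = u * v i := ⟨x i / v i, (div_mul_cancel₀ _ (hne i)).symm⟩
      choose u hu using hu
      have c1 := hc 1
      have c2 := hc 2
      have c3 := hc 3
      have c4 := hc 4
      simp only [hu] at e0 e1 e2 e3 e4
      have f1 : u 0 + 2 * u 1 = u 2 + u 3 + u 4 := mul_left_cancel₀ (pow_ne_zero 4 hz) (by
        linear_combination v 1 * e1 - (v 0 * u 0 + 2 * v 0 * u 1) * c1 + (u 2 + u 3 + u 4) * hP)
      have f2 : u 0 + 2 * u 2 = u 1 + u 3 + u 4 := mul_left_cancel₀ (pow_ne_zero 4 hz) (by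
        linear_combination v 2 * e2 - (v 0 * u 0 + 2 * v 0 * u 2) * c2 + (u 1 + u 3 + u 4) * hP)
      have f3 : u 0 + 2 * u 3 = u 1 + u 2 + u 4 := mul_left_cancel₀ (pow_ne_zero 4 hz) (by
        linear_combination v 3 * e3 - (v 0 * u 0 + 2 * v 0 * u 3) * c3 + (u 1 + u 2 + u 4) * hP)
      have f4 : u 0 + 2 * u 4 = u 1 + u 2 + u 3 := mul_left_cancel₀ (pow_ne_zero 4 hz) (by
        linear_combination v 4 * e4 - (v 0 * u 0 + 2 * v 0 * u 4) * c4 + (u 1 + u 2 + u 3) * hP)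
      have f0 : 4 * u 0 = u 1 + u 2 + u 3 + u 4 := mul_left_cancel₀ (pow_ne_zero 3 hz) (by
        linear_combination e0 + u 1 * c1 + u 2 * c2 + u 3 * c3 + u 4 * c4)
      refine ⟨u 0, funext fun i => ?_⟩
      rw [Pi.smul_apply, smul_eq_mul, hu i]
      congr 1
      fin_cases i <;> simp only [Fin.zero_eta, Fin.mk_one, Fin.reduceFinMk]
      · linear_combination (1 / 3) * (f0 - f1)
      · linear_combination (1 / 3) * (f0 - f2)
      · linear_combination (1 / 3) * (f0 - f3)
      · linear_combination (1 / 3) * (f0 - f4)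
    · have key (hx : ∀ k, k ≠ i.succ → k ≠ j.succ → x k = 0)
          (he : 0 = v i.succ ^ 2 * x i.succ + v j.succ ^ 2 * x j.succ) : ∃ a : ℂ, a • v = x := by
        refine ⟨x i.succ / v i.succ, funext fun k => ?_⟩
        rw [Pi.smul_apply, smul_eq_mul, div_mul_eq_mul_div, div_eq_iff hi]
        by_cases hki : k = i.succ
        · rw [hki]
        by_cases hkj : k = j.succ
        · rw [hkj]
          refine mul_left_cancel₀ (pow_ne_zero 2 hj) ?_
          linear_combination x i.succ * hc + v i.succ * he
        · rw [hx k hki hkj, hk k hki hkj, mul_zero, zero_mul]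
      fin_cases i <;> fin_cases j <;> first
        | exact absurd hij (by decide)
        | simp [Fin.forall_fin_succ] at hi hj hk key
          simp [hk, hi, hj] at e0 e1 e2 e3 e4
          simp [e1, e2, e3, e4, e0] at key
          exact key
  · rintro ⟨c, rfl⟩
    obtain ⟨h0, h1, h2, h3, h4⟩ := h
    simp only [Pi.smul_apply, smul_eq_mul]
    refine ⟨?_, ?_, ?_, ?_, ?_⟩
    · linear_combination c * h0
    · linear_combination 3 * c * h1
    · linear_combination 3 * c * h2
    · linear_combination 3 * c * h3
    · linear_combination 3 * c * h4

/-- Labels for the nodes: three exponents of a cube root of unity, or a pair of coordinates and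
one such exponent. -/
abbrev NodeIndex : Type :=
  (Fin 3 × Fin 3 × Fin 3) ⊕ ({p : Fin 4 × Fin 4 // p.1 < p.2} × Fin 3)

theorem card_nodeIndex : Nat.card NodeIndex = 45 := by
  rw [Nat.card_eq_fintype_card]
  decide

/-- The representative of the node with a given label, in terms of a cube root of unity `ω`. -/
noncomputable def nodeVec (ω : ℂ) : NodeIndex → Fin 5 → ℂ
  | .inl (a, b, c) => ![1, ω ^ (a : ℕ), ω ^ (b : ℕ), ω ^ (c : ℕ), (ω ^ (a + b + c : ℕ)) ^ 2]
  | .inr (p, k) => Pi.single p.1.1.succ 1 - Pi.single p.1.2.succ (ω ^ (k : ℕ))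

theorem nodeVec_ne_zero (ω : ℂ) (n : NodeIndex) : nodeVec ω n ≠ 0 := by
  intro h
  match n with
  | .inl (a, b, c) => simpa [nodeVec] using congrFun h 0
  | .inr (⟨(i, j), hij⟩, k) =>
    have hij' : i ≠ j := ne_of_lt hij
    simpa [nodeVec, hij'] using congrFun h i.succ

theorem nodeVec_singular {ω : ℂ} (hω : IsPrimitiveRoot ω 3) (n : NodeIndex) :
    BurkhardtSingular (nodeVec ω n) := by
  have hpow (m : ℕ) : (ω ^ m) ^ 3 = 1 := by rw [pow_right_comm, hω.pow_eq_one, one_pow]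
  match n with
  | .inl (a, b, c) =>
    have ha := hpow a
    have hb := hpow b
    have hc := hpow c
    simp only [nodeVec, pow_add]
    generalize ω ^ (a : ℕ) = x at *
    generalize ω ^ (b : ℕ) = y at *
    generalize ω ^ (c : ℕ) = z at *
    have hxyz : (x * y * z) ^ 3 = 1 := by rw [mul_pow, mul_pow, ha, hb, hc]; norm_num
    constructor <;>
      simp only [Matrix.cons_val]
    · linear_combination -ha - hb - hc - ((x * y * z) ^ 3 + 1) * hxyz
    · linear_combination -x ^ 2 * (y ^ 3 * hc + hb)
    · linear_combination -y ^ 2 * (x ^ 3 * hc + ha)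
    · linear_combination -z ^ 2 * (x ^ 3 * hb + ha)
    · linear_combination (x * y * z) * hxyz
  | .inr (⟨(i, j), hij⟩, k) =>
    have hk := hpow k
    simp only [nodeVec]
    generalize ω ^ (k : ℕ) = x at *
    have hij' : i < j := hij
    clear hij
    fin_cases i <;> fin_cases j <;> first
      | exact absurd hij' (by decide)
      | constructor <;> simp [Fin.ext_iff, Odd.neg_pow (by decide : Odd 3), hk]

theorem nodeVec_injective {ω : ℂ} (hω : IsPrimitiveRoot ω 3) {m n : NodeIndex} {t : ℂ}
    (h : t • nodeVec ω n = nodeVec ω m) : m = n := by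
  have hinj {a b : Fin 3} (hab : ω ^ (a : ℕ) = ω ^ (b : ℕ)) : a = b :=
    Fin.ext (hω.pow_inj a.2 b.2 hab)
  have hne (a : Fin 3) : ω ^ (a : ℕ) ≠ 0 := pow_ne_zero _ (hω.ne_zero three_ne_zero)
  match m, n with
  | .inl (a, b, c), .inl (a', b', c') =>
    have h0 : t = 1 := by simpa [nodeVec] using congrFun h 0
    have h1 := congrFun h 1
    have h2 := congrFun h 2
    have h3 := congrFun h 3
    simp only [nodeVec, h0, one_smul, Matrix.cons_val] at h1 h2 h3
    rw [hinj h1, hinj h2, hinj h3]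
  | .inl (a, b, c), .inr (p, k) => simpa [nodeVec, Pi.single_apply] using congrFun h 0
  | .inr (p, k), .inl (a, b, c) =>
    have h0 : t = 0 := by simpa [nodeVec, Pi.single_apply] using congrFun h 0
    rw [h0, zero_smul] at h
    exact absurd h.symm (nodeVec_ne_zero ω _)
  | .inr (⟨(i, j), hij⟩, k), .inr (⟨(i', j'), hij'⟩, k') =>
    have hlt : i < j := hij
    have hlt' : i' < j' := hij'
    have h1 : i = i' ∨ i = j' := by
      by_contra! hc
      simpa [nodeVec, hc.1, hc.2, hlt.ne] using congrFun h i.succ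
    have h2 : j = i' ∨ j = j' := by
      by_contra! hc
      simpa [nodeVec, hc.1, hc.2, hlt.ne', hne] using congrFun h j.succ
    obtain ⟨rfl, rfl⟩ : i = i' ∧ j = j' := by omega
    have h3 : t = 1 := by simpa [nodeVec, hlt.ne] using congrFun h i.succ
    have h4 : ω ^ (k' : ℕ) = ω ^ (k : ℕ) := by
      simpa [nodeVec, hlt.ne', h3] using congrFun h j.succ
    rw [hinj h4]

theorem BurkhardtSingular.exists_smul_nodeVec {ω : ℂ} (hω : IsPrimitiveRoot ω 3) {v : Fin 5 → ℂ}
    (h : BurkhardtSingular v) (hv : v ≠ 0) : ∃ (n : NodeIndex) (t : ℂ), t • nodeVec ω n = v := by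
  have root {x y : ℂ} (hy : y ≠ 0) (hxy : x ^ 3 = y ^ 3) :
      ∃ a : Fin 3, y * ω ^ (a : ℕ) = x := by
    obtain ⟨a, ha, hax⟩ := hω.eq_pow_of_pow_eq_one (ξ := x / y)
      (by rw [div_pow, hxy, div_self (pow_ne_zero 3 hy)])
    exact ⟨⟨a, ha⟩, by rw [hax, mul_div_cancel₀ _ hy]⟩
  obtain ⟨hz, hc, hP⟩ | ⟨i, j, hij, hi, hj, hc, hk⟩ := h.cases hv
  · obtain ⟨a, ha⟩ := root hz (hc 1)
    obtain ⟨b, hb⟩ := root hz (hc 2)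
    obtain ⟨c, hc'⟩ := root hz (hc 3)
    refine ⟨.inl (a, b, c), v 0, funext fun i => ?_⟩
    have hpow (m : ℕ) : (ω ^ m) ^ 3 = 1 := by rw [pow_right_comm, hω.pow_eq_one, one_pow]
    have h4 : v 4 * ω ^ (a + b + c : ℕ) = v 0 := by
      refine mul_left_cancel₀ (pow_ne_zero 3 hz) ?_
      rw [← ha, ← hb, ← hc'] at hP
      rw [pow_add, pow_add]
      linear_combination hP
    fin_cases i <;> simp [nodeVec, ha, hb, hc']
    rw [← h4]
    linear_combination v 4 * hpow (a + b + c)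
  · obtain ⟨k, hk'⟩ := root (x := -v j.succ) hi (by linear_combination -hc)
    refine ⟨.inr (⟨(i, j), hij⟩, k), v i.succ, funext fun l => ?_⟩
    by_cases hli : l = i.succ
    · simp [hli, nodeVec, hij.ne]
    by_cases hlj : l = j.succ
    · simp [hlj, nodeVec, hij.ne', hk']
    · simp [nodeVec, hli, hlj, hk l hli hlj]

theorem projSing_burkhardtForm_eq_range {ω : ℂ} (hω : IsPrimitiveRoot ω 3) :
    projSing burkhardtForm =
      Set.range fun n => Projectivization.mk ℂ (nodeVec ω n) (nodeVec_ne_zero ω n) := by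
  ext p
  induction p using Projectivization.ind with
  | h v hv =>
    rw [mk_mem_projSing_iff, Set.mem_range]
    simp only [Projectivization.mk_eq_mk_iff']
    constructor
    · intro h
      obtain ⟨n, t, rfl⟩ := h.exists_smul_nodeVec hω hv
      have ht : t ≠ 0 := by rintro rfl; exact hv (zero_smul _ _)
      exact ⟨n, t⁻¹, inv_smul_smul₀ ht _⟩
    · rintro ⟨n, a, ha⟩
      have hs := nodeVec_singular hω n
      have ha0 : a ≠ 0 := by
        rintro rfl
        exact nodeVec_ne_zero ω n (by rw [← ha, zero_smul])
      rw [← inv_smul_smul₀ ha0 v, ha]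
      exact hs.smul _

/-- The Burkhardt quartic hypersurface in `ℙ⁴(ℂ)` has exactly `45` singular points, and
each of them is a node. -/
theorem burkhardt_quartic_has_45_nodes :
    (projSing burkhardtForm).Finite ∧ (projSing burkhardtForm).ncard = 45 ∧
    ∀ p ∈ projSing burkhardtForm, IsNode burkhardtForm p := by
  have hω := Complex.isPrimitiveRoot_exp 3 three_ne_zero
  rw [projSing_burkhardtForm_eq_range hω]
  refine ⟨Set.finite_range _, ?_, fun p hp => ?_⟩
  · rw [← Nat.card_coe_set_eq, Nat.card_range_of_injective, card_nodeIndex]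
    intro m n hmn
    obtain ⟨t, ht⟩ := (Projectivization.mk_eq_mk_iff' ℂ _ _ _ _).1 hmn
    exact nodeVec_injective hω ht
  · rw [← projSing_burkhardtForm_eq_range hω] at hp
    refine ⟨hp, fun v hv hpv => rank_eq_of_ker_eq_span hv _ ?_⟩
    rw [hpv, mk_mem_projSing_iff] at hp
    exact hp.ker_hessianAt hv
end

section
/- The Klein cubic, the hypersurface in ℙ^4(ℂ) defined by Σ_{i∈ℤ/5} x_i^2·x_{i+1} = 0 (indices taken modulo 5), is smooth. Equivalently: if x = (x_i)_{i∈ℤ/5} ∈ ℂ^5 satisfies x_{i−1}^2 + 2·x_i·x_{i+1} = 0 for every i ∈ ℤ/5 (the vanishing of all partial derivatives of the defining cubic), then x = 0. -/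
/-- The Klein cubic `Σ_{i∈ℤ/5} x_i² x_{i+1} = 0` in `ℙ⁴(ℂ)` is smooth: if all partial
derivatives `x_{i−1}² + 2·x_i·x_{i+1}` of the defining cubic vanish at
`x = (x_i)_{i∈ℤ/5} ∈ ℂ⁵`, then `x = 0`. -/
theorem klein_cubic_smooth (x : ZMod 5 → ℂ)
    (h : ∀ i : ZMod 5, x (i - 1) ^ 2 + 2 * x i * x (i + 1) = 0) : x = 0 := by
  have hstep (i : ZMod 5) (hi : x i = 0) : x (i - 1) = 0 := by
    simpa [hi] using h i
  have h0 := h 0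
  have h1 : x 0 ^ 2 + 2 * x 1 * x 2 = 0 := h 1
  have h2 : x 1 ^ 2 + 2 * x 2 * x 3 = 0 := h 2
  have h3 : x 2 ^ 2 + 2 * x 3 * x 4 = 0 := h 3
  have h4 : x 3 ^ 2 + 2 * x 4 * x 0 = 0 := h 4
  change x 4 ^ 2 + 2 * x 0 * x 1 = 0 at h0
  -- The monomials `x i ^ 2 * x (i + 1)` are multiplied by `-2` as `i` decreases by one.
  have hy : x 0 ^ 2 * x 1 = 0 := by
    linear_combination (x 1 * h1 - 2 * x 2 * h2 + 4 * x 3 * h3 - 8 * x 4 * h4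
      + 16 * x 0 * h0) / 33
  have hx : x 0 = 0 := by
    rcases mul_eq_zero.mp hy with hx | hx
    · exact pow_eq_zero_iff two_ne_zero |>.mp hx
    · exact hstep 1 hx
  have hx4 : x 4 = 0 := hstep 0 hx
  have hx3 : x 3 = 0 := hstep 4 hx4
  have hx2 : x 2 = 0 := hstep 3 hx3
  have hx1 : x 1 = 0 := hstep 2 hx2
  funext i
  fin_cases i
  exacts [hx, hx1, hx2, hx3, hx4]
end

section
/- Let σ_k denote the k-th elementary symmetric polynomial in six variables, and define the homogeneous quintic Q(x_0,…,x_4) = (σ_5 + σ_2·σ_3)(x_0, x_1, x_2, x_3, x_4, −(x_0+x_1+x_2+x_3+x_4)) on ℂ^5. Then the quintic hypersurface {Q = 0} ⊂ ℙ^4(ℂ) has exactly 130 singular points, and every one of these singular points is a node. -/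
open scoped LinearAlgebra.Projectivization
open MvPolynomial

/-- The substitution `(x_0,…,x_4) ↦ (x_0,…,x_4,−(x_0+⋯+x_4))`. -/
noncomputable def hyperplaneSub : Fin 6 → MvPolynomial (Fin 5) ℂ := fun i =>
  if h : (i : ℕ) < 5 then X ⟨(i : ℕ), h⟩ else -(∑ j : Fin 5, X j)

/-- Van Straten's quintic: `Q(x_0,…,x_4) = (σ_5 + σ_2·σ_3)(x_0,…,x_4,−(x_0+⋯+x_4))`,
where `σ_k` is the `k`-th elementary symmetric polynomial in six variables. -/
noncomputable def vanStratenQuintic : MvPolynomial (Fin 5) ℂ :=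
  MvPolynomial.aeval hyperplaneSub
    (esymm (Fin 6) ℂ 5 + esymm (Fin 6) ℂ 2 * esymm (Fin 6) ℂ 3)


lemma hyperplaneSub_eq : hyperplaneSub =
    ![X 0, X 1, X 2, X 3, X 4, -(X 0 + X 1 + X 2 + X 3 + X 4)] := by
  funext i
  fin_cases i <;> simp [hyperplaneSub, Fin.sum_univ_five]

lemma sum_hyperplaneSub : ∑ j, hyperplaneSub j = 0 := by
  simp [hyperplaneSub_eq, Fin.sum_univ_six]

lemma vanStratenQuintic_eq : vanStratenQuintic =
    C (1 / 5) * ∑ j, hyperplaneSub j ^ 5 -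
      C (1 / 3) * ((∑ j, hyperplaneSub j ^ 2) * ∑ j, hyperplaneSub j ^ 3) := by
  have newton (k : ℕ) := congrArg (aeval hyperplaneSub) (mul_esymm_eq_sum (Fin 6) ℂ k)
  have h2 := newton 2
  have h3 := newton 3
  have h5 := newton 5
  have f2 : {a ∈ Finset.HasAntidiagonal.antidiagonal 2 | a.1 < 2} = {((0 : ℕ), (2 : ℕ)), (1, 1)} := by decide
  have f3 : {a ∈ Finset.HasAntidiagonal.antidiagonal 3 | a.1 < 3} = {((0 : ℕ), (3 : ℕ)), (1, 2), (2, 1)} := by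
    decide
  have f5 : {a ∈ Finset.HasAntidiagonal.antidiagonal 5 | a.1 < 5} =
    {((0 : ℕ), (5 : ℕ)), (1, 4), (2, 3), (3, 2), (4, 1)} := by decide
  rw [f2] at h2
  rw [f3] at h3
  rw [f5] at h5
  simp [psum, sum_hyperplaneSub, -aeval_eq_bind₁] at h2 h3 h5
  rw [vanStratenQuintic]
  simp only [map_add, map_mul]
  have c5 : (C (1 / 5) : MvPolynomial (Fin 5) ℂ) * 5 = 1 := by
    rw [← map_ofNat C, ← map_mul]; norm_num
  have c3 : (C (1 / 3) : MvPolynomial (Fin 5) ℂ) * 3 = 1 := by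
    rw [← map_ofNat C, ← map_mul]; norm_num
  generalize aeval hyperplaneSub (esymm (Fin 6) ℂ 2) = e2 at *
  generalize aeval hyperplaneSub (esymm (Fin 6) ℂ 3) = e3 at *
  generalize aeval hyperplaneSub (esymm (Fin 6) ℂ 5) = e5 at *
  generalize (C (1 / 5) : MvPolynomial (Fin 5) ℂ) = u5 at *
  generalize (C (1 / 3) : MvPolynomial (Fin 5) ℂ) = u3 at *
  generalize ∑ j, hyperplaneSub j ^ 2 = p2 at *
  generalize ∑ j, hyperplaneSub j ^ 3 = p3 at *
  generalize ∑ j, hyperplaneSub j ^ 5 = p5 at *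
  have hp2 : p2 = -(2 * e2) := by linear_combination h2
  have hp3 : p3 = 3 * e3 := by linear_combination -h3
  have hp5 : p5 = 5 * e5 - 5 * e2 * e3 := by
    subst hp2 hp3; linear_combination -h5
  subst hp2 hp3 hp5
  linear_combination (-e5 + e2 * e3) * c5 - 2 * e2 * e3 * c3

/-- The first derivative in direction `i` of the `j`-th linear form. -/
def coeffSub (i : Fin 5) (j : Fin 6) : ℂ :=
  if j = i.castSucc then 1 else if j = Fin.last 5 then -1 else 0

lemma pderiv_hyperplaneSub (i : Fin 5) (j : Fin 6) :
    pderiv i (hyperplaneSub j) = C (coeffSub i j) := by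
  rw [hyperplaneSub_eq]
  fin_cases i <;> fin_cases j <;> simp [coeffSub, pderiv_X]

lemma sum_coeffSub_mul {A : Type*} [CommRing A] [Algebra ℂ A] (i : Fin 5) (g : Fin 6 → A) :
    ∑ j, algebraMap ℂ A (coeffSub i j) * g j = g i.castSucc - g (Fin.last 5) := by
  fin_cases i <;> simp [coeffSub, Fin.sum_univ_six, sub_eq_add_neg]

/-- The gradient in six coordinates of `p₅ / 5 - p₂ p₃ / 3`. -/
noncomputable def grad {A : Type*} [CommRing A] [Algebra ℂ A] (x : Fin 6 → A) (j : Fin 6) : A :=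
  x j ^ 4 - (∑ l, x l ^ 2) * x j ^ 2 - algebraMap ℂ A (2 / 3) * (∑ l, x l ^ 3) * x j

lemma pderiv_vanStratenQuintic (i : Fin 5) : pderiv i vanStratenQuintic =
    grad hyperplaneSub i.castSucc - grad hyperplaneSub (Fin.last 5) := by
  have c5 : (C (1 / 5) : MvPolynomial (Fin 5) ℂ) * 5 = 1 := by
    rw [← map_ofNat C, ← map_mul]; norm_num
  have c3 : (C (1 / 3) : MvPolynomial (Fin 5) ℂ) * 3 = 1 := by
    rw [← map_ofNat C, ← map_mul]; norm_num
  have c23 : (C (2 / 3) : MvPolynomial (Fin 5) ℂ) = 2 * C (1 / 3) := by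
    rw [← map_ofNat C, ← map_mul]; norm_num
  rw [← sum_coeffSub_mul, vanStratenQuintic_eq]
  simp only [grad, algebraMap_eq, map_sub, Derivation.leibniz, map_sum, Derivation.leibniz_pow,
    pderiv_hyperplaneSub, pderiv_C, smul_eq_mul, nsmul_eq_mul, c23]
  generalize ∑ j, hyperplaneSub j ^ 2 = p2
  generalize ∑ j, hyperplaneSub j ^ 3 = p3
  simp only [Fin.sum_univ_six]
  push_cast
  linear_combination (norm := (simp only [Fin.sum_univ_six]; ring))
    (∑ j, C (coeffSub i j) * hyperplaneSub j ^ 4) * c5 -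
      p2 * (∑ j, C (coeffSub i j) * hyperplaneSub j ^ 2) * c3

/-- The Hessian in six coordinates of `p₅ / 5 - p₂ p₃ / 3`. -/
noncomputable def hess (x : Fin 6 → ℂ) (j k : Fin 6) : ℂ :=
  (if j = k then 4 * x j ^ 3 - 2 * (∑ l, x l ^ 2) * x j - 2 / 3 * ∑ l, x l ^ 3 else 0) -
    2 * x j * x k * (x j + x k)

/-- The point of the hyperplane `∑ x_i = 0` with first five coordinates `v`. -/
noncomputable def lift6 (v : Fin 5 → ℂ) (j : Fin 6) : ℂ := eval v (hyperplaneSub j)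

lemma lift6_eq (v : Fin 5 → ℂ) :
    lift6 v = ![v 0, v 1, v 2, v 3, v 4, -(v 0 + v 1 + v 2 + v 3 + v 4)] := by
  funext j
  fin_cases j <;> simp [lift6, hyperplaneSub_eq]

lemma sum_lift6 (v : Fin 5 → ℂ) : ∑ j, lift6 v j = 0 := by
  simp [lift6_eq, Fin.sum_univ_six]

lemma eval_pderiv_vanStratenQuintic (v : Fin 5 → ℂ) (i : Fin 5) :
    eval v (pderiv i vanStratenQuintic) =
      grad (lift6 v) i.castSucc - grad (lift6 v) (Fin.last 5) := by
  simp [pderiv_vanStratenQuintic, grad, lift6]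

lemma eval_pderiv_grad (v : Fin 5 → ℂ) (i : Fin 5) (j : Fin 6) :
    eval v (pderiv i (grad hyperplaneSub j)) =
      hess (lift6 v) i.castSucc j - hess (lift6 v) (Fin.last 5) j := by
  rw [← sum_coeffSub_mul (A := ℂ) i fun k => hess (lift6 v) k j]
  simp only [grad, algebraMap_eq, map_sub, Derivation.leibniz, map_sum, Derivation.leibniz_pow,
    pderiv_hyperplaneSub, pderiv_C, smul_eq_mul, nsmul_eq_mul, map_mul, map_add, map_pow, eval_C,
    map_natCast, map_zero]
  have h (x : Fin 6 → ℂ) (d : Fin 6 → ℂ) : ∑ k, d k * hess x k j =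
    d j * (4 * x j ^ 3 - 2 * (∑ l, x l ^ 2) * x j - 2 / 3 * ∑ l, x l ^ 3)
    - ∑ k, d k * (2 * x k * x j * (x k + x j)) := by
    simp only [hess, mul_sub, Finset.sum_sub_distrib, mul_ite, mul_zero, Finset.sum_ite_eq',
      Finset.mem_univ, if_true]
  have := h (lift6 v) (coeffSub i)
  simp only [Algebra.algebraMap_self, RingHom.id_apply, this]
  simp only [lift6, Fin.sum_univ_six]
  push_cast
  ring

lemma hessianAt_vanStratenQuintic (v : Fin 5 → ℂ) (i k : Fin 5) :
    hessianAt vanStratenQuintic v i k =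
      hess (lift6 v) i.castSucc k.castSucc - hess (lift6 v) (Fin.last 5) k.castSucc -
      (hess (lift6 v) i.castSucc (Fin.last 5) - hess (lift6 v) (Fin.last 5) (Fin.last 5)) := by
  simp [hessianAt, pderiv_vanStratenQuintic, eval_pderiv_grad]

lemma hessianAt_mulVec (v u : Fin 5 → ℂ) (i : Fin 5) :
    (hessianAt vanStratenQuintic v).mulVec u i =
      ∑ k, hess (lift6 v) i.castSucc k * lift6 u k -
        ∑ k, hess (lift6 v) (Fin.last 5) k * lift6 u k := by
  simp only [Matrix.mulVec, dotProduct, hessianAt_vanStratenQuintic, Fin.sum_univ_five,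
    Fin.sum_univ_six, lift6_eq u]
  simp
  ring

/-- The Hessian at `x` is nondegenerate on the hyperplane `∑ y_i = 0` modulo the line of `x`. -/
def IsNondegenerate (x : Fin 6 → ℂ) : Prop :=
  ∀ y : Fin 6 → ℂ, ∑ k, y k = 0 →
    (∀ i, ∑ k, hess x i k * y k = ∑ k, hess x (Fin.last 5) k * y k) → ∃ t : ℂ, y = t • x

lemma IsNondegenerate.smul_comp {w : Fin 6 → ℂ} (hw : IsNondegenerate w) {a : ℂ} (ha : a ≠ 0)
    (π : Equiv.Perm (Fin 6)) : IsNondegenerate (a • w ∘ π) := by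
  have hess_eq (i k) : hess (a • w ∘ π) i k = a ^ 3 * hess w (π i) (π k) := by
    have hs (n : ℕ) : ∑ l, (a • w ∘ π) l ^ n = a ^ n * ∑ l, w l ^ n := by
      rw [← Equiv.sum_comp π fun l => w l ^ n, Finset.mul_sum]
      simp [mul_pow]
    simp only [hess, hs, π.injective.eq_iff]
    split_ifs <;> simp <;> ring
  intro y hy h
  have key (i) : ∑ k, hess (a • w ∘ π) i k * y k =
      a ^ 3 * ∑ k, hess w (π i) k * (y ∘ π.symm) k := by
    rw [← Equiv.sum_comp π fun k => hess w (π i) k * (y ∘ π.symm) k, Finset.mul_sum]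
    simp [hess_eq, mul_assoc]
  simp only [key, mul_right_inj' (pow_ne_zero 3 ha)] at h
  obtain ⟨t, ht⟩ := hw (y ∘ π.symm) (by rw [← hy, ← Equiv.sum_comp π]; simp) fun i => by
    rw [← π.apply_symm_apply i, h, ← h (π.symm (Fin.last 5)), π.apply_symm_apply]
  refine ⟨t / a, ?_⟩
  funext i
  have := congrFun ht (π i)
  simp at this
  simp [this]
  field_simp

lemma sum_hess_mul (x y : Fin 6 → ℂ) (i : Fin 6) : ∑ k, hess x i k * y k =
    (4 * x i ^ 3 - 2 * (∑ l, x l ^ 2) * x i - 2 / 3 * ∑ l, x l ^ 3) * y i -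
      2 * x i ^ 2 * ∑ k, x k * y k - 2 * x i * ∑ k, x k ^ 2 * y k := by
  simp only [hess, sub_mul, ite_mul, zero_mul, Finset.sum_sub_distrib, Finset.sum_ite_eq,
    Finset.mem_univ, if_true, Finset.mul_sum]
  rw [sub_sub _ (∑ k, _), ← Finset.sum_add_distrib]
  congr 1
  exact Finset.sum_congr rfl fun k _ => by ring

lemma isNondegenerate_A {s : ℂ} (hs : s ^ 2 = -3) :
    IsNondegenerate ![s, -s, 1, 1, -1, -1] := by
  intro y hy h
  have hs0 : s ≠ 0 := by rintro rfl; norm_num at hs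
  simp only [sum_hess_mul] at h
  have h0 := h 0
  have h1 := h 1
  have h2 := h 2
  have h3 := h 3
  have h4 := h 4
  simp [Fin.sum_univ_six] at hy h0 h1 h2 h3 h4
  have e3 : y 3 = y 2 := by grind
  have e5 : y 4 = y 5 := by grind
  have e1 : y 1 = - y 0 := by grind
  have e4 : y 5 = - y 2 := by grind
  have e0 : y 0 = s * y 2 := by grind
  refine ⟨y 2, funext fun i => ?_⟩
  fin_cases i <;> simp <;> grind

lemma isNondegenerate_B : IsNondegenerate ![1, 1, 1, -1, -1, -1] := by
  intro y hy h
  simp only [sum_hess_mul] at h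
  have h0 := h 0
  have h1 := h 1
  have h2 := h 2
  have h3 := h 3
  have h4 := h 4
  simp [Fin.sum_univ_six] at hy h0 h1 h2 h3 h4
  have e1 : y 1 = y 0 := by grind
  have e2 : y 2 = y 0 := by grind
  have e3 : y 3 = y 5 := by grind
  have e4 : y 4 = y 5 := by grind
  refine ⟨y 0, funext fun i => ?_⟩
  fin_cases i <;> simp <;> grind

lemma isNondegenerate_C {s : ℂ} (hs : s ^ 2 = -3) :
    IsNondegenerate ![-2 + s, -2 - s, 1, 1, 1, 1] := by
  intro y hy h
  have hs0 : s ≠ 0 := by rintro rfl; norm_num at hs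
  simp only [sum_hess_mul] at h
  have h0 := h 0
  have h1 := h 1
  have h2 := h 2
  have h3 := h 3
  have h4 := h 4
  simp [Fin.sum_univ_six] at hy h0 h1 h2 h3 h4
  have e2 : y 2 = y 5 := by grind
  have e3 : y 3 = y 5 := by grind
  have e4 : y 4 = y 5 := by grind
  have e0 : s * (y 0 - y 1) = -6 * y 5 := by grind
  refine ⟨y 5, funext fun i => ?_⟩
  fin_cases i <;> simp <;> grind

lemma rank_hessianAt {v : Fin 5 → ℂ} (hv : v ≠ 0) (hn : IsNondegenerate (lift6 v))
    (hsing : ∀ i, eval v (pderiv i vanStratenQuintic) = 0) :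
    (hessianAt vanStratenQuintic v).rank = 4 := by
  have hker : LinearMap.ker (hessianAt vanStratenQuintic v).mulVecLin = ℂ ∙ v := by
    ext u
    rw [LinearMap.mem_ker, Submodule.mem_span_singleton, Matrix.mulVecLin_apply]
    constructor
    · intro hu
      have h (i : Fin 5) := (hessianAt_mulVec v u i).symm.trans (congrFun hu i)
      obtain ⟨t, ht⟩ := hn (lift6 u) (sum_lift6 u) (by
        intro i
        refine Fin.lastCases rfl (fun i => sub_eq_zero.mp (h i)) i)
      refine ⟨t, ?_⟩
      funext i
      have := congrFun ht i.castSucc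
      rw [lift6_eq, lift6_eq] at this
      fin_cases i <;> simpa using this.symm
    · rintro ⟨t, rfl⟩
      have hvv : (hessianAt vanStratenQuintic v).mulVec v = 0 := by
        funext i
        have h := hsing i
        rw [eval_pderiv_vanStratenQuintic] at h
        rw [hessianAt_mulVec, sum_hess_mul, sum_hess_mul]
        simp only [grad, Algebra.algebraMap_self, RingHom.id_apply] at h
        simp only [← pow_succ, ← sq, Pi.zero_apply]
        linear_combination 4 * h
      rw [Matrix.mulVec_smul, hvv, smul_zero]
  have := LinearMap.finrank_range_add_finrank_ker (hessianAt vanStratenQuintic v).mulVecLin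
  rw [hker, finrank_span_singleton hv] at this
  rw [Matrix.rank]
  simpa using this

lemma exists_roots_quartic (b c d : ℂ) :
    ∃ r : Fin 4 → ℂ, ∀ t, t ^ 4 + b * t ^ 2 + c * t + d = ∏ j, (t - r j) := by
  let P : Polynomial ℂ := .X ^ 4 + .C b * .X ^ 2 + .C c * .X + .C d
  have hd : P.natDegree = 4 := by simp only [P]; compute_degree!
  have hm : P.Monic := by simp only [P]; monicity!
  have hs := IsAlgClosed.splits P
  have hc : P.roots.card = 4 := hs.natDegree_eq_card_roots.symm.trans hd
  obtain ⟨a₀, ha₀⟩ := Multiset.card_pos_iff_exists_mem.mp (hc ▸ four_pos)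
  obtain ⟨s, hs₀⟩ := Multiset.exists_cons_of_mem ha₀
  have hs' : s.card = 3 := by simpa [hs₀] using hc
  obtain ⟨a₁, a₂, a₃, rfl⟩ := Multiset.card_eq_three.mp hs'
  refine ⟨![a₀, a₁, a₂, a₃], fun t => ?_⟩
  have := congrArg (Polynomial.eval t) (hs.eq_prod_roots_of_monic hm)
  rw [hs₀] at this
  simpa [P, Fin.prod_univ_four, mul_assoc] using this

lemma exists_perm_comp_eq {f g : Fin 6 → Fin 4}
    (h : ∀ j, Fintype.card {i // f i = j} = Fintype.card {i // g i = j}) :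
    ∃ π : Equiv.Perm (Fin 6), ∀ i, f i = g (π i) :=
  ⟨Equiv.ofFiberEquiv fun j => Fintype.equivOfCardEq (h j),
    fun i => (Equiv.ofFiberEquiv_map _ i).symm⟩

lemma partition_six_cases {m0 m1 m2 m3 : ℕ} (h01 : m1 ≤ m0) (h12 : m2 ≤ m1) (h23 : m3 ≤ m2)
    (hsum : m0 + m1 + m2 + m3 = 6) :
    (m0 = 6 ∧ m1 = 0 ∧ m2 = 0 ∧ m3 = 0) ∨ (m0 = 5 ∧ m1 = 1 ∧ m2 = 0 ∧ m3 = 0) ∨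
      (m0 = 4 ∧ m1 = 2 ∧ m2 = 0 ∧ m3 = 0) ∨ (m0 = 4 ∧ m1 = 1 ∧ m2 = 1 ∧ m3 = 0) ∨
      (m0 = 3 ∧ m1 = 3 ∧ m2 = 0 ∧ m3 = 0) ∨ (m0 = 3 ∧ m1 = 2 ∧ m2 = 1 ∧ m3 = 0) ∨
      (m0 = 3 ∧ m1 = 1 ∧ m2 = 1 ∧ m3 = 1) ∨ (m0 = 2 ∧ m1 = 2 ∧ m2 = 2 ∧ m3 = 0) ∨
      (m0 = 2 ∧ m1 = 2 ∧ m2 = 1 ∧ m3 = 1) := by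
  have h3 : m3 ≤ 1 := by omega
  have h2 : m2 ≤ 2 := by omega
  have h1 : m1 ≤ 3 := by omega
  obtain rfl : m0 = 6 - m1 - m2 - m3 := by omega
  interval_cases m3 <;> interval_cases m2 <;> interval_cases m1 <;> simp_all

lemma weighted_roots_cases {m0 m1 m2 m3 : ℕ} {a b c d : ℂ}
    (h01 : m1 ≤ m0) (h12 : m2 ≤ m1) (h23 : m3 ≤ m2)
    (hsum : m0 + m1 + m2 + m3 = 6) (hr : a + b + c + d = 0)
    (h₁ : m0 * a + m1 * b + m2 * c + m3 * d = 0)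
    (h₂ : 2 * (m0 * a ^ 2 + m1 * b ^ 2 + m2 * c ^ 2 + m3 * d ^ 2) =
      a ^ 2 + b ^ 2 + c ^ 2 + d ^ 2)
    (h₃ : 2 * (m0 * a ^ 3 + m1 * b ^ 3 + m2 * c ^ 3 + m3 * d ^ 3) =
      a ^ 3 + b ^ 3 + c ^ 3 + d ^ 3) :
    ((0 < m0 → a = 0) ∧ (0 < m1 → b = 0) ∧ (0 < m2 → c = 0) ∧ (0 < m3 → d = 0)) ∨
    a ≠ 0 ∧ ∃ s : ℂ, s ^ 2 = -3 ∧
      ((m0 = 2 ∧ m1 = 2 ∧ m2 = 1 ∧ m3 = 1) ∧ b = -a ∧ c = a * s ∧ d = -(a * s) ∨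
       (m0 = 3 ∧ m1 = 3 ∧ m2 = 0 ∧ m3 = 0) ∧ b = -a ∨
       (m0 = 4 ∧ m1 = 1 ∧ m2 = 1 ∧ m3 = 0) ∧ b = a * (-2 + s) ∧ c = a * (-2 - s)) := by
  obtain ⟨s, hs⟩ : ∃ s : ℂ, s ^ 2 = -3 := IsAlgClosed.exists_pow_nat_eq _ two_pos
  have cube {z : ℂ} (h : z ^ 3 = 0) : z = 0 := pow_eq_zero_iff three_ne_zero |>.mp h
  have sq0 {z : ℂ} (h : z ^ 2 = 0) : z = 0 := pow_eq_zero_iff two_ne_zero |>.mp h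
  rcases partition_six_cases h01 h12 h23 hsum with h | h | h | h | h | h | h | h | h <;>
    obtain ⟨rfl, rfl, rfl, rfl⟩ := h <;> norm_num at h₁ h₂ h₃
  · simp [h₁]
  · have hb : b = -5 * a := by linear_combination h₁
    have hd : d = 4 * a - c := by linear_combination hr - hb
    subst hb hd
    have ha : a = 0 := cube (by grind)
    simp [ha]
  · have hb : b = -2 * a := by linear_combination h₁ / 2
    have hd : d = a - c := by linear_combination hr - hb
    subst hb hd
    have ha : a = 0 := cube (by grind)
    simp [ha]
  · have hd : d = 3 * a := by linear_combination hr - h₁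
    have hc : c = -4 * a - b := by linear_combination h₁
    subst hd hc
    have hprod : (b + 2 * a - a * s) * (b + 2 * a + a * s) = 0 := by grind
    by_cases ha : a = 0
    · left
      subst ha
      have hb : b = 0 := sq0 (by grind)
      simp [hb]
    · right
      rcases mul_eq_zero.mp hprod with h | h
      · exact ⟨ha, s, hs, .inr <| .inr ⟨by simp, by linear_combination h, by linear_combination -h⟩⟩
      · exact ⟨ha, -s, by rw [neg_sq, hs], .inr <| .inr ⟨by simp, by linear_combination h,
          by linear_combination -h⟩⟩
  · have hb : b = -a := by linear_combination h₁ / 3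
    subst hb
    by_cases ha : a = 0
    · simp [ha]
    · exact Or.inr ⟨ha, s, hs, .inr <| .inl ⟨by simp, rfl⟩⟩
  · have hd : d = 2 * a + b := by linear_combination hr - h₁
    have hc : c = -3 * a - 2 * b := by linear_combination h₁
    subst hd hc
    have hq : 5 * a ^ 2 + 4 * a * b + 3 * b ^ 2 = 0 := by linear_combination h₂ / 2
    have hprod : (a + b) ^ 2 * (5 * a + b) = 0 := by linear_combination -h₃ / 6
    have ha : a = 0 := by
      rcases mul_eq_zero.mp hprod with h | h
      · have := sq0 h
        exact sq0 (by grind)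
      · exact sq0 (by grind)
    subst ha
    have hb : b = 0 := sq0 (by grind)
    simp [hb]
  · have ha : a = 0 := by linear_combination (h₁ - hr) / 2
    subst ha
    have hb : b = 0 := cube (by grind)
    have hc : c = 0 := cube (by grind)
    have hd : d = 0 := cube (by grind)
    simp [hb, hc, hd]
  · have hd : d = 0 := by linear_combination hr - h₁ / 2
    subst hd
    have ha : a = 0 := cube (by grind)
    have hb : b = 0 := cube (by grind)
    have hc : c = 0 := cube (by grind)
    simp [ha, hb, hc]
  · have hb : b = -a := by linear_combination h₁ - hr
    have hd : d = -c := by linear_combination hr - hb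
    subst hb hd
    have hprod : (c - a * s) * (c + a * s) = 0 := by grind
    by_cases ha : a = 0
    · left
      subst ha
      have hc : c = 0 := sq0 (by grind)
      simp [hc]
    · right
      rcases mul_eq_zero.mp hprod with h | h
      · exact ⟨ha, s, hs, .inl ⟨by simp, rfl, by linear_combination h, by linear_combination -h⟩⟩
      · exact ⟨ha, -s, by rw [neg_sq, hs], .inl ⟨by simp, rfl, by linear_combination h,
          by linear_combination -h⟩⟩

/-- If `x` takes values among the `r j`, the `r j` may be ordered by decreasing multiplicity. -/
lemma exists_sorted_fibers {x : Fin 6 → ℂ} {r : Fin 4 → ℂ} (h : ∀ i, ∃ j, x i = r j) :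
    ∃ (τ : Equiv.Perm (Fin 4)) (f : Fin 6 → Fin 4), (∀ i, x i = r (τ (f i))) ∧
      Antitone fun j => Fintype.card {i // f i = j} := by
  choose f hf using h
  let m : Fin 4 → ℕᵒᵈ := fun j => OrderDual.toDual (Fintype.card {i // f i = j})
  refine ⟨Tuple.sort m, (Tuple.sort m).symm ∘ f, by simp [hf], fun i j hij => ?_⟩
  have := Tuple.monotone_sort m hij
  simpa [m, Equiv.symm_apply_eq] using this

/-- Up to scaling and permutation of coordinates, there are three kinds of singular points. -/
lemma exists_smul_comp_perm {x : Fin 6 → ℂ} (hx : x ≠ 0) (hsum : ∑ i, x i = 0)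
    (hg : ∀ i, grad x i = grad x (Fin.last 5)) :
    ∃ (a : ℂ) (π : Equiv.Perm (Fin 6)) (s : ℂ), a ≠ 0 ∧ s ^ 2 = -3 ∧
      (x = a • ![s, -s, 1, 1, -1, -1] ∘ π ∨ x = a • ![1, 1, 1, -1, -1, -1] ∘ π ∨
        x = a • ![-2 + s, -2 - s, 1, 1, 1, 1] ∘ π) := by
  obtain ⟨r₀, hr₀⟩ := exists_roots_quartic (-∑ l, x l ^ 2) (-(2 / 3 * ∑ l, x l ^ 3))
    (-grad x (Fin.last 5))
  obtain ⟨τ, f, hf, hm⟩ := exists_sorted_fibers (x := x) (r := r₀) fun i => by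
    have h := hr₀ (x i)
    rw [← hg i] at h
    have h0 : ∏ j, (x i - r₀ j) = 0 := by
      rw [← h]
      simp only [grad, Algebra.algebraMap_self, RingHom.id_apply]
      ring
    obtain ⟨j, -, hj⟩ := Finset.prod_eq_zero_iff.mp h0
    exact ⟨j, sub_eq_zero.mp hj⟩
  obtain ⟨r, rfl⟩ : ∃ r, r₀ = r ∘ τ.symm := ⟨r₀ ∘ τ, by funext; simp⟩
  have hr (t : ℂ) := (hr₀ t).trans (Equiv.prod_comp τ.symm fun j => t - r j)
  simp only [Function.comp_apply, Equiv.symm_apply_apply] at hf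
  have hpow (k : ℕ) : ∑ i, x i ^ k = ∑ j, Fintype.card {i // f i = j} * r j ^ k := by
    rw [← Finset.sum_fiberwise Finset.univ f]
    refine Finset.sum_congr rfl fun j _ => ?_
    rw [Finset.sum_congr rfl (g := fun _ => r j ^ k) fun i hi => by
      rw [hf, (Finset.mem_filter.mp hi).2]]
    simp [Fintype.card_subtype]
  have hcard : ∑ j, Fintype.card {i // f i = j} = 6 := by
    have := hpow 0
    simp only [pow_zero, mul_one, Finset.sum_const, Finset.card_univ, Fintype.card_fin,
      nsmul_eq_mul] at this
    exact_mod_cast this.symm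
  obtain ⟨m, hm_eq⟩ : ∃ m : Fin 4 → ℕ, ∀ j, Fintype.card {i // f i = j} = m j := ⟨_, fun _ => rfl⟩
  simp only [hm_eq] at hpow hcard hm
  have e1 := hpow 1
  simp only [pow_one, hsum] at e1
  rw [hpow 2, hpow 3] at hr
  have hr0 := hr 0
  have hr1 := hr 1
  have hr2 := hr (-1)
  have hr3 := hr 2
  have hr4 := hr (-2)
  simp only [Fin.prod_univ_four, Fin.sum_univ_four] at hr0 hr1 hr2 hr3 hr4 hcard e1
  have E1 : r 0 + r 1 + r 2 + r 3 = 0 := by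
    linear_combination (hr3 - hr4 - 2 * (hr1 - hr2)) / 12
  have E2 : r 0 * r 1 + r 0 * r 2 + r 0 * r 3 + r 1 * r 2 + r 1 * r 3 + r 2 * r 3 =
      -(m 0 * r 0 ^ 2 + m 1 * r 1 ^ 2 + m 2 * r 2 ^ 2 + m 3 * r 3 ^ 2) := by
    linear_combination -(hr1 + hr2 - 2 * hr0) / 2
  have E3 : r 0 * r 1 * r 2 + r 0 * r 1 * r 3 + r 0 * r 2 * r 3 + r 1 * r 2 * r 3 =
      2 / 3 * (m 0 * r 0 ^ 3 + m 1 * r 1 ^ 3 + m 2 * r 2 ^ 3 + m 3 * r 3 ^ 3) := by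
    linear_combination (hr1 - hr2) / 2 - E1
  have reindex {g : Fin 6 → Fin 4} (hg : ∀ j, Fintype.card {i // g i = j} = m j) :
      ∃ π : Equiv.Perm (Fin 6), ∀ i, x i = r (g (π i)) := by
    obtain ⟨π, hπ⟩ := exists_perm_comp_eq fun j => (hm_eq j).trans (hg j).symm
    exact ⟨π, fun i => by rw [hf, hπ]⟩
  rcases weighted_roots_cases (hm (by decide : (0 : Fin 4) ≤ 1)) (hm (by decide : (1 : Fin 4) ≤ 2))
    (hm (by decide : (2 : Fin 4) ≤ 3)) hcard E1 e1.symm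
    (by linear_combination 2 * E2 - (r 0 + r 1 + r 2 + r 3) * E1)
    (by linear_combination -3 * E3 - ((r 0 + r 1 + r 2 + r 3) ^ 2 -
      3 * (r 0 * r 1 + r 0 * r 2 + r 0 * r 3 + r 1 * r 2 + r 1 * r 3 + r 2 * r 3)) * E1) with
    ⟨z0, z1, z2, z3⟩ | ⟨ha, s, hs, h⟩
  · refine absurd (_root_.funext fun i => ?_) hx
    have hpos : 0 < m (f i) := by
      rw [← hm_eq]
      exact Fintype.card_pos_iff.mpr ⟨⟨i, rfl⟩⟩
    rw [hf i]
    generalize f i = j at hpos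
    fin_cases j
    exacts [z0 hpos, z1 hpos, z2 hpos, z3 hpos]
  have hm' : m = ![m 0, m 1, m 2, m 3] := by
    funext j
    fin_cases j <;> rfl
  rcases h with ⟨⟨k0, k1, k2, k3⟩, h1, h2, h3⟩ | ⟨⟨k0, k1, k2, k3⟩, h1⟩ |
    ⟨⟨k0, k1, k2, k3⟩, h1, h2⟩ <;> beta_reduce at k0 k1 k2 k3 <;> rw [k0, k1, k2, k3] at hm'
  · obtain ⟨π, hπ⟩ := reindex (g := ![2, 3, 0, 0, 1, 1]) (by rw [hm']; decide)
    refine ⟨r 0, π, s, ha, hs, .inl (_root_.funext fun i => ?_)⟩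
    rw [hπ]
    simp only [Pi.smul_apply, Function.comp_apply]
    generalize π i = k
    fin_cases k <;> simp [h1, h2, h3]
  · obtain ⟨π, hπ⟩ := reindex (g := ![0, 0, 0, 1, 1, 1]) (by rw [hm']; decide)
    refine ⟨r 0, π, s, ha, hs, .inr <| .inl (_root_.funext fun i => ?_)⟩
    rw [hπ]
    simp only [Pi.smul_apply, Function.comp_apply]
    generalize π i = k
    fin_cases k <;> simp [h1]
  · obtain ⟨π, hπ⟩ := reindex (g := ![1, 2, 0, 0, 0, 0]) (by rw [hm']; decide)
    refine ⟨r 0, π, s, ha, hs, .inr <| .inr (_root_.funext fun i => ?_)⟩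
    rw [hπ]
    simp only [Pi.smul_apply, Function.comp_apply]
    generalize π i = k
    fin_cases k <;> simp [h1, h2]

/-- A scalar multiple of `u` with first coordinate `21`, when the norm of `u 0` divides `21`. -/
def rescale (u : Fin 6 → ℤ√(-3)) : Fin 6 → ℤ√(-3) :=
  fun m => u m * (star (u 0) * ((21 / (u 0).norm : ℤ) : ℤ√(-3)))

/-- The vector with `√-3`, `-√-3`, `1`, `1` in positions `i`, `j`, `k`, `l`, and `-1` elsewhere. -/
def vecA (i j k l : Fin 6) : Fin 6 → ℤ√(-3) := fun m =>
  if m = i then ⟨0, 1⟩ else if m = j then ⟨0, -1⟩ else if m = k ∨ m = l then 1 else -1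

/-- The vector with `1` in positions `i`, `j`, `k`, and `-1` elsewhere. -/
def vecB (i j k : Fin 6) : Fin 6 → ℤ√(-3) := fun m =>
  if m = i ∨ m = j ∨ m = k then 1 else -1

/-- The vector with `-2 + √-3`, `-2 - √-3` in positions `i`, `j`, and `1` elsewhere. -/
def vecC (i j : Fin 6) : Fin 6 → ℤ√(-3) := fun m =>
  if m = i then ⟨-2, 1⟩ else if m = j then ⟨-2, -1⟩ else 1

/-- A set of indices `(i, j, k, l)` such that the vectors `vecA i j k l` represent, once each, the
singular points proportional to a permutation of `(√-3, -√-3, 1, 1, -1, -1)`. -/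
def indexA : Finset (Fin 6 × Fin 6 × Fin 6 × Fin 6) :=
  Finset.univ.filter fun t => t.1 < t.2.1 ∧ t.2.2.1 < t.2.2.2 ∧
    t.2.2.1 ≠ t.1 ∧ t.2.2.1 ≠ t.2.1 ∧ t.2.2.2 ≠ t.1 ∧ t.2.2.2 ≠ t.2.1

/-- A set of indices `(j, k)` such that the vectors `vecB 0 j k` represent, once each, the
singular points proportional to a permutation of `(1, 1, 1, -1, -1, -1)`. -/
def indexB : Finset (Fin 6 × Fin 6) :=
  Finset.univ.filter fun t => 0 < t.1 ∧ t.1 < t.2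

/-- A set of indices `(i, j)` such that the vectors `vecC i j` represent, once each, the
singular points proportional to a permutation of `(-2 + √-3, -2 - √-3, 1, 1, 1, 1)`. -/
def indexC : Finset (Fin 6 × Fin 6) :=
  Finset.univ.filter fun t => t.1 ≠ t.2

/-- Representatives of the singular points, normalised to have first coordinate `21`. -/
def singularVectors : Finset (Fin 6 → ℤ√(-3)) :=
  (indexA.image fun t => rescale (vecA t.1 t.2.1 t.2.2.1 t.2.2.2)) ∪
  (indexB.image fun t => rescale (vecB 0 t.1 t.2)) ∪
  (indexC.image fun t => rescale (vecC t.1 t.2))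

/-- A numerical code separating the elements of `singularVectors`. -/
def vectorCode (u : Fin 6 → ℤ√(-3)) : ℕ :=
  (List.ofFn u).foldl (fun a z => a * 40000 + ((z.re + 100) * 200 + z.im + 100).toNat) 0

lemma card_singularVectors : singularVectors.card = 130 := by
  refine le_antisymm ?_ (le_trans (le_of_eq ?_) (Finset.card_image_le (f := vectorCode)))
  · have hA : indexA.card = 90 := by decide +kernel
    have hB : indexB.card = 10 := by decide +kernel
    have hC : indexC.card = 30 := by decide +kernel
    calc singularVectors.card ≤ indexA.card + indexB.card + indexC.card :=
          (Finset.card_union_le _ _).trans <| add_le_add ((Finset.card_union_le _ _).trans <|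
            add_le_add Finset.card_image_le Finset.card_image_le) Finset.card_image_le
      _ = 130 := by rw [hA, hB, hC]
  · simp only [singularVectors, Finset.image_union, Finset.image_image]
    decide +kernel

lemma singularVectors_spec {n : Fin 6 → ℤ√(-3)} (hn : n ∈ singularVectors) :
    n 0 = 21 ∧ ∑ i, n i = 0 ∧
    ∀ i, 3 * n i ^ 4 - 3 * (∑ j, n j ^ 2) * n i ^ 2 - 2 * (∑ j, n j ^ 3) * n i =
      3 * n 5 ^ 4 - 3 * (∑ j, n j ^ 2) * n 5 ^ 2 - 2 * (∑ j, n j ^ 3) * n 5 := by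
  simp only [singularVectors, Finset.mem_union, Finset.mem_image, indexA, indexB, indexC,
    Finset.mem_filter, Finset.mem_univ, true_and] at hn
  obtain (⟨⟨i, j, k, l⟩, h, rfl⟩ | ⟨⟨j, k⟩, h, rfl⟩) | ⟨⟨i, j⟩, h, rfl⟩ := hn
  · revert i j k l
    decide +kernel
  · revert j k
    decide +kernel
  · revert i j
    decide +kernel

section RingHom

variable (φ : ℤ√(-3) →+* ℂ)

lemma map_sqrtd_sq : φ ⟨0, 1⟩ ^ 2 = -3 := by
  rw [← map_pow, show (⟨0, 1⟩ : ℤ√(-3)) ^ 2 = -3 by decide]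
  rw [map_neg, map_ofNat]

lemma map_neg_sqrtd : φ ⟨0, -1⟩ = -φ ⟨0, 1⟩ := by
  rw [← map_neg]
  rfl

lemma exists_eq_smul_rescale {u : Fin 6 → ℤ√(-3)} (h : rescale u ∈ singularVectors) :
    ∃ c : ℂ, φ ∘ u = c • (φ ∘ rescale u) := by
  have h0 := congrArg φ (singularVectors_spec h).1
  simp only [rescale, map_mul] at h0
  set d := φ (star (u 0)) * φ ((21 / (u 0).norm : ℤ) : ℤ√(-3)) with hd
  have hd0 : d ≠ 0 := by
    intro hd0
    rw [hd0, mul_zero, map_ofNat] at h0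
    norm_num at h0
  refine ⟨d⁻¹, ?_⟩
  funext m
  simp only [Function.comp_apply, Pi.smul_apply, rescale, map_mul, ← hd, smul_eq_mul]
  field_simp

lemma map_comp_vecA (π : Equiv.Perm (Fin 6)) :
    φ ∘ vecA (π.symm 0) (π.symm 1) (π.symm 2) (π.symm 3) =
      ![φ ⟨0, 1⟩, -φ ⟨0, 1⟩, 1, 1, -1, -1] ∘ π := by
  funext m
  simp only [Function.comp_apply, vecA, Equiv.eq_symm_apply]
  generalize π m = k
  fin_cases k <;> simp [map_neg_sqrtd]

lemma map_comp_vecB (π : Equiv.Perm (Fin 6)) :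
    φ ∘ vecB (π.symm 0) (π.symm 1) (π.symm 2) = ![1, 1, 1, -1, -1, -1] ∘ π := by
  funext m
  simp only [Function.comp_apply, vecB, Equiv.eq_symm_apply]
  generalize π m = k
  fin_cases k <;> simp

lemma map_comp_vecC (π : Equiv.Perm (Fin 6)) :
    φ ∘ vecC (π.symm 0) (π.symm 1) =
      ![-2 + φ ⟨0, 1⟩, -2 - φ ⟨0, 1⟩, 1, 1, 1, 1] ∘ π := by
  have h1 : φ ⟨-2, 1⟩ = -2 + φ ⟨0, 1⟩ := by
    rw [show (⟨-2, 1⟩ : ℤ√(-3)) = -2 + ⟨0, 1⟩ by decide]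
    rw [map_add, map_neg, map_ofNat]
  have h2 : φ ⟨-2, -1⟩ = -2 - φ ⟨0, 1⟩ := by
    rw [show (⟨-2, -1⟩ : ℤ√(-3)) = -2 - ⟨0, 1⟩ by decide]
    rw [map_sub, map_neg, map_ofNat]
  funext m
  simp only [Function.comp_apply, vecC, Equiv.eq_symm_apply]
  generalize π m = k
  fin_cases k <;> simp [h1, h2]

/-- If permuting the entries of `w` by `σ` multiplies it by `e`, then `π` may be replaced by
`σ ∘ π` in a multiple of `w ∘ π`. -/
lemma exists_smul_comp_trans {w : Fin 6 → ℂ} {e : ℂ} {σ : Equiv.Perm (Fin 6)} (he : e * e = 1)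
    (hσ : w ∘ σ = e • w) (a : ℂ) (π : Equiv.Perm (Fin 6)) :
    a • w ∘ π = (e * a) • w ∘ (π.trans σ) := by
  rw [Equiv.coe_trans, ← Function.comp_assoc, hσ]
  funext m
  simp only [Pi.smul_apply, Function.comp_apply, smul_eq_mul]
  linear_combination -(a * w (π m)) * he

lemma exists_singularVectors_A (a : ℂ) (π : Equiv.Perm (Fin 6)) :
    ∃ n ∈ singularVectors, ∃ c : ℂ,
      a • ![φ ⟨0, 1⟩, -φ ⟨0, 1⟩, 1, 1, -1, -1] ∘ π = c • (φ ∘ n) := by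
  wlog h01 : π.symm 0 < π.symm 1 generalizing a π
  · rw [exists_smul_comp_trans (e := -1)
      (σ := Equiv.swap 0 1 * Equiv.swap 2 4 * Equiv.swap 3 5) (by norm_num)
      (by funext i; fin_cases i <;> simp [Equiv.swap_apply_def])]
    refine this _ _ ?_
    have hne := π.symm.injective.ne (show (0 : Fin 6) ≠ 1 by decide)
    exact lt_of_le_of_ne (not_lt.mp h01) hne.symm
  wlog h23 : π.symm 2 < π.symm 3 generalizing a π
  · rw [exists_smul_comp_trans (e := 1) (σ := Equiv.swap 2 3) (by norm_num)
      (by funext i; fin_cases i <;> simp [Equiv.swap_apply_def])]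
    have hne := π.symm.injective.ne (show (2 : Fin 6) ≠ 3 by decide)
    exact this _ _ h01 (lt_of_le_of_ne (not_lt.mp h23) hne.symm)
  have hmem : rescale (vecA (π.symm 0) (π.symm 1) (π.symm 2) (π.symm 3)) ∈ singularVectors := by
    refine Finset.mem_union_left _ (Finset.mem_union_left _ (Finset.mem_image.mpr
      ⟨(π.symm 0, π.symm 1, π.symm 2, π.symm 3), ?_, rfl⟩))
    simp [indexA, h01, h23]
  obtain ⟨c, hc⟩ := exists_eq_smul_rescale φ hmem
  exact ⟨_, hmem, a * c, by rw [← map_comp_vecA, hc, smul_smul]⟩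

lemma exists_singularVectors_B (a : ℂ) (π : Equiv.Perm (Fin 6)) :
    ∃ n ∈ singularVectors, ∃ c : ℂ, a • ![1, 1, 1, -1, -1, -1] ∘ π = c • (φ ∘ n) := by
  wlog h0 : π.symm 0 = 0 generalizing a π
  · obtain ⟨e, σ, he, hσ, h⟩ : ∃ (e : ℂ) (σ : Equiv.Perm (Fin 6)), e * e = 1 ∧
        (![1, 1, 1, -1, -1, -1] : Fin 6 → ℂ) ∘ σ = e • ![1, 1, 1, -1, -1, -1] ∧ σ (π 0) = 0 := by
      generalize π 0 = k
      fin_cases k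
      · exact ⟨1, 1, by simp⟩
      · exact ⟨1, Equiv.swap 0 1, by norm_num,
          by funext i; fin_cases i <;> simp [Equiv.swap_apply_def], by simp⟩
      · exact ⟨1, Equiv.swap 0 2, by norm_num,
          by funext i; fin_cases i <;> simp [Equiv.swap_apply_def], by simp⟩
      · exact ⟨-1, Equiv.swap 0 3 * Equiv.swap 1 4 * Equiv.swap 2 5, by norm_num,
          by funext i; fin_cases i <;> simp [Equiv.swap_apply_def], by decide⟩
      · exact ⟨-1, Equiv.swap 0 4 * Equiv.swap 1 3 * Equiv.swap 2 5, by norm_num,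
          by funext i; fin_cases i <;> simp [Equiv.swap_apply_def], by decide⟩
      · exact ⟨-1, Equiv.swap 0 5 * Equiv.swap 1 3 * Equiv.swap 2 4, by norm_num,
          by funext i; fin_cases i <;> simp [Equiv.swap_apply_def], by decide⟩
    rw [exists_smul_comp_trans he hσ]
    exact this _ _ (by rw [Equiv.symm_apply_eq]; exact h.symm)
  wlog h12 : π.symm 1 < π.symm 2 generalizing a π
  · rw [exists_smul_comp_trans (e := 1) (σ := Equiv.swap 1 2) (by norm_num)
      (by funext i; fin_cases i <;> simp [Equiv.swap_apply_def])]
    have hne := π.symm.injective.ne (show (1 : Fin 6) ≠ 2 by decide)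
    exact this _ _ h0 (lt_of_le_of_ne (not_lt.mp h12) hne.symm)
  have hmem : rescale (vecB (π.symm 0) (π.symm 1) (π.symm 2)) ∈ singularVectors := by
    refine Finset.mem_union_left _ (Finset.mem_union_right _ (Finset.mem_image.mpr
      ⟨(π.symm 1, π.symm 2), ?_, by rw [h0]⟩))
    simp only [indexB, Finset.mem_filter, Finset.mem_univ, true_and]
    refine ⟨?_, h12⟩
    exact Fin.pos_iff_ne_zero.mpr (by rw [← h0]; exact π.symm.injective.ne (by decide))
  obtain ⟨c, hc⟩ := exists_eq_smul_rescale φ hmem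
  exact ⟨_, hmem, a * c, by rw [← map_comp_vecB φ, hc, smul_smul]⟩

lemma exists_singularVectors_C (a : ℂ) (π : Equiv.Perm (Fin 6)) :
    ∃ n ∈ singularVectors, ∃ c : ℂ,
      a • ![-2 + φ ⟨0, 1⟩, -2 - φ ⟨0, 1⟩, 1, 1, 1, 1] ∘ π = c • (φ ∘ n) := by
  have hmem : rescale (vecC (π.symm 0) (π.symm 1)) ∈ singularVectors := by
    refine Finset.mem_union_right _ (Finset.mem_image.mpr ⟨(π.symm 0, π.symm 1), ?_, rfl⟩)
    simp [indexC]
  obtain ⟨c, hc⟩ := exists_eq_smul_rescale φ hmem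
  exact ⟨_, hmem, a * c, by rw [← map_comp_vecC, hc, smul_smul]⟩

lemma exists_eq_smul_map {x : Fin 6 → ℂ} (hx : x ≠ 0) (hsum : ∑ i, x i = 0)
    (hg : ∀ i, grad x i = grad x (Fin.last 5)) :
    ∃ n ∈ singularVectors, ∃ c : ℂ, x = c • (φ ∘ n) := by
  obtain ⟨a, π, s, -, hs, h⟩ := exists_smul_comp_perm hx hsum hg
  have hs' : s = φ ⟨0, 1⟩ ∨ s = -φ ⟨0, 1⟩ :=
    sq_eq_sq_iff_eq_or_eq_neg.mp (hs.trans (map_sqrtd_sq φ).symm)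
  rcases h with rfl | rfl | rfl
  · rcases hs' with rfl | rfl
    · exact exists_singularVectors_A φ a π
    · have : ![-φ ⟨0, 1⟩, - -φ ⟨0, 1⟩, 1, 1, -1, -1] ∘ π =
          ![φ ⟨0, 1⟩, -φ ⟨0, 1⟩, 1, 1, -1, -1] ∘ (π.trans (Equiv.swap 0 1)) := by
        funext m
        simp only [Function.comp_apply, Equiv.trans_apply]
        generalize π m = k
        fin_cases k <;> simp [Equiv.swap_apply_def]
      rw [this]
      exact exists_singularVectors_A φ a _
  · exact exists_singularVectors_B φ a π
  · rcases hs' with rfl | rfl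
    · exact exists_singularVectors_C φ a π
    · have : ![-2 + -φ ⟨0, 1⟩, -2 - -φ ⟨0, 1⟩, 1, 1, 1, 1] ∘ π =
          ![-2 + φ ⟨0, 1⟩, -2 - φ ⟨0, 1⟩, 1, 1, 1, 1] ∘ (π.trans (Equiv.swap 0 1)) := by
        funext m
        simp only [Function.comp_apply, Equiv.trans_apply]
        generalize π m = k
        fin_cases k <;> simp [Equiv.swap_apply_def, sub_eq_add_neg]
      rw [this]
      exact exists_singularVectors_C φ a _

end RingHom

lemma grad_smul (c : ℂ) (x : Fin 6 → ℂ) (i : Fin 6) : grad (c • x) i = c ^ 4 * grad x i := by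
  simp only [grad, Pi.smul_apply, smul_eq_mul, mul_pow, ← Finset.mul_sum]
  ring

lemma lift6_smul (c : ℂ) (v : Fin 5 → ℂ) : lift6 (c • v) = c • lift6 v := by
  funext i
  fin_cases i <;> simp [lift6_eq]
  ring

lemma lift6_castSucc (v : Fin 5 → ℂ) (i : Fin 5) : lift6 v i.castSucc = v i := by
  fin_cases i <;> simp [lift6_eq]

lemma lift6_ne_zero {v : Fin 5 → ℂ} (hv : v ≠ 0) : lift6 v ≠ 0 := by
  contrapose! hv
  funext i
  rw [← lift6_castSucc v, hv]
  rfl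

lemma lift6_comp_castSucc {x : Fin 6 → ℂ} (hx : ∑ i, x i = 0) :
    lift6 (x ∘ Fin.castSucc) = x := by
  rw [Fin.sum_univ_six] at hx
  funext i
  fin_cases i <;> simp [lift6_eq]
  linear_combination -hx

lemma singular_iff (v : Fin 5 → ℂ) :
    (∀ i, eval v (pderiv i vanStratenQuintic) = 0) ↔
      ∀ i, grad (lift6 v) i = grad (lift6 v) (Fin.last 5) := by
  simp only [eval_pderiv_vanStratenQuintic, sub_eq_zero]
  exact ⟨fun h i => Fin.lastCases rfl h i, fun h i => h _⟩

lemma rank_hessianAt_of_singular {v : Fin 5 → ℂ} (hv : v ≠ 0)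
    (h : ∀ i, eval v (pderiv i vanStratenQuintic) = 0) :
    (hessianAt vanStratenQuintic v).rank = 4 := by
  refine rank_hessianAt hv ?_ h
  obtain ⟨a, π, s, ha, hs, h | h | h⟩ :=
    exists_smul_comp_perm (lift6_ne_zero hv) (sum_lift6 v) ((singular_iff v).mp h) <;> rw [h]
  exacts [(isNondegenerate_A hs).smul_comp ha π, isNondegenerate_B.smul_comp ha π,
    (isNondegenerate_C hs).smul_comp ha π]

lemma isNode_of_mem_projSing {p : ℙ ℂ (Fin 5 → ℂ)} (hp : p ∈ projSing vanStratenQuintic) :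
    IsNode vanStratenQuintic p := by
  refine ⟨hp, fun v hv hpv => rank_hessianAt_of_singular hv ?_⟩
  obtain ⟨w, hw, rfl, hsing⟩ := hp
  obtain ⟨c, rfl⟩ := (Projectivization.mk_eq_mk_iff' ℂ v w hv hw).mp hpv.symm
  rw [singular_iff] at hsing ⊢
  intro i
  rw [lift6_smul, grad_smul, grad_smul, hsing]

section RingHom

variable (φ : ℤ√(-3) →+* ℂ)

lemma map_comp_castSucc_ne_zero {n : Fin 6 → ℤ√(-3)} (hn : n ∈ singularVectors) :
    φ ∘ n ∘ Fin.castSucc ≠ 0 := fun h => by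
  have h0 := congrFun h 0
  simp only [Function.comp_apply, Fin.castSucc_zero, (singularVectors_spec hn).1,
    map_ofNat, Pi.zero_apply] at h0
  norm_num at h0

lemma lift6_map_comp_castSucc {n : Fin 6 → ℤ√(-3)} (hn : n ∈ singularVectors) :
    lift6 (φ ∘ n ∘ Fin.castSucc) = φ ∘ n :=
  lift6_comp_castSucc (x := φ ∘ n) <| by
    simp only [Function.comp_apply, ← map_sum, (singularVectors_spec hn).2.1, map_zero]

/-- The point of `ℙ⁴` defined by an element of `singularVectors`. -/
noncomputable def singularPoint (n : singularVectors) : ℙ ℂ (Fin 5 → ℂ) :=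
  Projectivization.mk ℂ (φ ∘ n ∘ Fin.castSucc) (map_comp_castSucc_ne_zero φ n.2)

lemma singularPoint_mem (n : singularVectors) : singularPoint φ n ∈ projSing vanStratenQuintic := by
  refine ⟨_, map_comp_castSucc_ne_zero φ n.2, rfl, (singular_iff _).mpr fun i => ?_⟩
  have h := congrArg φ ((singularVectors_spec n.2).2.2 i)
  simp only [map_sub, map_mul, map_pow, map_sum, map_ofNat] at h
  rw [lift6_map_comp_castSucc φ n.2]
  simp only [grad, Function.comp_apply, Algebra.algebraMap_self, RingHom.id_apply]
  change _ = φ (n.1 5) ^ 4 - _ * φ (n.1 5) ^ 2 - _ * φ (n.1 5)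
  linear_combination h / 3

lemma singularPoint_injective (hφ : Function.Injective φ) :
    Function.Injective (singularPoint φ) := by
  intro n m h
  obtain ⟨c, hc⟩ := (Projectivization.mk_eq_mk_iff' ℂ _ _ _ _).mp h
  have h6 := congrArg lift6 hc
  rw [lift6_smul, lift6_map_comp_castSucc φ n.2, lift6_map_comp_castSucc φ m.2] at h6
  have h0 := congrFun h6 0
  simp only [Pi.smul_apply, Function.comp_apply, (singularVectors_spec n.2).1,
    (singularVectors_spec m.2).1, map_ofNat, smul_eq_mul] at h0
  obtain rfl : c = 1 := by linear_combination h0 / 21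
  rw [one_smul] at h6
  exact Subtype.ext (hφ.comp_left h6.symm)

lemma range_singularPoint : Set.range (singularPoint φ) = projSing vanStratenQuintic := by
  refine (Set.range_subset_iff.mpr (singularPoint_mem φ)).antisymm ?_
  rintro _ ⟨v, hv, rfl, h⟩
  obtain ⟨n, hn, c, hc⟩ :=
    exists_eq_smul_map φ (lift6_ne_zero hv) (sum_lift6 v) ((singular_iff v).mp h)
  refine ⟨⟨n, hn⟩, ((Projectivization.mk_eq_mk_iff' ℂ _ _ _ _).mpr ⟨c, ?_⟩).symm⟩
  funext i
  rw [← lift6_castSucc v, hc]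
  rfl

end RingHom

lemma exists_injective_ringHom : ∃ φ : ℤ√(-3) →+* ℂ, Function.Injective φ := by
  obtain ⟨s, hs⟩ := IsAlgClosed.exists_pow_nat_eq (-3 : ℂ) (n := 2) (by norm_num)
  refine ⟨Zsqrtd.lift ⟨s, by rw [← sq, hs]; norm_num⟩, Zsqrtd.lift_injective _ fun n h => ?_⟩
  nlinarith [mul_self_nonneg n]

/-- The quintic hypersurface `{Q = 0} ⊂ ℙ⁴(ℂ)` has exactly `130` singular points, and
each of them is a node. -/
theorem van_straten_quintic_has_130_nodes :
    (projSing vanStratenQuintic).Finite ∧ (projSing vanStratenQuintic).ncard = 130 ∧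
    ∀ p ∈ projSing vanStratenQuintic, IsNode vanStratenQuintic p := by
  obtain ⟨φ, hφ⟩ := exists_injective_ringHom
  refine ⟨?_, ?_, fun p => isNode_of_mem_projSing⟩
  · rw [← range_singularPoint φ]
    exact Set.finite_range _
  · rw [← range_singularPoint φ, ← Set.image_univ,
      Set.ncard_image_of_injective _ (singularPoint_injective φ hφ), Set.ncard_univ,
      Nat.card_eq_fintype_card, Fintype.card_coe, card_singularVectors]
end

section
/- The abelianization of SL(2,ℤ), i.e. the quotient of SL(2,ℤ) by its commutator subgroup, is isomorphic to the cyclic group ℤ/12ℤ. -/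
/-- The polynomial in the entries of a matrix of `SL(2,ℤ)` whose class modulo `12` is the
abelianization character. -/
def abelianizationPoly {R : Type*} [CommRing R] (a b c d : R) : R :=
  (1 - c ^ 2) * (b * d + 3 * (c - 1) * d + c + 3) + c * (a + d - 3)

theorem abelianizationPoly_mul_T_zmod_three : ∀ a b c d : ZMod 3, a * d - b * c = 1 →
    abelianizationPoly a (a + b) c (c + d) = abelianizationPoly a b c d + 1 := by
  unfold abelianizationPoly
  decide

theorem abelianizationPoly_mul_S_zmod_three : ∀ a b c d : ZMod 3, a * d - b * c = 1 →
    abelianizationPoly b (-a) d (-c) = abelianizationPoly a b c d - 3 := by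
  unfold abelianizationPoly
  decide

theorem abelianizationPoly_mul_T_zmod_four : ∀ a b c d : ZMod 4, a * d - b * c = 1 →
    abelianizationPoly a (a + b) c (c + d) = abelianizationPoly a b c d + 1 := by
  unfold abelianizationPoly
  decide +kernel

theorem abelianizationPoly_mul_S_zmod_four : ∀ a b c d : ZMod 4, a * d - b * c = 1 →
    abelianizationPoly b (-a) d (-c) = abelianizationPoly a b c d - 3 := by
  unfold abelianizationPoly
  decide +kernel

theorem ZMod.intCast_twelve_eq_of_three_of_four {x y : ℤ} (h3 : (x : ZMod 3) = y)
    (h4 : (x : ZMod 4) = y) : (x : ZMod 12) = y := by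
  have h3' := (ZMod.intCast_eq_intCast_iff_dvd_sub _ _ 3).1 h3
  have h4' := (ZMod.intCast_eq_intCast_iff_dvd_sub _ _ 4).1 h4
  refine (ZMod.intCast_eq_intCast_iff_dvd_sub _ _ 12).2 ?_
  push_cast at *
  omega

namespace Matrix.SpecialLinearGroup

open ModularGroup

/-- The abelianization character of `SL(2,ℤ)`, as a function to `ℤ/12ℤ`. -/
def toZModTwelve (g : SpecialLinearGroup (Fin 2) ℤ) : ZMod 12 :=
  (abelianizationPoly (g 0 0) (g 0 1) (g 1 0) (g 1 1) : ℤ)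

theorem toZModTwelve_mul_T (g : SpecialLinearGroup (Fin 2) ℤ) :
    toZModTwelve (g * T) = toZModTwelve g + 1 := by
  have hdet : g 0 0 * g 1 1 - g 0 1 * g 1 0 = 1 := by
    rw [← Matrix.det_fin_two]; exact g.det_coe
  have key : ((abelianizationPoly (g 0 0) (g 0 0 + g 0 1) (g 1 0) (g 1 0 + g 1 1) : ℤ) : ZMod 12)
      = (abelianizationPoly (g 0 0) (g 0 1) (g 1 0) (g 1 1) + 1 : ℤ) := by
    apply ZMod.intCast_twelve_eq_of_three_of_four
    · have := abelianizationPoly_mul_T_zmod_three (g 0 0) (g 0 1) (g 1 0) (g 1 1)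
        (by exact_mod_cast congrArg (Int.cast : ℤ → ZMod 3) hdet)
      simpa [abelianizationPoly] using this
    · have := abelianizationPoly_mul_T_zmod_four (g 0 0) (g 0 1) (g 1 0) (g 1 1)
        (by exact_mod_cast congrArg (Int.cast : ℤ → ZMod 4) hdet)
      simpa [abelianizationPoly] using this
  have e0 : (g * T) 0 0 = g 0 0 := by
    simp [coe_T, Matrix.mul_apply, Fin.sum_univ_two]
  have e1 : (g * T) 0 1 = g 0 0 + g 0 1 := by
    simp [coe_T, Matrix.mul_apply, Fin.sum_univ_two]
  have e2 : (g * T) 1 0 = g 1 0 := by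
    simp [coe_T, Matrix.mul_apply, Fin.sum_univ_two]
  have e3 : (g * T) 1 1 = g 1 0 + g 1 1 := by
    simp [coe_T, Matrix.mul_apply, Fin.sum_univ_two]
  rw [toZModTwelve, e0, e1, e2, e3, key]
  simp [toZModTwelve]

theorem toZModTwelve_mul_S (g : SpecialLinearGroup (Fin 2) ℤ) :
    toZModTwelve (g * S) = toZModTwelve g - 3 := by
  have hdet : g 0 0 * g 1 1 - g 0 1 * g 1 0 = 1 := by
    rw [← Matrix.det_fin_two]; exact g.det_coe
  have key : ((abelianizationPoly (g 0 1) (-g 0 0) (g 1 1) (-g 1 0) : ℤ) : ZMod 12)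
      = (abelianizationPoly (g 0 0) (g 0 1) (g 1 0) (g 1 1) - 3 : ℤ) := by
    apply ZMod.intCast_twelve_eq_of_three_of_four
    · have := abelianizationPoly_mul_S_zmod_three (g 0 0) (g 0 1) (g 1 0) (g 1 1)
        (by exact_mod_cast congrArg (Int.cast : ℤ → ZMod 3) hdet)
      simpa [abelianizationPoly] using this
    · have := abelianizationPoly_mul_S_zmod_four (g 0 0) (g 0 1) (g 1 0) (g 1 1)
        (by exact_mod_cast congrArg (Int.cast : ℤ → ZMod 4) hdet)
      simpa [abelianizationPoly] using this
  have e0 : (g * S) 0 0 = g 0 1 := by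
    simp [coe_S, Matrix.mul_apply, Fin.sum_univ_two]
  have e1 : (g * S) 0 1 = -g 0 0 := by
    simp [coe_S, Matrix.mul_apply, Fin.sum_univ_two]
  have e2 : (g * S) 1 0 = g 1 1 := by
    simp [coe_S, Matrix.mul_apply, Fin.sum_univ_two]
  have e3 : (g * S) 1 1 = -g 1 0 := by
    simp [coe_S, Matrix.mul_apply, Fin.sum_univ_two]
  rw [toZModTwelve, e0, e1, e2, e3, key]
  simp [toZModTwelve]

theorem toZModTwelve_one : toZModTwelve 1 = 0 := by
  simp [toZModTwelve, abelianizationPoly]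

theorem toZModTwelve_T : toZModTwelve T = 1 := by
  simpa [toZModTwelve_one] using toZModTwelve_mul_T 1

theorem toZModTwelve_S : toZModTwelve S = -3 := by
  simpa [toZModTwelve_one] using toZModTwelve_mul_S 1

theorem toZModTwelve_mul (g h : SpecialLinearGroup (Fin 2) ℤ) :
    toZModTwelve (g * h) = toZModTwelve g + toZModTwelve h := by
  have hh : h ∈ Subgroup.closure {S, T} := by simp [SpecialLinearGroup.SL2Z_generators]
  induction hh using Subgroup.closure_induction generalizing g with
  | mem x hx =>
    rcases hx with rfl | rfl
    · rw [toZModTwelve_mul_S, toZModTwelve_S, sub_eq_add_neg]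
    · rw [toZModTwelve_mul_T, toZModTwelve_T]
  | one => simp [toZModTwelve_one]
  | mul x y _ _ hx hy => rw [← mul_assoc, hy, hx, hy x, add_assoc]
  | inv x _ hx =>
    have h1 := hx (g * x⁻¹)
    have h2 := hx x⁻¹
    rw [inv_mul_cancel_right] at h1
    rw [inv_mul_cancel, toZModTwelve_one] at h2
    linear_combination h2 - h1

/-- The abelianization character of `SL(2,ℤ)`, sending `T` to `1 : ℤ/12ℤ`. -/
def abelianizationChar : SpecialLinearGroup (Fin 2) ℤ →* Multiplicative (ZMod 12) where
  toFun g := Multiplicative.ofAdd (toZModTwelve g)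
  map_one' := by rw [toZModTwelve_one]; rfl
  map_mul' g h := by rw [toZModTwelve_mul]; rfl

theorem abelianization_S_mul_T_pow_three :
    Abelianization.of S * Abelianization.of T ^ 3 = 1 := by
  have h : (S * T) ^ 3 = S ^ 2 := by decide
  have h' := congrArg Abelianization.of h
  rw [map_pow, map_mul, map_pow, mul_pow, pow_succ _ 2, mul_assoc] at h'
  exact mul_eq_left.1 h'

theorem abelianization_T_pow_twelve : (Abelianization.of T) ^ 12 = 1 := by
  have h : S ^ 4 = 1 := by decide
  have h' := congrArg Abelianization.of h
  rw [map_pow, map_one] at h'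
  calc (Abelianization.of T) ^ 12
      = (Abelianization.of S) ^ 4 * (Abelianization.of T ^ 3) ^ 4 := by
        rw [h', one_mul, ← pow_mul]
    _ = 1 := by rw [← mul_pow, abelianization_S_mul_T_pow_three, one_pow]

theorem abelianization_mem_zpowers_T (g : SpecialLinearGroup (Fin 2) ℤ) :
    Abelianization.of g ∈ Subgroup.zpowers (Abelianization.of T) := by
  have hg : g ∈ Subgroup.closure {S, T} := by simp [SpecialLinearGroup.SL2Z_generators]
  have hle : Subgroup.closure {S, T} ≤
      (Subgroup.zpowers (Abelianization.of T)).comap Abelianization.of := by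
    rw [Subgroup.closure_le]
    rintro x (rfl | rfl)
    · change Abelianization.of S ∈ Subgroup.zpowers (Abelianization.of T)
      rw [eq_inv_of_mul_eq_one_left abelianization_S_mul_T_pow_three]
      exact inv_mem (pow_mem (Subgroup.mem_zpowers _) 3)
    · exact Subgroup.mem_zpowers _
  exact hle hg

theorem lift_abelianizationChar_zpow (n : ℤ) :
    Abelianization.lift abelianizationChar (Abelianization.of T ^ n) =
      Multiplicative.ofAdd (n : ZMod 12) := by
  rw [map_zpow, Abelianization.lift_apply_of]
  change Multiplicative.ofAdd (toZModTwelve T) ^ n = _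
  rw [toZModTwelve_T, ← ofAdd_zsmul, zsmul_one]

end Matrix.SpecialLinearGroup

open Matrix.SpecialLinearGroup in
theorem lift_abelianizationChar_bijective :
    Function.Bijective (Abelianization.lift abelianizationChar) := by
  constructor
  · rw [injective_iff_map_eq_one]
    intro x hx
    obtain ⟨g, rfl⟩ := QuotientGroup.mk_surjective x
    obtain ⟨n, hn⟩ := abelianization_mem_zpowers_T g
    change Abelianization.of g = 1
    change Abelianization.lift abelianizationChar (Abelianization.of g) = 1 at hx
    rw [← hn] at hx ⊢
    simp only at hx ⊢
    rw [lift_abelianizationChar_zpow, ofAdd_eq_one, ZMod.intCast_zmod_eq_zero_iff_dvd] at hx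
    obtain ⟨k, rfl⟩ := hx
    rw [zpow_mul]
    have := abelianization_T_pow_twelve
    rw [show ((12 : ℕ) : ℤ) = 12 from rfl]
    rw [show Abelianization.of ModularGroup.T ^ (12 : ℤ) = 1 from mod_cast this, one_zpow]
  · intro y
    obtain ⟨n, hn⟩ := ZMod.intCast_surjective y.toAdd
    exact ⟨_, (lift_abelianizationChar_zpow n).trans (congrArg Multiplicative.ofAdd hn)⟩

/-- The abelianization of `SL(2,ℤ)` is isomorphic to the cyclic group `ℤ/12ℤ`. -/
theorem abelianization_SL2Z_iso_zmod12 :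
    Nonempty (Abelianization (Matrix.SpecialLinearGroup (Fin 2) ℤ) ≃*
      Multiplicative (ZMod 12)) :=
  ⟨MulEquiv.ofBijective _ lift_abelianizationChar_bijective⟩
end
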